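/- Let 𝔥 be a complex Hilbert space which is either infinite dimensional or of finite dimension greater than two, and let d be a decoherence functional for 𝔥. Then d can be extended (uniquely) to a bounded bilinear form D : B(𝔥) × B(𝔥) → ℂ with D(p,q) = d(p,q) for all projections p,q if, and only if, d is bounded. -/

import Mathlib

/- Common background definitions: decoherence functionals on the projection
lattice of a complex Hilbert space, boundedness/additivity notions, trace class
operators, and an axiomatisation of the Hilbert space tensor product
`𝔥 ⊗ 𝔥` together with the operator tensor product. -/

noncomputable section

open scoped ComplexInnerProductSpace ComplexOrder
open ContinuousLinearMap

universe u

variable {E : Type u} [NormedAddCommGroup E] [InnerProductSpace ℂ E] [CompleteSpace E]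
variable {G : Type u} [NormedAddCommGroup G] [InnerProductSpace ℂ G] [CompleteSpace G]

/-- `p` is an orthogonal projection on a Hilbert space. -/
def IsOrthoProj (p : E →L[ℂ] E) : Prop :=
  IsIdempotentElem p ∧ IsSelfAdjoint p

/-- `p` is an operator of finite rank. -/
def HasFiniteRank (p : E →L[ℂ] E) : Prop :=
  FiniteDimensional ℂ ↥(LinearMap.range (p : E →ₗ[ℂ] E))

/-- A decoherence functional on the lattice of projections `P(𝔥)`
(modelled as a function on all pairs of bounded operators whose defining
properties refer only to its values at pairs of orthogonal projections). -/
structure IsDecoherenceFunctional (d : (E →L[ℂ] E) → (E →L[ℂ] E) → ℂ) : Prop where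
  hermitian : ∀ p q, IsOrthoProj p → IsOrthoProj q → d p q = starRingEnd ℂ (d q p)
  pos : ∀ p, IsOrthoProj p → 0 ≤ d p p
  normalized : d 1 1 = 1
  orthoadd : ∀ p₁ p₂ q, IsOrthoProj p₁ → IsOrthoProj p₂ → IsOrthoProj q →
    p₁ * p₂ = 0 → d (p₁ + p₂) q = d p₁ q + d p₂ q

/-- A decoherence functional is bounded if `{|d(p,q)|}` is a bounded set. -/
def DFBounded (d : (E →L[ℂ] E) → (E →L[ℂ] E) → ℂ) : Prop :=
  ∃ C : ℝ, ∀ p q, IsOrthoProj p → IsOrthoProj q → ‖d p q‖ ≤ C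

/-- Countable additivity of a decoherence functional: for every countable
pairwise orthogonal family of projections summing (strongly) to `P`,
`d (P, q) = ∑ d (pᵢ, q)`. -/
def DFCountablyAdditive (d : (E →L[ℂ] E) → (E →L[ℂ] E) → ℂ) : Prop :=
  ∀ (p : ℕ → E →L[ℂ] E) (P q : E →L[ℂ] E),
    (∀ i, IsOrthoProj (p i)) → IsOrthoProj P → IsOrthoProj q →
    (∀ i j, i ≠ j → p i * p j = 0) →
    (∀ x : E, HasSum (fun i => p i x) (P x)) →
    HasSum (fun i => d (p i) q) (d P q)

/-- Complete additivity of a decoherence functional. -/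
def DFCompletelyAdditive (d : (E →L[ℂ] E) → (E →L[ℂ] E) → ℂ) : Prop :=
  ∀ (ι : Type u) (p : ι → E →L[ℂ] E) (P q : E →L[ℂ] E),
    (∀ i, IsOrthoProj (p i)) → IsOrthoProj P → IsOrthoProj q →
    (∀ i j, i ≠ j → p i * p j = 0) →
    (∀ x : E, HasSum (fun i => p i x) (P x)) →
    HasSum (fun i => d (p i) q) (d P q)

/-- A bilinear form `D` on `B(𝔥) × B(𝔥)` is bounded. -/
def IsBoundedBilinear (D : (E →L[ℂ] E) →ₗ[ℂ] (E →L[ℂ] E) →ₗ[ℂ] ℂ) : Prop :=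
  ∃ C : ℝ, ∀ x y : E →L[ℂ] E, ‖D x y‖ ≤ C * ‖x‖ * ‖y‖

/-- The bilinear form `D` extends the decoherence functional `d`. -/
def ExtendsDF (D : (E →L[ℂ] E) →ₗ[ℂ] (E →L[ℂ] E) →ₗ[ℂ] ℂ)
    (d : (E →L[ℂ] E) → (E →L[ℂ] E) → ℂ) : Prop :=
  ∀ p q, IsOrthoProj p → IsOrthoProj q → D p q = d p q

/-- `T` is a trace class operator (via the standard characterisation: the sums
`∑ |⟪eᵢ, T fᵢ⟫|` over finite orthonormal families are uniformly bounded). -/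
def IsTraceClass (T : E →L[ℂ] E) : Prop :=
  ∃ C : ℝ, ∀ (n : ℕ) (e f : Fin n → E), Orthonormal ℂ e → Orthonormal ℂ f →
    ∑ i, ‖⟪e i, T (f i)⟫‖ ≤ C

/-- The trace of an operator computed in the Hilbert basis `b` (for a trace
class operator this is basis independent and is the usual trace). -/
def traceAlong {ι : Type*} (b : HilbertBasis ι ℂ E) (T : E →L[ℂ] E) : ℂ :=
  ∑' i, ⟪b i, T (b i)⟫

/-- The rank one orthogonal projection `p_ξ` onto the span of a unit vector `ξ`. -/
def rankOneProj (ξ : E) : E →L[ℂ] E :=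
  (innerSL ℂ ξ).smulRight ξ

/-- An axiomatisation of the Hilbert space tensor product `G = E ⊗ E`:
a bilinear map `tmul` into `G` multiplying inner products and having dense span. -/
structure HilbertTensorProduct (E G : Type u) [NormedAddCommGroup E]
    [InnerProductSpace ℂ E] [NormedAddCommGroup G] [InnerProductSpace ℂ G] :
    Type u where
  tmul : E →ₗ[ℂ] E →ₗ[ℂ] G
  inner_tmul : ∀ a b c d : E, ⟪tmul a b, tmul c d⟫ = ⟪a, c⟫ * ⟪b, d⟫
  dense_span : Dense (↑(Submodule.span ℂ (Set.range fun z : E × E => tmul z.1 z.2)) : Set G)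

/-- The algebraic tensor product `E ⊗_alg E`, viewed as a (dense) subspace of `G`. -/
def HilbertTensorProduct.algSpan (J : HilbertTensorProduct E G) : Submodule ℂ G :=
  Submodule.span ℂ (Set.range fun z : E × E => J.tmul z.1 z.2)

/-- The Hilbert space tensor product together with the operator tensor product
`(x, y) ↦ x ⊗ y` on bounded operators. -/
structure OperatorTensor (E G : Type u) [NormedAddCommGroup E]
    [InnerProductSpace ℂ E] [NormedAddCommGroup G] [InnerProductSpace ℂ G]
    extends HilbertTensorProduct E G where
  op : (E →L[ℂ] E) → (E →L[ℂ] E) → (G →L[ℂ] G)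
  op_tmul : ∀ (x y : E →L[ℂ] E) (a b : E), op x y (tmul a b) = tmul (x a) (y b)

/-- The algebraic tensor product `K(𝔥) • K(𝔥)`: the span in `B(G)` of the
operators `x ⊗ y` with `x, y` compact. -/
def OperatorTensor.compactSpan (J : OperatorTensor E G) : Submodule ℂ (G →L[ℂ] G) :=
  Submodule.span ℂ {T | ∃ x y : E →L[ℂ] E,
    IsCompactOperator (⇑x) ∧ IsCompactOperator (⇑y) ∧ T = J.op x y}

/-- `β` is the linear functional on `K(𝔥) • K(𝔥)` induced by the bilinear form
`D`, i.e. `β (x ⊗ y) = D (x, y)` for compact `x, y`. -/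
def IsBetaFor (J : OperatorTensor E G)
    (D : (E →L[ℂ] E) →ₗ[ℂ] (E →L[ℂ] E) →ₗ[ℂ] ℂ)
    (β : ↥J.compactSpan →ₗ[ℂ] ℂ) : Prop :=
  ∀ x y : E →L[ℂ] E, IsCompactOperator (⇑x) → IsCompactOperator (⇑y) →
    ∀ hm : J.op x y ∈ J.compactSpan, β ⟨J.op x y, hm⟩ = D x y

/-- `β` is bounded for the operator norm (inherited from `B(G)`). -/
def BetaNormBounded (J : OperatorTensor E G) (β : ↥J.compactSpan →ₗ[ℂ] ℂ) : Prop :=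
  ∃ C : ℝ, ∀ S : J.compactSpan, ‖β S‖ ≤ C * ‖(S : G →L[ℂ] G)‖

/-- A decoherence functional is tensor bounded if its associated functional `β`
on `K(𝔥) • K(𝔥)` is bounded for the (pre-)C*-norm. -/
def IsTensorBounded (J : OperatorTensor E G)
    (d : (E →L[ℂ] E) → (E →L[ℂ] E) → ℂ) : Prop :=
  ∃ D, IsBoundedBilinear D ∧ ExtendsDF D d ∧
    ∃ β, IsBetaFor J D β ∧ BetaNormBounded J β

/-- `β` is uniformly bounded on the projections `p_ξ`, `ξ` a unit vector of the
algebraic tensor product `𝔥 ⊗_alg 𝔥`. -/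
def BetaTraciallyBounded (J : OperatorTensor E G) (β : ↥J.compactSpan →ₗ[ℂ] ℂ) : Prop :=
  ∃ C : ℝ, ∀ ξ : G, ξ ∈ J.toHilbertTensorProduct.algSpan → ‖ξ‖ = 1 →
    ∀ hm : rankOneProj ξ ∈ J.compactSpan, ‖β ⟨rankOneProj ξ, hm⟩‖ ≤ C

/-- A decoherence functional is tracially bounded if it is bounded and its
associated functional `β` is uniformly bounded on rank one projections `p_ξ`
with `ξ` a unit vector in `𝔥 ⊗_alg 𝔥`. -/
def IsTraciallyBounded (J : OperatorTensor E G)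
    (d : (E →L[ℂ] E) → (E →L[ℂ] E) → ℂ) : Prop :=
  DFBounded d ∧ ∃ D, IsBoundedBilinear D ∧ ExtendsDF D d ∧
    ∃ β, IsBetaFor J D β ∧ BetaTraciallyBounded J β

section partA

/-! ## Frame functions over a parameter space -/

abbrev E3 := EuclideanSpace ℝ (Fin 3)

def mk3 (a b c : ℝ) : E3 := !₂[a, b, c]

lemma inner_mk3 (a b c a' b' c' : ℝ) :
    inner ℝ (mk3 a b c) (mk3 a' b' c') = a * a' + b * b' + c * c' := by
  simp [mk3, PiLp.inner_apply, Fin.sum_univ_three]; ring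

lemma mk3_norm_sq (a b c : ℝ) : ‖mk3 a b c‖ ^ 2 = a ^ 2 + b ^ 2 + c ^ 2 := by
  rw [← real_inner_self_eq_norm_sq, inner_mk3]; ring

lemma mk3_ne {a b c : ℝ} (h : 0 < a ^ 2 + b ^ 2 + c ^ 2) : mk3 a b c ≠ 0 := by
  intro h0
  rw [← mk3_norm_sq, h0] at h
  simp at h

lemma mk3_eta (x : E3) : mk3 (x 0) (x 1) (x 2) = x := by
  ext i; fin_cases i <;> rfl

@[fun_prop]
lemma continuous_mk3 {Ω : Type*} [TopologicalSpace Ω] {a b c : Ω → ℝ} (ha : Continuous a)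
    (hb : Continuous b) (hc : Continuous c) : Continuous fun ω => mk3 (a ω) (b ω) (c ω) := by
  unfold mk3
  apply (PiLp.continuous_toLp 2 _).comp
  refine continuous_pi fun i => ?_
  fin_cases i <;> simpa

structure Frame {Ω : Type*} [TopologicalSpace Ω] (u v x : Ω → E3) : Prop where
  cu : Continuous u
  cv : Continuous v
  cx : Continuous x
  nu : ∀ ω, u ω ≠ 0
  nv : ∀ ω, v ω ≠ 0
  nx : ∀ ω, x ω ≠ 0
  uv : ∀ ω, inner ℝ (u ω) (v ω) = 0
  ux : ∀ ω, inner ℝ (u ω) (x ω) = 0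
  vx : ∀ ω, inner ℝ (v ω) (x ω) = 0

lemma Frame.rot {Ω : Type*} [TopologicalSpace Ω] {u v x : Ω → E3} (h : Frame u v x) :
    Frame v x u :=
  ⟨h.cv, h.cx, h.cu, h.nv, h.nx, h.nu, h.vx, fun ω => by rw [real_inner_comm]; exact h.uv ω,
    fun ω => by rw [real_inner_comm]; exact h.ux ω⟩

lemma Frame.swap {Ω : Type*} [TopologicalSpace Ω] {u v x : Ω → E3} (h : Frame u v x) :
    Frame v u x :=
  ⟨h.cv, h.cu, h.cx, h.nv, h.nu, h.nx, fun ω => by rw [real_inner_comm]; exact h.uv ω,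
    h.vx, h.ux⟩

/-- `f` is a bounded frame function. -/
structure FF {Ω : Type*} [TopologicalSpace Ω] (f : (Ω → E3) → ℝ) (B w : ℝ) : Prop where
  bdd : ∀ u, Continuous u → (∀ ω, u ω ≠ 0) → |f u| ≤ B
  frame : ∀ u v x, Frame u v x → f u + f v + f x = w

section lemK

variable {Ω : Type*} [TopologicalSpace Ω]

lemma frame_mk {a b c a' b' c' a'' b'' c'' : Ω → ℝ}
    (h1 : Continuous a) (h2 : Continuous b) (h3 : Continuous c)
    (h1' : Continuous a') (h2' : Continuous b') (h3' : Continuous c')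
    (h1'' : Continuous a'') (h2'' : Continuous b'') (h3'' : Continuous c'')
    (n : ∀ ω, 0 < a ω ^ 2 + b ω ^ 2 + c ω ^ 2)
    (n' : ∀ ω, 0 < a' ω ^ 2 + b' ω ^ 2 + c' ω ^ 2)
    (n'' : ∀ ω, 0 < a'' ω ^ 2 + b'' ω ^ 2 + c'' ω ^ 2)
    (o : ∀ ω, a ω * a' ω + b ω * b' ω + c ω * c' ω = 0)
    (o' : ∀ ω, a ω * a'' ω + b ω * b'' ω + c ω * c'' ω = 0)
    (o'' : ∀ ω, a' ω * a'' ω + b' ω * b'' ω + c' ω * c'' ω = 0) :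
    Frame (fun ω => mk3 (a ω) (b ω) (c ω)) (fun ω => mk3 (a' ω) (b' ω) (c' ω))
      (fun ω => mk3 (a'' ω) (b'' ω) (c'' ω)) := by
  refine ⟨by fun_prop, by fun_prop, by fun_prop, fun ω => mk3_ne (n ω), fun ω => mk3_ne (n' ω),
    fun ω => mk3_ne (n'' ω), ?_, ?_, ?_⟩ <;> intro ω <;> rw [inner_mk3]
  · exact o ω
  · exact o' ω
  · exact o'' ω

def kf (D : (Ω → E3) → ℝ) (d : ℝ) (a b c : Ω → ℝ) : ℝ :=
  D (fun ω => mk3 (a ω) (b ω) (c ω)) + D (fun ω => mk3 (a ω) (- c ω) (b ω)) + d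

variable {D : (Ω → E3) → ℝ} {M d : ℝ}

lemma kf_frame (hfr : ∀ u v x, Frame u v x → D u + D v + D x = 0)
    {a b c a' b' c' a'' b'' c'' : Ω → ℝ}
    (h1 : Continuous a) (h2 : Continuous b) (h3 : Continuous c)
    (h1' : Continuous a') (h2' : Continuous b') (h3' : Continuous c')
    (h1'' : Continuous a'') (h2'' : Continuous b'') (h3'' : Continuous c'')
    (n : ∀ ω, 0 < a ω ^ 2 + b ω ^ 2 + c ω ^ 2)
    (n' : ∀ ω, 0 < a' ω ^ 2 + b' ω ^ 2 + c' ω ^ 2)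
    (n'' : ∀ ω, 0 < a'' ω ^ 2 + b'' ω ^ 2 + c'' ω ^ 2)
    (o : ∀ ω, a ω * a' ω + b ω * b' ω + c ω * c' ω = 0)
    (o' : ∀ ω, a ω * a'' ω + b ω * b'' ω + c ω * c'' ω = 0)
    (o'' : ∀ ω, a' ω * a'' ω + b' ω * b'' ω + c' ω * c'' ω = 0) :
    kf D d a b c + kf D d a' b' c' + kf D d a'' b'' c'' = 3 * d := by
  have e1 := hfr _ _ _ (frame_mk h1 h2 h3 h1' h2' h3' h1'' h2'' h3'' n n' n'' o o' o'')
  have e2 := hfr _ _ _ (frame_mk (a := a) (b := fun ω => - c ω) (c := b)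
    (a' := a') (b' := fun ω => - c' ω) (c' := b') (a'' := a'') (b'' := fun ω => - c'' ω) (c'' := b'')
    h1 (by fun_prop) h2 h1' (by fun_prop) h2' h1'' (by fun_prop) h2''
    (fun ω => by nlinarith [n ω]) (fun ω => by nlinarith [n' ω]) (fun ω => by nlinarith [n'' ω])
    (fun ω => by linarith [o ω]) (fun ω => by linarith [o' ω]) (fun ω => by linarith [o'' ω]))
  unfold kf
  linarith

lemma kf_eq (hfr : ∀ u v x, Frame u v x → D u + D v + D x = 0)
    (hd : D (fun _ => mk3 1 0 0) = d) {b c : Ω → ℝ} (hb : Continuous b) (hc : Continuous c)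
    (n : ∀ ω, 0 < b ω ^ 2 + c ω ^ 2) : kf D d (fun _ => 0) b c = 0 := by
  have e1 := hfr _ _ _ (frame_mk (a := fun _ => 1) (b := fun _ => 0) (c := fun _ => 0)
    (a' := fun _ => 0) (b' := b) (c' := c) (a'' := fun _ => 0) (b'' := fun ω => - c ω) (c'' := b)
    (by fun_prop) (by fun_prop) (by fun_prop) (by fun_prop) hb hc (by fun_prop) (by fun_prop) hb
    (fun ω => by norm_num) (fun ω => by nlinarith [n ω]) (fun ω => by nlinarith [n ω])
    (fun ω => by ring) (fun ω => by ring) (fun ω => by ring))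
  unfold kf
  rw [hd] at e1
  linarith

lemma kf_lower (hfr : ∀ u v x, Frame u v x → D u + D v + D x = 0)
    (hM : ∀ u v x, Frame u v x → D u ≤ M)
    (hd : D (fun _ => mk3 1 0 0) = d) {a b c : Ω → ℝ} (ha : Continuous a) (hb : Continuous b)
    (hc : Continuous c) (n : ∀ ω, 0 < b ω ^ 2 + c ω ^ 2) : - (2 * (M - d)) ≤ kf D d a b c := by
  have hn1 : ∀ ω, 0 < a ω ^ 2 + b ω ^ 2 + c ω ^ 2 := fun ω => by nlinarith [n ω]
  have hn2 : ∀ ω, 0 < (0:ℝ) ^ 2 + (- c ω) ^ 2 + b ω ^ 2 := fun ω => by nlinarith [n ω]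
  have hn3 : ∀ ω, 0 < (b ω ^ 2 + c ω ^ 2) ^ 2 + (- (a ω * b ω)) ^ 2 + (- (a ω * c ω)) ^ 2 :=
    fun ω => by have := n ω; positivity
  have F := frame_mk (a := a) (b := b) (c := c)
    (a' := fun _ => 0) (b' := fun ω => - c ω) (c' := b)
    (a'' := fun ω => b ω ^ 2 + c ω ^ 2) (b'' := fun ω => - (a ω * b ω)) (c'' := fun ω => - (a ω * c ω))
    (by fun_prop) (by fun_prop) (by fun_prop) (by fun_prop) (by fun_prop) (by fun_prop)
    (by fun_prop) (by fun_prop) (by fun_prop) hn1 hn2 hn3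
    (fun ω => by ring) (fun ω => by ring) (fun ω => by ring)
  have F2 := frame_mk (a := a) (b := fun ω => - c ω) (c := b)
    (a' := fun _ => 0) (b' := fun ω => - b ω) (c' := fun ω => - c ω)
    (a'' := fun ω => b ω ^ 2 + c ω ^ 2) (b'' := fun ω => - - (a ω * c ω)) (c'' := fun ω => - (a ω * b ω))
    (by fun_prop) (by fun_prop) (by fun_prop) (by fun_prop) (by fun_prop) (by fun_prop)
    (by fun_prop) (by fun_prop) (by fun_prop) (fun ω => by nlinarith [n ω])
    (fun ω => by nlinarith [n ω]) (fun ω => by have := n ω; positivity)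
    (fun ω => by ring) (fun ω => by ring) (fun ω => by ring)
  have k1 := kf_frame (d := d) hfr (a := a) (b := b) (c := c)
    (a' := fun _ => 0) (b' := fun ω => - c ω) (c' := b)
    (a'' := fun ω => b ω ^ 2 + c ω ^ 2) (b'' := fun ω => - (a ω * b ω)) (c'' := fun ω => - (a ω * c ω))
    (by fun_prop) (by fun_prop) (by fun_prop) (by fun_prop) (by fun_prop) (by fun_prop)
    (by fun_prop) (by fun_prop) (by fun_prop) hn1 hn2 hn3
    (fun ω => by ring) (fun ω => by ring) (fun ω => by ring)
  have k2 := kf_eq hfr hd (b := fun ω => - c ω) (c := b) (by fun_prop) hb (fun ω => by nlinarith [n ω])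
  have m1 := hM _ _ _ F.rot.rot
  have m2 := hM _ _ _ F2.rot.rot
  have k3 : kf D d (fun ω => b ω ^ 2 + c ω ^ 2) (fun ω => - (a ω * b ω)) (fun ω => - (a ω * c ω))
      ≤ 2 * M + d := by
    unfold kf; linarith
  linarith

/-- one descent step -/
lemma kf_desc (hfr : ∀ u v x, Frame u v x → D u + D v + D x = 0)
    (hM : ∀ u v x, Frame u v x → D u ≤ M)
    (hd : D (fun _ => mk3 1 0 0) = d) {b c t : Ω → ℝ} (hb : Continuous b)
    (hc : Continuous c) (ht : Continuous t) (n : ∀ ω, 0 < b ω ^ 2 + c ω ^ 2) :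
    kf D d (fun _ => 1) (fun ω => b ω - t ω * c ω) (fun ω => c ω + t ω * b ω) ≤
      kf D d (fun _ => 1) b c + 2 * (M - d) := by
  have hn1 : ∀ ω, 0 < (1:ℝ) ^ 2 + b ω ^ 2 + c ω ^ 2 := fun ω => by nlinarith [n ω]
  have hn2 : ∀ ω, 0 < (0:ℝ) ^ 2 + (- c ω) ^ 2 + b ω ^ 2 := fun ω => by nlinarith [n ω]
  have hn3 : ∀ ω, 0 < (b ω ^ 2 + c ω ^ 2) ^ 2 + (- b ω) ^ 2 + (- c ω) ^ 2 :=
    fun ω => by have := n ω; positivity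
  have k1 := kf_frame (d := d) hfr (a := fun _ => 1) (b := b) (c := c)
    (a' := fun _ => 0) (b' := fun ω => - c ω) (c' := b)
    (a'' := fun ω => b ω ^ 2 + c ω ^ 2) (b'' := fun ω => - b ω) (c'' := fun ω => - c ω)
    (by fun_prop) (by fun_prop) (by fun_prop) (by fun_prop) (by fun_prop) (by fun_prop)
    (by fun_prop) (by fun_prop) (by fun_prop) hn1 hn2 hn3
    (fun ω => by ring) (fun ω => by ring) (fun ω => by ring)
  have key : ∀ ω, 0 < (t ω * (b ω ^ 2 + c ω ^ 2) * b ω + (1 + b ω ^ 2 + c ω ^ 2) * c ω) ^ 2 +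
      (t ω * (b ω ^ 2 + c ω ^ 2) * c ω - (1 + b ω ^ 2 + c ω ^ 2) * b ω) ^ 2 := fun ω => by
    have := n ω
    have e : (t ω * (b ω ^ 2 + c ω ^ 2) * b ω + (1 + b ω ^ 2 + c ω ^ 2) * c ω) ^ 2 +
      (t ω * (b ω ^ 2 + c ω ^ 2) * c ω - (1 + b ω ^ 2 + c ω ^ 2) * b ω) ^ 2 =
      (b ω ^ 2 + c ω ^ 2) * ((t ω * (b ω ^ 2 + c ω ^ 2)) ^ 2 + (1 + (b ω ^ 2 + c ω ^ 2)) ^ 2) := by ring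
    rw [e]; positivity
  have k2 := kf_frame (d := d) hfr (a := fun _ => 1) (b := fun ω => b ω - t ω * c ω)
    (c := fun ω => c ω + t ω * b ω)
    (a' := fun ω => t ω * (b ω ^ 2 + c ω ^ 2))
    (b' := fun ω => t ω * (b ω ^ 2 + c ω ^ 2) * b ω + (1 + b ω ^ 2 + c ω ^ 2) * c ω)
    (c' := fun ω => t ω * (b ω ^ 2 + c ω ^ 2) * c ω - (1 + b ω ^ 2 + c ω ^ 2) * b ω)
    (a'' := fun ω => b ω ^ 2 + c ω ^ 2) (b'' := fun ω => - b ω) (c'' := fun ω => - c ω)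
    (by fun_prop) (by fun_prop) (by fun_prop) (by fun_prop) (by fun_prop) (by fun_prop)
    (by fun_prop) (by fun_prop) (by fun_prop) (fun ω => by positivity)
    (fun ω => by have := key ω; nlinarith [sq_nonneg (t ω * (b ω ^ 2 + c ω ^ 2))]) hn3
    (fun ω => by ring) (fun ω => by ring) (fun ω => by ring)
  have k3 := kf_eq hfr hd (b := fun ω => - c ω) (c := b) (by fun_prop) hb (fun ω => by nlinarith [n ω])
  have k4 := kf_lower hfr hM hd (a := fun ω => t ω * (b ω ^ 2 + c ω ^ 2))
    (b := fun ω => t ω * (b ω ^ 2 + c ω ^ 2) * b ω + (1 + b ω ^ 2 + c ω ^ 2) * c ω)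
    (c := fun ω => t ω * (b ω ^ 2 + c ω ^ 2) * c ω - (1 + b ω ^ 2 + c ω ^ 2) * b ω)
    (by fun_prop) (by fun_prop) (by fun_prop) key
  linarith

/-- complex version of a descent step -/
lemma kf_descC (hfr : ∀ u v x, Frame u v x → D u + D v + D x = 0)
    (hM : ∀ u v x, Frame u v x → D u ≤ M)
    (hd : D (fun _ => mk3 1 0 0) = d) {z : Ω → ℂ} {t : Ω → ℝ} (hz : Continuous z)
    (ht : Continuous t) (n : ∀ ω, z ω ≠ 0) :
    kf D d (fun _ => 1) (fun ω => (z ω * (1 + t ω * Complex.I)).re)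
      (fun ω => (z ω * (1 + t ω * Complex.I)).im) ≤
      kf D d (fun _ => 1) (fun ω => (z ω).re) (fun ω => (z ω).im) + 2 * (M - d) := by
  have := kf_desc hfr hM hd (b := fun ω => (z ω).re) (c := fun ω => (z ω).im) (t := t)
    (by fun_prop) (by fun_prop) ht (fun ω => by
      have := Complex.normSq_pos.2 (n ω)
      rw [Complex.normSq_apply] at this; nlinarith)
  convert this using 2
  · ext ω; simp; ring
  · ext ω; simp; ring

lemma kf_desc4 (hfr : ∀ u v x, Frame u v x → D u + D v + D x = 0)
    (hM : ∀ u v x, Frame u v x → D u ≤ M)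
    (hd : D (fun _ => mk3 1 0 0) = d) {z y : Ω → ℂ} (hz : Continuous z) (hy : Continuous y)
    (n : ∀ ω, z ω ≠ 0) (hy2 : ∀ ω, 2 ≤ ‖y ω‖ + (y ω).re) :
    kf D d (fun _ => 1) (fun ω => (z ω * y ω).re) (fun ω => (z ω * y ω).im) ≤
      kf D d (fun _ => 1) (fun ω => (z ω).re) (fun ω => (z ω).im) + 8 * (M - d) := by
  set S : Ω → ℝ := fun ω => ‖y ω‖ + (y ω).re with hS
  have hSc : Continuous S := by fun_prop
  have hSne : ∀ ω, S ω ≠ 0 := fun ω => by have := hy2 ω; simp only [hS]; linarith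
  set t : Ω → ℝ := fun ω => (y ω).im / S ω with ht
  have htc : Continuous t := (by fun_prop : Continuous fun ω => (y ω).im).div hSc hSne
  set s : Ω → ℝ := fun ω => Real.sqrt (S ω / 2 - 1) with hs
  have hsc : Continuous s := by fun_prop
  have nI : ∀ r : ℝ, (1 + r * Complex.I : ℂ) ≠ 0 := fun r h => by
    have := congrArg Complex.re h; simp at this
  have ee : ∀ ω, z ω * y ω = z ω * (1 + t ω * Complex.I) * (1 + t ω * Complex.I) *
      (1 + s ω * Complex.I) * (1 + ((- s ω : ℝ) : ℂ) * Complex.I) := by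
    intro ω
    have h1 : (1 + s ω * Complex.I) * (1 + ((- s ω : ℝ) : ℂ) * Complex.I) = ((S ω / 2 : ℝ) : ℂ) := by
      have : (s ω) ^ 2 = S ω / 2 - 1 := Real.sq_sqrt (by have := hy2 ω; simp only [hS]; linarith)
      have h2 : ((s ω : ℝ) : ℂ) ^ 2 = ((S ω / 2 - 1 : ℝ) : ℂ) := by rw [← this]; push_cast; rfl
      push_cast at h2 ⊢
      linear_combination h2 - (s ω : ℂ) ^ 2 * Complex.I_sq
    have h3 : (1 + t ω * Complex.I) * (1 + t ω * Complex.I) * ((S ω / 2 : ℝ) : ℂ) = y ω := by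
      have hn : ‖y ω‖ ^ 2 = (y ω).re ^ 2 + (y ω).im ^ 2 := by
        rw [← Complex.normSq_eq_norm_sq, Complex.normSq_apply]; ring
      have hSv : S ω = ‖y ω‖ + (y ω).re := rfl
      have htv : t ω * S ω = (y ω).im := div_mul_cancel₀ _ (hSne ω)
      apply Complex.ext
      · simp
        have : (1 - t ω * t ω) * S ω * S ω = 2 * (y ω).re * S ω := by
          have : (1 - t ω * t ω) * S ω * S ω = S ω ^ 2 - (t ω * S ω) ^ 2 := by ring
          rw [this, htv, hSv]; linear_combination hn
        have := mul_right_cancel₀ (hSne ω) this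
        linarith
      · simp
        linarith
    calc z ω * y ω = z ω * ((1 + t ω * Complex.I) * (1 + t ω * Complex.I) *
        ((1 + s ω * Complex.I) * (1 + ((- s ω : ℝ) : ℂ) * Complex.I))) := by rw [h1, h3]
      _ = _ := by ring
  have hzc1 : Continuous fun ω => z ω * (1 + t ω * Complex.I) := by fun_prop
  have hzc2 : Continuous fun ω => z ω * (1 + t ω * Complex.I) * (1 + t ω * Complex.I) := by fun_prop
  have hzc3 : Continuous fun ω => z ω * (1 + t ω * Complex.I) * (1 + t ω * Complex.I) *
      (1 + s ω * Complex.I) := by fun_prop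
  have d1 := kf_descC hfr hM hd hz htc n
  have d2 := kf_descC hfr hM hd hzc1 htc (fun ω => mul_ne_zero (n ω) (nI _))
  have d3 := kf_descC hfr hM hd hzc2 hsc (fun ω => mul_ne_zero (mul_ne_zero (n ω) (nI _)) (nI _))
  have d4 := kf_descC hfr hM hd hzc3 (t := fun ω => - s ω) (by fun_prop)
    (fun ω => mul_ne_zero (mul_ne_zero (mul_ne_zero (n ω) (nI _)) (nI _)) (nI _))
  simp only [ee]
  linarith

end lemK

end partA

section partB

section lemK2
variable {Ω : Type*} [TopologicalSpace Ω]
variable {D : (Ω → E3) → ℝ} {M d : ℝ}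

lemma kf_step (hfr : ∀ u v x, Frame u v x → D u + D v + D x = 0)
    (hM : ∀ u v x, Frame u v x → D u ≤ M)
    (hd : D (fun _ => mk3 1 0 0) = d) {p q : Ω → ℝ} (hp : Continuous p) (hq : Continuous q)
    (p1 : ∀ ω, 19 ≤ p ω ∧ p ω ≤ 21) (q1 : ∀ ω, |q ω| ≤ 1/4) (σ τ : ℝ) (hσ : σ = 1 ∨ σ = -1)
    (hτ : τ = 1 ∨ τ = -1)
    (h : kf D d (fun _ => 1) (fun _ => σ) (fun _ => τ * √2) ≤ 3 * d / 4) :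
    kf D d (fun _ => 1) p q ≤ 3 * d / 4 + 8 * (M - d) := by
  set za : ℂ := ⟨σ, τ * √2⟩ with hza
  have hs2 : (√2) ^ 2 = (2:ℝ) := Real.sq_sqrt (by norm_num)
  have hs0 : 0 ≤ √2 := Real.sqrt_nonneg 2
  have hs2' : √2 ≤ 1.42 := by nlinarith
  have hσ2 : σ ^ 2 = 1 := by rcases hσ with h | h <;> rw [h] <;> norm_num
  have hτ2 : τ ^ 2 = 1 := by rcases hτ with h | h <;> rw [h] <;> norm_num
  have hnsq : Complex.normSq za = 3 := by
    rw [Complex.normSq_apply]; simp only [hza]; nlinarith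
  have hne : za ≠ 0 := by
    intro h0; rw [h0] at hnsq; simp at hnsq
  set z : Ω → ℂ := fun ω => (p ω : ℂ) + q ω * Complex.I with hz
  have hzc : Continuous z := by fun_prop
  have hn3 : ‖za‖ = √3 := by
    rw [Complex.norm_def, hnsq]
  have := kf_desc4 hfr hM hd (z := fun _ => za) (y := fun ω => z ω / za) (by fun_prop)
    (hzc.div_const _) (fun _ => hne) (fun ω => by
      have hre : (z ω / za).re = (p ω * σ + q ω * (τ * √2)) / 3 := by
        rw [Complex.div_re, hnsq]; simp [hz, hza]; ring
      have h3 : √3 ≤ 1.74 := by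
        rw [Real.sqrt_le_left (by norm_num)]; norm_num
      have h3' : 0 < √3 := by positivity
      have hnz : 19 ≤ ‖z ω‖ := by
        have : (z ω).re ≤ ‖z ω‖ := Complex.re_le_norm _
        simp [hz] at this
        linarith [(p1 ω).1]
      have h4 : 10 ≤ ‖z ω‖ / √3 := by rw [le_div_iff₀ h3']; nlinarith
      rw [norm_div, hn3, hre]
      have h5 : - 21 ≤ p ω * σ := by
        rcases hσ with h | h <;> rw [h] <;> linarith [(p1 ω).1, (p1 ω).2]
      have h6 : |q ω * (τ * √2)| ≤ 1/4 * 1.42 := by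
        rw [abs_mul]
        have : |τ * √2| ≤ 1.42 := by
          rw [abs_mul, abs_of_nonneg hs0]
          rcases hτ with h | h <;> rw [h] <;> simpa using hs2'
        exact mul_le_mul (q1 ω) this (abs_nonneg _) (by norm_num)
      have := abs_le.1 h6
      linarith)
  have e : ∀ ω, za * (z ω / za) = z ω := fun ω => by field_simp
  simp only [e] at this
  simp only [hz, hza] at this
  simp at this
  linarith

lemma lemK (hfr : ∀ u v x, Frame u v x → D u + D v + D x = 0)
    (hM : ∀ u v x, Frame u v x → D u ≤ M)
    (hd : D (fun _ => mk3 1 0 0) = d) {x b c : Ω → ℝ} (hx : Continuous x) (hb : Continuous b)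
    (hc : Continuous c) (x1 : ∀ ω, |x ω - 20| ≤ 1/100) (b1 : ∀ ω, |b ω + 1| ≤ 1/100)
    (c1 : ∀ ω, |c ω| ≤ 1/100) :
    5 * d / 4 - M - 8 * (M - d) ≤ D (fun ω => mk3 (x ω) (b ω) (c ω)) := by
  have hs2 : (√2) ^ 2 = (2:ℝ) := Real.sq_sqrt (by norm_num)
  have cc : ∀ r : ℝ, Continuous (fun _ : Ω => r) := fun r => continuous_const
  have k1 := kf_frame (d := d) hfr (cc 1) (cc 1) (cc 0) (cc 1) (cc (-1)) (cc 0) (cc 0) (cc 0) (cc 1)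
    (fun ω => by norm_num) (fun ω => by norm_num) (fun ω => by norm_num) (fun ω => by norm_num)
    (fun ω => by norm_num) (fun ω => by norm_num)
  have k2 := kf_eq hfr hd (cc 0) (cc 1) (fun ω => by norm_num)
  have k3 := kf_frame (d := d) hfr (cc 1) (cc 1) (cc (1 * √2)) (cc 1) (cc 1) (cc (-1 * √2))
    (cc 1) (cc (-1)) (cc 0)
    (fun ω => by positivity) (fun ω => by positivity) (fun ω => by norm_num)
    (fun ω => by nlinarith) (fun ω => by norm_num) (fun ω => by norm_num)
  have k4 := kf_frame (d := d) hfr (cc 1) (cc (-1)) (cc (1 * √2)) (cc 1) (cc (-1)) (cc (-1 * √2))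
    (cc 1) (cc 1) (cc 0)
    (fun ω => by positivity) (fun ω => by positivity) (fun ω => by norm_num)
    (fun ω => by nlinarith) (fun ω => by norm_num) (fun ω => by norm_num)
  have hx' := fun ω => abs_le.1 (x1 ω)
  have hb' := fun ω => abs_le.1 (b1 ω)
  have hc' := fun ω => abs_le.1 (c1 ω)
  have S1 : ∀ ω, 0.98 ≤ b ω ^ 2 + c ω ^ 2 := fun ω => by nlinarith [hb' ω, sq_nonneg (c ω)]
  have S2 : ∀ ω, b ω ^ 2 + c ω ^ 2 ≤ 1.0202 := fun ω => by nlinarith [hb' ω, hc' ω]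
  have Sne : ∀ ω, b ω ^ 2 + c ω ^ 2 ≠ 0 := fun ω => by linarith [S1 ω]
  have Spos : ∀ ω, 0 < b ω ^ 2 + c ω ^ 2 := fun ω => by linarith [S1 ω]
  set p : Ω → ℝ := fun ω => - (x ω * b ω) / (b ω ^ 2 + c ω ^ 2) with hp
  set q : Ω → ℝ := fun ω => - (x ω * c ω) / (b ω ^ 2 + c ω ^ 2) with hq
  have hpc : Continuous p := Continuous.div (by fun_prop) (by fun_prop) Sne
  have hqc : Continuous q := Continuous.div (by fun_prop) (by fun_prop) Sne
  have p1 : ∀ ω, 19 ≤ p ω ∧ p ω ≤ 21 := fun ω => by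
    simp only [hp]
    rw [le_div_iff₀ (Spos ω), div_le_iff₀ (Spos ω)]
    constructor <;> nlinarith [hx' ω, hb' ω, S1 ω, S2 ω]
  have q1 : ∀ ω, |q ω| ≤ 1/4 := fun ω => by
    simp only [hq]
    rw [abs_div, abs_neg, abs_mul, abs_of_pos (Spos ω), div_le_iff₀ (Spos ω)]
    have : |x ω| ≤ 20.01 := abs_le.2 ⟨by linarith [hx' ω], by linarith [hx' ω]⟩
    have : |x ω| * |c ω| ≤ 20.01 * (1/100) :=
      mul_le_mul this (c1 ω) (abs_nonneg _) (by norm_num)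
    linarith [S1 ω]
  have hpq : kf D d (fun _ => 1) p q ≤ 3 * d / 4 + 8 * (M - d) := by
    by_cases h1 : kf D d (fun _ => 1) (fun _ => 1) (fun _ => 1 * √2) ≤ 3 * d / 4
    · exact kf_step hfr hM hd hpc hqc p1 q1 1 1 (by simp) (by simp) h1
    by_cases h2 : kf D d (fun _ => 1) (fun _ => 1) (fun _ => -1 * √2) ≤ 3 * d / 4
    · exact kf_step hfr hM hd hpc hqc p1 q1 1 (-1) (by simp) (by simp) h2
    by_cases h3 : kf D d (fun _ => 1) (fun _ => -1) (fun _ => 1 * √2) ≤ 3 * d / 4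
    · exact kf_step hfr hM hd hpc hqc p1 q1 (-1) 1 (by simp) (by simp) h3
    by_cases h4 : kf D d (fun _ => 1) (fun _ => -1) (fun _ => -1 * √2) ≤ 3 * d / 4
    · exact kf_step hfr hM hd hpc hqc p1 q1 (-1) (-1) (by simp) (by simp) h4
    push Not at h1 h2 h3 h4
    linarith
  have k5 := kf_frame (d := d) hfr hx hb hc (cc 0) (b' := fun ω => - c ω) (by fun_prop) hb
    (cc 1) hpc hqc (fun ω => by nlinarith [Spos ω]) (fun ω => by nlinarith [Spos ω])
    (fun ω => by positivity) (fun ω => by ring)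
    (fun ω => by simp only [hp, hq]; have := Sne ω; field_simp; ring)
    (fun ω => by simp only [hp, hq]; have := Sne ω; field_simp; ring)
  have k6 := kf_eq hfr hd (b := fun ω => - c ω) (c := b) (by fun_prop) hb
    (fun ω => by nlinarith [Spos ω])
  have F2 := frame_mk (a := x) (b := fun ω => - c ω) (c := b)
    (a' := fun _ => 0) (b' := fun ω => - b ω) (c' := fun ω => - c ω)
    (a'' := fun ω => b ω ^ 2 + c ω ^ 2) (b'' := fun ω => - - (x ω * c ω)) (c'' := fun ω => - (x ω * b ω))
    (by fun_prop) (by fun_prop) (by fun_prop) (by fun_prop) (by fun_prop) (by fun_prop)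
    (by fun_prop) (by fun_prop) (by fun_prop) (fun ω => by nlinarith [Spos ω])
    (fun ω => by nlinarith [Spos ω]) (fun ω => by have := Spos ω; positivity)
    (fun ω => by ring) (fun ω => by ring) (fun ω => by ring)
  have m1 := hM _ _ _ F2
  have k7 : kf D d x b c = D (fun ω => mk3 (x ω) (b ω) (c ω)) +
    D (fun ω => mk3 (x ω) (- c ω) (b ω)) + d := rfl
  linarith

end lemK2

end partB

section partC

structure IsoF {Ω : Type*} [TopologicalSpace Ω] (W : Ω → (E3 ≃ₗᵢ[ℝ] E3)) : Prop where
  ct : ∀ u : Ω → E3, Continuous u → Continuous fun ω => W ω (u ω)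
  ct' : ∀ u : Ω → E3, Continuous u → Continuous fun ω => (W ω).symm (u ω)

section isof
variable {Ω : Type*} [TopologicalSpace Ω]

lemma IsoF.frame {W : Ω → (E3 ≃ₗᵢ[ℝ] E3)} (hW : IsoF W) {u v x : Ω → E3} (h : Frame u v x) :
    Frame (fun ω => W ω (u ω)) (fun ω => W ω (v ω)) (fun ω => W ω (x ω)) :=
  ⟨hW.ct _ h.cu, hW.ct _ h.cv, hW.ct _ h.cx, fun ω => by simpa using h.nu ω,
    fun ω => by simpa using h.nv ω, fun ω => by simpa using h.nx ω,
    fun ω => by simpa using h.uv ω, fun ω => by simpa using h.ux ω, fun ω => by simpa using h.vx ω⟩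

lemma IsoF.symm {W : Ω → (E3 ≃ₗᵢ[ℝ] E3)} (hW : IsoF W) : IsoF fun ω => (W ω).symm :=
  ⟨hW.ct', fun u hu => by simpa using hW.ct u hu⟩

lemma IsoF.trans {V W : Ω → (E3 ≃ₗᵢ[ℝ] E3)} (hV : IsoF V) (hW : IsoF W) :
    IsoF fun ω => (V ω).trans (W ω) :=
  ⟨fun u hu => by simpa using hW.ct _ (hV.ct u hu),
   fun u hu => by
    have := hV.ct' _ (hW.ct' u hu)
    exact this⟩

lemma FF.comp {f : (Ω → E3) → ℝ} {B w : ℝ} (hf : FF f B w) {W : Ω → (E3 ≃ₗᵢ[ℝ] E3)}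
    (hW : IsoF W) : FF (fun u => f fun ω => W ω (u ω)) B w :=
  ⟨fun u hu hn => hf.bdd _ (hW.ct u hu) (fun ω => by simpa using hn ω),
   fun _ _ _ h => hf.frame _ _ _ (hW.frame h)⟩

lemma FF.neg {f : (Ω → E3) → ℝ} {B w : ℝ} (hf : FF f B w) : FF (fun u => - f u) B (-w) :=
  ⟨fun u hu hn => by rw [abs_neg]; exact hf.bdd u hu hn,
   fun _ _ _ h => by have := hf.frame _ _ _ h; linarith⟩

/-- isometry field from an orthonormal field -/
lemma exists_isoF {a b c : Ω → E3} (ha : Continuous a) (hb : Continuous b) (hc : Continuous c)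
    (na : ∀ ω, ‖a ω‖ = 1) (nb : ∀ ω, ‖b ω‖ = 1) (nc : ∀ ω, ‖c ω‖ = 1)
    (ab : ∀ ω, inner ℝ (a ω) (b ω) = 0) (ac : ∀ ω, inner ℝ (a ω) (c ω) = 0)
    (bc : ∀ ω, inner ℝ (b ω) (c ω) = 0) :
    ∃ W : Ω → (E3 ≃ₗᵢ[ℝ] E3), IsoF W ∧ ∀ ω x, W ω x = x 0 • a ω + x 1 • b ω + x 2 • c ω := by
  have ho : ∀ ω, Orthonormal ℝ ![a ω, b ω, c ω] := fun ω => by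
    rw [orthonormal_iff_ite]
    intro i j
    fin_cases i <;> fin_cases j <;>
      simp [na, nb, nc, ab, ac, bc, real_inner_comm (a ω), real_inner_comm (b ω)]
  have hcard : ∀ ω, Module.finrank ℝ (Submodule.span ℝ (Set.range ![a ω, b ω, c ω])) = 3 := fun ω => by
    rw [finrank_span_eq_card (ho ω).linearIndependent]; simp
  have hsp : ∀ ω, ⊤ ≤ Submodule.span ℝ (Set.range ![a ω, b ω, c ω]) := fun ω => by
    rw [Submodule.eq_top_of_finrank_eq (S := Submodule.span ℝ (Set.range ![a ω, b ω, c ω]))]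
    rw [hcard]; simp
  let B : Ω → OrthonormalBasis (Fin 3) ℝ E3 := fun ω => OrthonormalBasis.mk (ho ω) (hsp ω)
  have hB : ∀ ω, ⇑(B ω) = ![a ω, b ω, c ω] := fun ω => OrthonormalBasis.coe_mk _ _
  refine ⟨fun ω => (B ω).repr.symm, ⟨fun u hu => ?_, fun u hu => ?_⟩, fun ω x => ?_⟩
  · have : (fun ω => (B ω).repr.symm (u ω)) =
      fun ω => u ω 0 • a ω + u ω 1 • b ω + u ω 2 • c ω := by
      ext1 ω
      rw [← OrthonormalBasis.sum_repr_symm, hB, Fin.sum_univ_three]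
      simp
    rw [this]; fun_prop
  · have : (fun ω => (B ω).repr.symm.symm (u ω)) =
      fun ω => mk3 (inner ℝ (a ω) (u ω)) (inner ℝ (b ω) (u ω)) (inner ℝ (c ω) (u ω)) := by
      ext ω i
      simp only [LinearIsometryEquiv.symm_symm]
      rw [OrthonormalBasis.repr_apply_apply, hB]
      fin_cases i <;> rfl
    rw [this]
    exact continuous_mk3 (ha.inner hu) (hb.inner hu) (hc.inner hu)
  · rw [← OrthonormalBasis.sum_repr_symm, hB, Fin.sum_univ_three]
    simp

lemma frame_normalize {u v x : Ω → E3} (h : Frame u v x) :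
    ∃ P : Ω → (E3 ≃ₗᵢ[ℝ] E3), IsoF P ∧ Frame (fun ω => P ω (mk3 1 0 0)) v x := by
  have cn : ∀ {u : Ω → E3}, Continuous u → (∀ ω, u ω ≠ 0) → Continuous fun ω => ‖u ω‖⁻¹ • u ω :=
    fun hu hn => (hu.norm.inv₀ (fun ω => by simpa using hn ω)).smul hu
  have nn : ∀ {u : E3}, u ≠ 0 → ‖‖u‖⁻¹ • u‖ = 1 := fun hn => by
    rw [norm_smul, norm_inv, norm_norm, inv_mul_cancel₀ (by simpa using hn)]
  obtain ⟨P, hP, hPe⟩ := exists_isoF (cn h.cu h.nu) (cn h.cv h.nv) (cn h.cx h.nx)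
    (fun ω => nn (h.nu ω)) (fun ω => nn (h.nv ω)) (fun ω => nn (h.nx ω))
    (fun ω => by rw [real_inner_smul_left, real_inner_smul_right, h.uv]; simp)
    (fun ω => by rw [real_inner_smul_left, real_inner_smul_right, h.ux]; simp)
    (fun ω => by rw [real_inner_smul_left, real_inner_smul_right, h.vx]; simp)
  have e : (fun ω => P ω (mk3 1 0 0)) = fun ω => ‖u ω‖⁻¹ • u ω := by
    ext1 ω; rw [hPe]; simp [mk3]
  refine ⟨P, hP, ?_⟩
  rw [e]
  exact ⟨cn h.cu h.nu, h.cv, h.cx, fun ω => by simpa using h.nu ω, h.nv, h.nx,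
    fun ω => by rw [real_inner_smul_left, h.uv]; simp,
    fun ω => by rw [real_inner_smul_left, h.ux]; simp, h.vx⟩

end isof

/-- set of possible defects -/
def defS (B ε : ℝ) : Set ℝ :=
  {r | ∃ (Ω : Type) (_ : TopologicalSpace Ω) (f : (Ω → E3) → ℝ) (w : ℝ) (W : Ω → (E3 ≃ₗᵢ[ℝ] E3)),
    FF f B w ∧ IsoF W ∧ (∀ ω x, ‖W ω x - x‖ ≤ ε * ‖x‖) ∧
    r = f (fun _ => mk3 1 0 0) - f (fun ω => W ω (mk3 1 0 0))}

lemma defS_le {B ε r : ℝ} (h : r ∈ defS B ε) : r ≤ 2 * B := by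
  obtain ⟨Ω, _, f, w, W, hf, hW, _, rfl⟩ := h
  have h0 : mk3 1 0 0 ≠ 0 := mk3_ne (by norm_num)
  have h1 := abs_le.1 (hf.bdd (fun _ => mk3 1 0 0) continuous_const (fun _ => h0))
  have h2 := abs_le.1 (hf.bdd (fun ω => W ω (mk3 1 0 0)) (hW.ct _ continuous_const)
    (fun _ => by simpa using h0))
  linarith

lemma defS_mono {B ε ε' : ℝ} (h : ε ≤ ε') : defS B ε ⊆ defS B ε' := by
  rintro r ⟨Ω, i, f, w, W, hf, hW, h1, rfl⟩
  exact ⟨Ω, i, f, w, W, hf, hW, fun ω x => (h1 ω x).trans (by gcongr), rfl⟩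

lemma defS_D {B ε M : ℝ} (hM : ∀ r ∈ defS B ε, r ≤ M) {Ω : Type} [TopologicalSpace Ω]
    {f : (Ω → E3) → ℝ} {w : ℝ} {W : Ω → (E3 ≃ₗᵢ[ℝ] E3)} (hf : FF f B w) (hW : IsoF W)
    (h1 : ∀ ω x, ‖W ω x - x‖ ≤ ε * ‖x‖) {u v x : Ω → E3} (h : Frame u v x) :
    f u - f (fun ω => W ω (u ω)) ≤ M := by
  obtain ⟨P, hP, hfr⟩ := frame_normalize h
  have e1 := hf.frame _ _ _ h
  have e2 := hf.frame _ _ _ hfr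
  have e3 := hf.frame _ _ _ (hW.frame h)
  have e4 := hf.frame _ _ _ (hW.frame hfr)
  have : f (fun ω => P ω (mk3 1 0 0)) - f (fun ω => W ω (P ω (mk3 1 0 0))) ≤ M := by
    apply hM
    refine ⟨Ω, _, _, w, fun ω => ((P ω).trans (W ω)).trans (P ω).symm, hf.comp hP,
      (hP.trans hW).trans hP.symm, fun ω x => ?_, by simp⟩
    have := h1 ω (P ω x)
    rw [(P ω).norm_map] at this
    rw [← (P ω).norm_map]
    simpa using this
  linarith

lemma lemC (B η : ℝ) (hη : 0 < η) : ∃ ε > 0, ∀ r ∈ defS B ε, r ≤ η := by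
  by_contra hcon
  push Not at hcon
  have hbd : ∀ ε, BddAbove (defS B ε) := fun ε => ⟨2 * B, fun r hr => defS_le hr⟩
  set Nf : ℝ → ℝ := fun ε => sSup (defS B ε) with hNf
  have hNη : ∀ ε > 0, η ≤ Nf ε := fun ε hε => by
    obtain ⟨r, hr, hr'⟩ := hcon ε hε
    exact hr'.le.trans (le_csSup (hbd ε) hr)
  set N := sInf (Nf '' Set.Ioi 0) with hN
  have hne : (Nf '' Set.Ioi 0).Nonempty := ⟨_, 1, by simp, rfl⟩
  have hNpos : 0 < N := hη.trans_le (le_csInf hne (by rintro _ ⟨ε, hε, rfl⟩; exact hNη ε hε))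
  have hbb : BddBelow (Nf '' Set.Ioi 0) := ⟨η, by rintro _ ⟨ε, hε, rfl⟩; exact hNη ε hε⟩
  obtain ⟨_, ⟨ε0, hε0, rfl⟩, hlt⟩ := exists_lt_of_csInf_lt hne
    (show sInf (Nf '' Set.Ioi 0) < N * (1 + 1/200) by rw [← hN]; nlinarith)
  simp only [Set.mem_Ioi] at hε0
  obtain ⟨J, hJ⟩ := exists_nat_gt (2 * B * 8 / N)
  rw [div_lt_iff₀ hNpos] at hJ
  set ε1 := min ε0 (1 / (2200 * (J + 1))) with hε1
  have hε1p : 0 < ε1 := lt_min hε0 (by positivity)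
  have hge : N ≤ Nf ε1 := csInf_le hbb ⟨ε1, hε1p, rfl⟩
  have hne1 : (defS B ε1).Nonempty := by
    obtain ⟨r, hr, _⟩ := hcon ε1 hε1p
    exact ⟨r, hr⟩
  obtain ⟨r, hr, hrlt⟩ := exists_lt_of_lt_csSup hne1
    (show N * (1 - 1/200) < sSup (defS B ε1) from lt_of_lt_of_le (by nlinarith) hge)
  obtain ⟨Ω, _, f, w, W, hf, hW, h1, rfl⟩ := hr
  have hM : ∀ r ∈ defS B ε1, r ≤ N * (1 + 1/200) := fun r hr =>
    (le_csSup (hbd ε0) (defS_mono (min_le_left _ _) hr)).trans hlt.le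
  set D : (Ω → E3) → ℝ := fun u => f u - f (fun ω => W ω (u ω)) with hD
  have hfr : ∀ u v x, Frame u v x → D u + D v + D x = 0 := fun u v x h => by
    have e1 := hf.frame _ _ _ h
    have e2 := hf.frame _ _ _ (hW.frame h)
    simp only [hD]; linarith
  have hDM : ∀ u v x, Frame u v x → D u ≤ N * (1 + 1/200) := fun u v x h =>
    defS_D hM hf hW h1 h
  let y0 : E3 := mk3 20 (-1) 0
  have hy0 : ‖y0‖ ≤ 21 := by
    have := mk3_norm_sq 20 (-1) 0
    have h2 : ‖y0‖ ^ 2 = 401 := by rw [this]; norm_num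
    nlinarith [norm_nonneg y0]
  have hy0n : y0 ≠ 0 := mk3_ne (by norm_num)
  let Y : ℕ → Ω → E3 := fun j => Nat.rec (fun _ => y0) (fun _ u ω => W ω (u ω)) j
  have Y0 : Y 0 = fun _ => y0 := rfl
  have YS : ∀ j, Y (j + 1) = fun ω => W ω (Y j ω) := fun j => rfl
  have Yc : ∀ j, Continuous (Y j) := fun j => by
    induction j with
    | zero => rw [Y0]; fun_prop
    | succ j ih => rw [YS]; exact hW.ct _ ih
  have Yn : ∀ j ω, ‖Y j ω‖ = ‖y0‖ := fun j ω => by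
    induction j with
    | zero => rw [Y0]
    | succ j ih => rw [YS, LinearIsometryEquiv.norm_map, ih]
  have Yd : ∀ j ω, ‖Y j ω - y0‖ ≤ j * (ε1 * 21) := fun j ω => by
    induction j with
    | zero => rw [Y0]; simp
    | succ j ih =>
      have h2 := h1 ω (Y j ω)
      rw [Yn] at h2
      have h3 : Y (j+1) ω - y0 = (W ω (Y j ω) - Y j ω) + (Y j ω - y0) := by rw [YS]; abel
      rw [h3]
      refine (norm_add_le _ _).trans ?_
      push_cast
      nlinarith
  have hlow : ∀ j < J, N / 8 ≤ D (Y j) := fun j hj => by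
    have hd : ∀ ω, ‖Y j ω - y0‖ ≤ 1/100 := fun ω => by
      refine (Yd j ω).trans ?_
      have e1 : ε1 ≤ 1 / (2200 * (J + 1)) := min_le_right _ _
      have hj' : (j:ℝ) ≤ J + 1 := by
        have : (j:ℝ) < J := by exact_mod_cast hj
        linarith
      calc (j:ℝ) * (ε1 * 21) ≤ (J+1) * (1 / (2200 * (J + 1)) * 21) := by gcongr
        _ = 21/2200 := by field_simp
        _ ≤ _ := by norm_num
    have hco : ∀ ω i, |(Y j ω - y0) i| ≤ 1/100 := fun ω i =>
      (PiLp.norm_apply_le (Y j ω - y0) i).trans (hd ω)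
    have := lemK hfr hDM (rfl : D (fun _ => mk3 1 0 0) = _) (x := fun ω => Y j ω 0)
      (b := fun ω => Y j ω 1) (c := fun ω => Y j ω 2)
      (by have := Yc j; fun_prop) (by have := Yc j; fun_prop) (by have := Yc j; fun_prop)
      (fun ω => by simpa [y0, mk3] using hco ω 0) (fun ω => by simpa [y0, mk3] using hco ω 1)
      (fun ω => by simpa [y0, mk3] using hco ω 2)
    simp only [mk3_eta] at this
    have hDe : N * (1 - 1/200) < D (fun _ => mk3 1 0 0) := hrlt
    refine le_trans ?_ this
    nlinarith
  have tel : ∑ j ∈ Finset.range J, D (Y j) = f (Y 0) - f (Y J) := by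
    have : ∀ j, D (Y j) = f (Y j) - f (Y (j+1)) := fun j => rfl
    simp only [this]
    exact Finset.sum_range_sub' (fun j => f (Y j)) J
  have hs : (J:ℝ) * (N / 8) ≤ ∑ j ∈ Finset.range J, D (Y j) := by
    have := Finset.card_nsmul_le_sum (Finset.range J) (fun j => D (Y j)) (N/8)
      (fun j hj => hlow j (Finset.mem_range.1 hj))
    simpa using this
  have nz : ∀ j ω, Y j ω ≠ 0 := fun j ω h => hy0n (by rw [← norm_eq_zero, ← Yn j ω, h, norm_zero])
  have b1 := abs_le.1 (hf.bdd _ (Yc 0) (nz 0))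
  have b2 := abs_le.1 (hf.bdd _ (Yc J) (nz J))
  linarith

lemma lemC1 (B η : ℝ) (hη : 0 < η) : ∃ ε > 0, ∀ (Ω : Type) [TopologicalSpace Ω]
    (f : (Ω → E3) → ℝ) (w : ℝ), FF f B w → ∀ c s : Ω → ℝ, Continuous c → Continuous s →
    (∀ ω, c ω ^ 2 + s ω ^ 2 = 1) → (∀ ω, (c ω - 1) ^ 2 + s ω ^ 2 ≤ ε ^ 2) →
    |f (fun _ => mk3 1 0 0) - f (fun ω => mk3 (c ω) (s ω) 0)| ≤ η := by
  obtain ⟨ε, hε, h⟩ := lemC B η hη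
  refine ⟨ε, hε, fun Ω _ f w hf c s hc hs h1 h2 => ?_⟩
  have n1 : ∀ {x : E3}, ‖x‖ ^ 2 = 1 → ‖x‖ = 1 := fun {x} hx => by
    have := norm_nonneg x; nlinarith
  obtain ⟨W, hW, hWe⟩ := exists_isoF (a := fun ω => mk3 (c ω) (s ω) 0)
    (b := fun ω => mk3 (- s ω) (c ω) 0) (c := fun _ => mk3 0 0 1)
    (by fun_prop) (by fun_prop) (by fun_prop)
    (fun ω => n1 (by rw [mk3_norm_sq]; linarith [h1 ω]))
    (fun ω => n1 (by rw [mk3_norm_sq]; linarith [h1 ω]))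
    (fun ω => n1 (by rw [mk3_norm_sq]; norm_num))
    (fun ω => by rw [inner_mk3]; ring) (fun ω => by rw [inner_mk3]; ring)
    (fun ω => by rw [inner_mk3]; ring)
  have hd : ∀ ω x, ‖W ω x - x‖ ≤ ε * ‖x‖ := fun ω x => by
    have e : W ω x - x = mk3 (x 0 * (c ω - 1) - x 1 * s ω) (x 0 * s ω + x 1 * (c ω - 1)) 0 := by
      rw [hWe]; ext i; fin_cases i <;> simp [mk3] <;> ring
    have hx : ‖x‖ ^ 2 = x 0 ^ 2 + x 1 ^ 2 + x 2 ^ 2 := by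
      rw [← mk3_norm_sq, mk3_eta]
    have : ‖W ω x - x‖ ^ 2 ≤ (ε * ‖x‖) ^ 2 := by
      rw [e, mk3_norm_sq, mul_pow, hx]
      have := h2 ω
      calc _ = (x 0 ^ 2 + x 1 ^ 2) * ((c ω - 1) ^ 2 + s ω ^ 2) := by ring
        _ ≤ (x 0 ^ 2 + x 1 ^ 2) * ε ^ 2 := by gcongr
        _ ≤ _ := by nlinarith [mul_nonneg (sq_nonneg ε) (sq_nonneg (x 2))]
    exact abs_le_of_sq_le_sq' this (by positivity) |>.2
  have e1 : (fun ω => W ω (mk3 1 0 0)) = fun ω => mk3 (c ω) (s ω) 0 := by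
    ext1 ω; rw [hWe]; simp [mk3]
  have r1 := h _ ⟨Ω, _, f, w, W, hf, hW, hd, rfl⟩
  have r2 := h _ ⟨Ω, _, _, -w, W, hf.neg, hW, hd, rfl⟩
  rw [e1] at r1 r2
  rw [abs_le]
  constructor <;> linarith

end partC

section partD

/-- real frame functions on `ℝ³` -/
structure RFF (f : E3 → ℝ) (B w : ℝ) : Prop where
  bdd : ∀ x, x ≠ 0 → |f x| ≤ B
  frame : ∀ u v x, u ≠ 0 → v ≠ 0 → x ≠ 0 → inner ℝ u v = 0 → inner ℝ u x = 0 → inner ℝ v x = 0 →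
    f u + f v + f x = w

lemma RFF.comp {f : E3 → ℝ} {B w : ℝ} (hf : RFF f B w) (U : E3 ≃ₗᵢ[ℝ] E3) :
    RFF (fun x => f (U x)) B w :=
  ⟨fun x hx => hf.bdd _ (by simpa using hx), fun u v x hu hv hx h1 h2 h3 =>
    hf.frame _ _ _ (by simpa using hu) (by simpa using hv) (by simpa using hx) (by simpa using h1)
      (by simpa using h2) (by simpa using h3)⟩

lemma RFF.toFF {f : E3 → ℝ} {B w : ℝ} (hf : RFF f B w) :
    FF (Ω := Unit) (fun u => f (u ())) B w :=
  ⟨fun _ _ hn => hf.bdd _ (hn ()), fun _ _ _ h => hf.frame _ _ _ (h.nu ()) (h.nv ()) (h.nx ())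
    (h.uv ()) (h.ux ()) (h.vx ())⟩

lemma norm_e1 : ‖mk3 1 0 0‖ = 1 := by
  have := mk3_norm_sq 1 0 0
  have h := norm_nonneg (mk3 1 0 0)
  nlinarith

lemma exists_iso_map_aux {F : Type*} [NormedAddCommGroup F] [InnerProductSpace ℝ F] (x y : F)
    (h : ‖x‖ = ‖y‖) : ∃ U : F ≃ₗᵢ[ℝ] F, U x = y ∧ U y = x ∧ U.symm = U := by
  have h2 : ∀ U : F ≃ₗᵢ[ℝ] F, U x = y → U.symm = U → U y = x := fun U h1 h2 => by
    rw [← h1]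
    conv_lhs => enter [1]; rw [← h2]
    exact U.symm_apply_apply x
  exact ⟨(ℝ ∙ (x - y))ᗮ.reflection, Submodule.reflection_sub h,
    h2 _ (Submodule.reflection_sub h) (by simp), by simp⟩

lemma exists_iso_map (x y : E3) (h : ‖x‖ = ‖y‖) : ∃ U : E3 ≃ₗᵢ[ℝ] E3, U x = y ∧ U y = x ∧
    U.symm = U := exists_iso_map_aux x y h

lemma RFF.smul {f : E3 → ℝ} {B w : ℝ} (hf : RFF f B w) {t : ℝ} (ht : t ≠ 0) {x : E3} (hx : x ≠ 0) :
    f (t • x) = f x := by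
  obtain ⟨U, hU, _⟩ := exists_iso_map (mk3 ‖x‖ 0 0) x (by
    have := mk3_norm_sq ‖x‖ 0 0
    have h := norm_nonneg (mk3 ‖x‖ 0 0)
    have h2 := norm_nonneg x
    exact (sq_eq_sq₀ h h2).1 (by linarith))
  have hf' := hf.comp U
  have hn : 0 < ‖x‖ := by simpa using hx
  have h1 := hf'.frame (mk3 ‖x‖ 0 0) (mk3 0 1 0) (mk3 0 0 1) (mk3_ne (by positivity))
    (mk3_ne (by norm_num)) (mk3_ne (by norm_num)) (by simp [inner_mk3]) (by simp [inner_mk3])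
    (by simp [inner_mk3])
  have h2 := hf'.frame (t • mk3 ‖x‖ 0 0) (mk3 0 1 0) (mk3 0 0 1)
    (smul_ne_zero ht (mk3_ne (by positivity)))
    (mk3_ne (by norm_num)) (mk3_ne (by norm_num)) (by simp [inner_smul_left, inner_mk3])
    (by simp [inner_smul_left, inner_mk3])
    (by simp [inner_mk3])
  simp only [map_smul, hU] at h1 h2
  linarith

lemma exists_rot (b c : ℝ) : ∃ Q : E3 ≃ₗᵢ[ℝ] E3, Q (mk3 1 0 0) = mk3 1 0 0 ∧
    ∀ a, Q (mk3 a (√(b ^ 2 + c ^ 2)) 0) = mk3 a b c := by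
  obtain ⟨U, hU, hU2, _⟩ := exists_iso_map (mk3 0 (√(b ^ 2 + c ^ 2)) 0) (mk3 0 b c) (by
    have h1 := mk3_norm_sq 0 (√(b ^ 2 + c ^ 2)) 0
    have h2 := mk3_norm_sq 0 b c
    rw [Real.sq_sqrt (by positivity)] at h1
    exact (sq_eq_sq₀ (norm_nonneg _) (norm_nonneg _)).1 (by linarith))
  by_cases h0 : 0 < b ^ 2 + c ^ 2
  · set s := √(b ^ 2 + c ^ 2) with hs
    have hsp : 0 < s := Real.sqrt_pos.2 h0
    have hs2 : s ^ 2 = b ^ 2 + c ^ 2 := Real.sq_sqrt h0.le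
    have n1 : ∀ {x : E3}, ‖x‖ ^ 2 = 1 → ‖x‖ = 1 := fun {x} hx => by
      have := norm_nonneg x; nlinarith
    obtain ⟨W, hW, hWe⟩ := exists_isoF (Ω := Unit) (a := fun ω => mk3 1 0 0)
      (b := fun ω => mk3 0 (b/s) (c/s)) (c := fun _ => mk3 0 (-(c/s)) (b/s))
      (by fun_prop) (by fun_prop) (by fun_prop)
      (fun ω => norm_e1)
      (fun ω => n1 (by rw [mk3_norm_sq]; field_simp; linarith))
      (fun ω => n1 (by rw [mk3_norm_sq]; field_simp; linarith))
      (fun ω => by rw [inner_mk3]; ring) (fun ω => by rw [inner_mk3]; ring)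
      (fun ω => by rw [inner_mk3]; ring)
    refine ⟨W (), ?_, fun a => ?_⟩
    · rw [hWe]; ext i; fin_cases i <;> simp [mk3]
    · rw [hWe]; ext i; fin_cases i <;> simp [mk3] <;> field_simp
  · have hb : b = 0 := by nlinarith [sq_nonneg b, sq_nonneg c]
    have hc : c = 0 := by nlinarith [sq_nonneg b, sq_nonneg c]
    subst hb hc
    exact ⟨LinearIsometryEquiv.refl ℝ E3, rfl, fun a => by simp⟩

lemma RFF.uc (B η : ℝ) (hη : 0 < η) : ∃ ε > 0, ∀ (f : E3 → ℝ) (w : ℝ), RFF f B w →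
    ∀ x y : E3, ‖x‖ = 1 → ‖y‖ = 1 → ‖x - y‖ ≤ ε → |f x - f y| ≤ η := by
  obtain ⟨ε, hε, H⟩ := lemC1 B η hη
  refine ⟨ε, hε, fun f w hf x y hx hy hxy => ?_⟩
  obtain ⟨U, hU, -⟩ := exists_iso_map (mk3 1 0 0) x (by rw [hx, norm_e1])
  set z := U.symm y with hz
  obtain ⟨Q, hQ1, hQ2⟩ := exists_rot (z 1) (z 2)
  have hzn : ‖z‖ ^ 2 = 1 := by rw [hz, LinearIsometryEquiv.norm_map, hy]; norm_num
  have hz2 : z 0 ^ 2 + z 1 ^ 2 + z 2 ^ 2 = 1 := by rw [← mk3_norm_sq, mk3_eta, hzn]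
  have hs := Real.sq_sqrt (show 0 ≤ z 1 ^ 2 + z 2 ^ 2 by positivity)
  have hd : ‖z - mk3 1 0 0‖ ≤ ε := by
    rw [← U.norm_map, map_sub, hU, hz, U.apply_symm_apply, norm_sub_rev]; exact hxy
  have hd2 : ‖z - mk3 1 0 0‖ ^ 2 = (z 0 - 1) ^ 2 + z 1 ^ 2 + z 2 ^ 2 := by
    rw [← mk3_norm_sq]; congr 2; ext i; fin_cases i <;> simp [mk3]
  have := H Unit _ w ((hf.comp U).comp Q).toFF (fun _ => z 0) (fun _ => √(z 1 ^ 2 + z 2 ^ 2))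
    (by fun_prop) (by fun_prop) (fun _ => by rw [hs]; linarith)
    (fun _ => by rw [hs]; nlinarith [norm_nonneg (z - mk3 1 0 0)])
  simp only [hQ1, hQ2, mk3_eta, hU] at this
  rwa [hz, U.apply_symm_apply] at this

lemma RFF.scale {f : E3 → ℝ} {B w : ℝ} (hf : RFF f B w) (t : ℝ) (x : E3) :
    ‖t • x‖ ^ 2 * f (t • x) = t ^ 2 * (‖x‖ ^ 2 * f x) := by
  by_cases ht : t = 0
  · simp [ht]
  by_cases hx : x = 0
  · simp [hx]
  rw [hf.smul ht hx, norm_smul, mul_pow, Real.norm_eq_abs, sq_abs]; ring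

lemma RFF.cont {f : E3 → ℝ} {B w : ℝ} (hf : RFF f B w) :
    Continuous fun x => ‖x‖ ^ 2 * f x := by
  rw [continuous_iff_continuousAt]
  intro x
  by_cases hx : x = 0
  · subst hx
    have : Filter.Tendsto (fun x : E3 => ‖x‖ ^ 2 * B) (nhds 0) (nhds 0) := by
      have : Continuous (fun x : E3 => ‖x‖ ^ 2 * B) := by fun_prop
      have := this.tendsto 0
      simpa using this
    unfold ContinuousAt
    simp only [norm_zero, ne_eq, OfNat.ofNat_ne_zero, not_false_eq_true, zero_pow, zero_mul]
    refine squeeze_zero_norm (fun y => ?_) this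
    by_cases hy : y = 0
    · simp [hy]
    · rw [norm_mul, norm_pow, norm_norm, Real.norm_eq_abs]
      gcongr
      exact hf.bdd y hy
  · have hcs : ContinuousOn f (Metric.sphere 0 1) := by
      rw [Metric.continuousOn_iff]
      intro b hb η hη
      obtain ⟨ε, hε, H⟩ := RFF.uc B (η/2) (by positivity)
      refine ⟨ε, hε, fun a ha hab => ?_⟩
      rw [Real.dist_eq]
      rw [dist_eq_norm] at hab
      have := H f w hf a b (by simpa using ha) (by simpa using hb) hab.le
      linarith
    have hopen : IsOpen {y : E3 | y ≠ 0} := isOpen_ne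
    have hon : ContinuousOn (fun y : E3 => ‖y‖ ^ 2 * f (‖y‖⁻¹ • y)) {y : E3 | y ≠ 0} := by
      refine (by fun_prop : Continuous fun y : E3 => ‖y‖ ^ 2).continuousOn.mul ?_
      refine hcs.comp ?_ ?_
      · exact (continuous_norm.continuousOn.inv₀ (fun y hy => by simpa using hy)).smul continuousOn_id
      · intro y hy
        have : ‖y‖ ≠ 0 := by simpa using hy
        simp [norm_smul, this]
    have hat := hon.continuousAt (hopen.mem_nhds hx)
    refine hat.congr ?_
    filter_upwards [hopen.mem_nhds hx] with y hy
    rw [hf.smul (by simpa using hy) hy]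

end partD

section partE

def av (F : E3 → ℝ) (a ρ : ℝ) : ℝ :=
  ∫ θ in (0:ℝ)..(2 * Real.pi), F (mk3 a (ρ * Real.cos θ) (ρ * Real.sin θ))

def rotv (φ : ℝ) (x : E3) : E3 :=
  mk3 (x 0) (Real.cos φ * x 1 - Real.sin φ * x 2) (Real.sin φ * x 1 + Real.cos φ * x 2)

lemma av_rot (F : E3 → ℝ) (x : E3) :
    ∫ φ in (0:ℝ)..(2 * Real.pi), F (rotv φ x) = av F (x 0) (√(x 1 ^ 2 + x 2 ^ 2)) := by
  set z : ℂ := ⟨x 1, x 2⟩ with hz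
  set ψ := Complex.arg z with hψ
  set ρ := √(x 1 ^ 2 + x 2 ^ 2) with hρ
  have hn : ‖z‖ = ρ := by rw [Complex.norm_def, Complex.normSq_apply, hρ]; congr 1; simp [hz]; ring
  have h1 : x 1 = ρ * Real.cos ψ := by
    have := Complex.norm_mul_cos_arg z; rw [hn] at this; exact this.symm
  have h2 : x 2 = ρ * Real.sin ψ := by
    have := Complex.norm_mul_sin_arg z; rw [hn] at this; exact this.symm
  set g : ℝ → ℝ := fun θ => F (mk3 (x 0) (ρ * Real.cos θ) (ρ * Real.sin θ)) with hg
  have hper : Function.Periodic g (2 * Real.pi) := fun θ => by simp [hg]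
  have e : ∀ φ, F (rotv φ x) = g (φ + ψ) := fun φ => by
    simp only [hg, rotv, Real.cos_add, Real.sin_add, h1, h2]
    congr 2 <;> ring
  simp only [e]
  rw [intervalIntegral.integral_comp_add_right]
  have := hper.intervalIntegral_add_eq ψ 0
  rw [zero_add, add_comm (2 * Real.pi), this, zero_add]
  rfl

lemma add3_linear {κ : ℝ → ℝ} {b : ℝ} (hb : ∀ l, 0 ≤ l → l ≤ 1 → |κ l| ≤ b)
    (h : ∀ x y z, 0 ≤ x → 0 ≤ y → 0 ≤ z → x + y + z = 1 → κ x + κ y + κ z = 0) {l : ℝ}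
    (h0 : 0 ≤ l) (h1 : l ≤ 1) : κ l = κ 1 * (3 * l - 1) / 2 := by
  set H : ℝ → ℝ := fun l => κ l - κ 1 * (3 * l - 1) / 2 with hH
  have e3 : ∀ x y z, 0 ≤ x → 0 ≤ y → 0 ≤ z → x + y + z = 1 → H x + H y + H z = 0 := by
    intro x y z hx hy hz hs
    have := h x y z hx hy hz hs
    have hz' : z = 1 - x - y := by linarith
    subst hz'
    simp only [hH]; linarith
  have H1 : H 1 = 0 := by simp only [hH]; ring
  have H0 : H 0 = 0 := by have := e3 1 0 0 (by norm_num) le_rfl le_rfl (by norm_num); linarith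
  have e2 : ∀ x, 0 ≤ x → x ≤ 1 → H (1 - x) = - H x := fun x hx hx1 => by
    have := e3 x (1 - x) 0 hx (by linarith) le_rfl (by ring); linarith
  have dbl : ∀ x, 0 ≤ x → x ≤ 1/2 → H (2 * x) = 2 * H x := fun x hx hx1 => by
    have h1 := e3 x x (1 - 2 * x) hx hx (by linarith) (by ring)
    have h2 := e2 (2 * x) (by linarith) (by linarith)
    linarith
  have key : ∀ n : ℕ, ∀ x, 0 ≤ x → x ≤ 1 → |H x| ≤ (b + |κ 1|) / 2 ^ n := by
    intro n
    induction n with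
    | zero =>
      intro x hx hx1
      simp only [hH, pow_zero, div_one]
      refine (abs_sub _ _).trans ?_
      have : |κ 1 * (3 * x - 1) / 2| ≤ |κ 1| := by
        rw [mul_div_assoc, abs_mul]
        have : |(3 * x - 1) / 2| ≤ 1 := abs_le.2 ⟨by linarith, by linarith⟩
        nlinarith [abs_nonneg (κ 1)]
      linarith [hb x hx hx1]
    | succ n ih =>
      intro x hx hx1
      rw [pow_succ, ← div_div, le_div_iff₀ (by norm_num)]
      by_cases hx2 : x ≤ 1/2
      · have := ih (2 * x) (by linarith) (by linarith)
        rw [dbl x hx hx2, abs_mul] at this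
        norm_num at this; linarith
      · have h2 := ih (2 * (1 - x)) (by linarith) (by linarith)
        rw [dbl (1 - x) (by linarith) (by linarith), e2 x hx hx1, abs_mul, abs_neg] at h2
        norm_num at h2; linarith
  have hz : |H l| ≤ 0 := by
    have ht : Filter.Tendsto (fun n : ℕ => (b + |κ 1|) / 2 ^ n) Filter.atTop (nhds 0) := by
      have := (tendsto_pow_atTop_nhds_zero_of_lt_one (r := (1/2 : ℝ)) (by norm_num) (by norm_num)).const_mul (b + |κ 1|)
      simpa [div_eq_mul_inv] using this
    exact ge_of_tendsto' ht (fun n => key n l h0 h1)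
  have := abs_nonpos_iff.1 hz
  simp only [hH] at this; linarith

lemma exists_rotv (φ : ℝ) : ∃ U : E3 ≃ₗᵢ[ℝ] E3, ∀ x, U x = rotv φ x := by
  have n1 : ∀ {x : E3}, ‖x‖ ^ 2 = 1 → ‖x‖ = 1 := fun {x} hx => by
    have := norm_nonneg x; nlinarith
  have hcs := Real.sin_sq_add_cos_sq φ
  obtain ⟨W, hW, hWe⟩ := exists_isoF (Ω := Unit) (a := fun ω => mk3 1 0 0)
      (b := fun ω => mk3 0 (Real.cos φ) (Real.sin φ)) (c := fun _ => mk3 0 (-(Real.sin φ)) (Real.cos φ))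
      (by fun_prop) (by fun_prop) (by fun_prop)
      (fun ω => norm_e1)
      (fun ω => n1 (by rw [mk3_norm_sq]; linarith))
      (fun ω => n1 (by rw [mk3_norm_sq]; linarith))
      (fun ω => by rw [inner_mk3]; ring) (fun ω => by rw [inner_mk3]; ring)
      (fun ω => by rw [inner_mk3]; ring)
  refine ⟨W (), fun x => ?_⟩
  rw [hWe]; ext i; fin_cases i <;> simp [mk3, rotv] <;> ring

lemma continuous_rotv : Continuous fun p : ℝ × E3 => rotv p.1 p.2 := by
  unfold rotv; fun_prop

lemma norm_sq_coord (x : E3) : ‖x‖ ^ 2 = x 0 ^ 2 + x 1 ^ 2 + x 2 ^ 2 := by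
  rw [← mk3_norm_sq, mk3_eta]

section axial

lemma av_scale {f : E3 → ℝ} {B : ℝ} (hf : RFF f B 0)
    (t a ρ : ℝ) : av (fun x => ‖x‖ ^ 2 * f x) (t * a) (t * ρ) =
    t ^ 2 * av (fun x => ‖x‖ ^ 2 * f x) a ρ := by
  unfold av
  rw [← intervalIntegral.integral_const_mul]
  congr 1; ext θ
  rw [← hf.scale]
  have : mk3 (t * a) (t * ρ * Real.cos θ) (t * ρ * Real.sin θ) =
      t • mk3 a (ρ * Real.cos θ) (ρ * Real.sin θ) := by
    ext i; fin_cases i <;> simp [mk3, mul_assoc]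
  rw [this]

lemma av_even {f : E3 → ℝ} {B : ℝ} (hf : RFF f B 0)
    (a ρ : ℝ) : av (fun x => ‖x‖ ^ 2 * f x) (-a) ρ =
    av (fun x => ‖x‖ ^ 2 * f x) a ρ := by
  have h1 := av_scale hf (-1) a (-ρ)
  have h2 := av_rot (fun x => ‖x‖ ^ 2 * f x) (mk3 a (-ρ) 0)
  have h3 := av_rot (fun x => ‖x‖ ^ 2 * f x) (mk3 a ρ 0)
  have h4 : av (fun x => ‖x‖ ^ 2 * f x) a (-ρ) = av (fun x => ‖x‖ ^ 2 * f x) a (√ (ρ ^ 2)) := by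
    have e : √ (ρ ^ 2) = √ ((mk3 a (-ρ) 0) 1 ^ 2 + (mk3 a (-ρ) 0) 2 ^ 2) := by simp [mk3]
    rw [e]
    refine Eq.trans ?_ h2
    unfold av rotv
    congr 1; ext θ; congr 2 <;> simp [mk3] <;> ring_nf
  have h5 : av (fun x => ‖x‖ ^ 2 * f x) a ρ = av (fun x => ‖x‖ ^ 2 * f x) a (√ (ρ ^ 2)) := by
    have e : √ (ρ ^ 2) = √ ((mk3 a ρ 0) 1 ^ 2 + (mk3 a ρ 0) 2 ^ 2) := by simp [mk3]
    rw [e]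
    refine Eq.trans ?_ h3
    unfold av rotv
    congr 1; ext θ; congr 2 <;> simp [mk3] <;> ring_nf
  rw [h5, ← h4]
  have : av (fun x => ‖x‖ ^ 2 * f x) (-a) ρ = av (fun x => ‖x‖ ^ 2 * f x) (-1 * a) (-1 * -ρ) := by
    congr 1 <;> ring
  rw [this, h1]; ring

lemma kappa_lin {f : E3 → ℝ} {B : ℝ} (hf : RFF f B 0)
    {l : ℝ} (h0 : 0 ≤ l) (h1 : l ≤ 1) :
    av (fun x => ‖x‖ ^ 2 * f x) (√l) (√(1 - l)) =
      2 * Real.pi * f (mk3 1 0 0) * (3 * l - 1) / 2 := by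
  have hB : 0 ≤ B := (abs_nonneg _).trans (hf.bdd (mk3 1 0 0) (mk3_ne (by norm_num)))
  have hcont := hf.cont
  have hk1 : av (fun x => ‖x‖ ^ 2 * f x) (√1) (√(1 - 1)) = 2 * Real.pi * f (mk3 1 0 0) := by
    unfold av
    simp [norm_e1]
  have := add3_linear (κ := fun l => av (fun x => ‖x‖ ^ 2 * f x) (√l) (√(1 - l)))
    (b := B * |2 * Real.pi - 0|) ?_ ?_ h0 h1
  · rw [this, hk1]
  · intro l h0 h1
    unfold av
    rw [← Real.norm_eq_abs (∫ θ in (0:ℝ)..(2 * Real.pi), _)]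
    apply intervalIntegral.norm_integral_le_of_norm_le_const
    intro θ _
    have hn : ‖mk3 (√l) (√(1 - l) * Real.cos θ) (√(1 - l) * Real.sin θ)‖ ^ 2 = 1 := by
      rw [mk3_norm_sq, mul_pow, mul_pow, Real.sq_sqrt h0, Real.sq_sqrt (by linarith)]
      have := Real.sin_sq_add_cos_sq θ
      linear_combination (1 - l) * this
    show ‖‖mk3 (√l) (√(1 - l) * Real.cos θ) (√(1 - l) * Real.sin θ)‖ ^ 2 * _‖ ≤ B
    rw [hn, one_mul]
    exact hf.bdd _ (fun h => by rw [h] at hn; simp at hn)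
  · intro x y z hx hy hz hs
    obtain ⟨U, hU, hU2, hU3⟩ := exists_iso_map (mk3 1 0 0) (mk3 (√x) (√y) (√z)) (by
      have h1 := mk3_norm_sq (√x) (√y) (√z)
      rw [Real.sq_sqrt hx, Real.sq_sqrt hy, Real.sq_sqrt hz, hs] at h1
      rw [norm_e1]
      have := norm_nonneg (mk3 (√x) (√y) (√z))
      nlinarith)
    have key : ∀ e : E3, ‖e‖ = 1 → ∀ m, 0 ≤ m → inner ℝ e (mk3 (√x) (√y) (√z)) = √m →
        av (fun x => ‖x‖ ^ 2 * f x) (√m) (√(1 - m)) =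
        ∫ φ in (0:ℝ)..(2 * Real.pi), f (rotv φ (U e)) := by
      intro e he m hm hin
      have h0 : (U e) 0 = √m := by
        have h1 : inner ℝ (U e) (mk3 1 0 0) = √m := by
          rw [← hU2, U.inner_map_map, hin]
        rw [← h1, ← mk3_eta (U e), inner_mk3]; simp [mk3]
      have hn : (U e) 0 ^ 2 + (U e) 1 ^ 2 + (U e) 2 ^ 2 = 1 := by
        rw [← norm_sq_coord, U.norm_map, he]; norm_num
      have h1 : (U e) 1 ^ 2 + (U e) 2 ^ 2 = 1 - m := by
        rw [h0, Real.sq_sqrt hm] at hn; linarith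
      have := av_rot (fun x => ‖x‖ ^ 2 * f x) (U e)
      rw [h0, h1] at this
      rw [← this]
      congr 1; ext φ
      obtain ⟨R, hR⟩ := exists_rotv φ
      rw [← hR, R.norm_map, U.norm_map, he]; simp
    have n2 : ‖mk3 0 1 0‖ = 1 := by
      have := mk3_norm_sq 0 1 0; have h := norm_nonneg (mk3 0 1 0); nlinarith
    have n3 : ‖mk3 0 0 1‖ = 1 := by
      have := mk3_norm_sq 0 0 1; have h := norm_nonneg (mk3 0 0 1); nlinarith
    have ci : ∀ e : E3, ‖e‖ = 1 → IntervalIntegrable (fun φ => f (rotv φ (U e)))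
        MeasureTheory.volume 0 (2 * Real.pi) := by
      intro e he
      apply Continuous.intervalIntegrable
      have h1 : Continuous fun φ => rotv φ (U e) := by
        have := continuous_rotv.comp (Continuous.prodMk_left (U e)); exact this
      have h2 := hcont.comp h1
      convert h2 using 1
      ext φ
      obtain ⟨R, hR⟩ := exists_rotv φ
      simp only [Function.comp]
      rw [← hR, R.norm_map, U.norm_map, he]; simp
    rw [key _ norm_e1 x hx (by rw [inner_mk3]; ring), key _ n2 y hy (by rw [inner_mk3]; ring),
      key _ n3 z hz (by rw [inner_mk3]; ring), ← intervalIntegral.integral_add (ci _ norm_e1) (ci _ n2),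
      ← intervalIntegral.integral_add ((ci _ norm_e1).add (ci _ n2)) (ci _ n3)]
    have : ∀ φ, f (rotv φ (U (mk3 1 0 0))) + f (rotv φ (U (mk3 0 1 0))) +
        f (rotv φ (U (mk3 0 0 1))) = 0 := by
      intro φ
      obtain ⟨R, hR⟩ := exists_rotv φ
      simp only [← hR]
      exact ((hf.comp R).comp U).frame _ _ _ (mk3_ne (by norm_num)) (mk3_ne (by norm_num))
        (mk3_ne (by norm_num)) (by simp [inner_mk3]) (by simp [inner_mk3]) (by simp [inner_mk3])
    simp [this]

lemma axial {f : E3 → ℝ} {B : ℝ} (hf : RFF f B 0)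
    (x : E3) : ∫ φ in (0:ℝ)..(2 * Real.pi), ‖rotv φ x‖ ^ 2 * f (rotv φ x) =
    2 * Real.pi * f (mk3 1 0 0) * (3 * x 0 ^ 2 - ‖x‖ ^ 2) / 2 := by
  by_cases hx : x = 0
  · subst hx
    have : ∀ φ, rotv φ 0 = 0 := fun φ => by
      ext i; fin_cases i <;> simp [rotv, mk3]
    simp [this]
  have hn : 0 < ‖x‖ := by simpa using hx
  have hn2 := norm_sq_coord x
  have h1 := av_rot (fun x => ‖x‖ ^ 2 * f x) x
  simp only at h1
  rw [h1]
  set l := x 0 ^ 2 / ‖x‖ ^ 2 with hl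
  have hl1 : l ≤ 1 := by rw [hl, div_le_one (by positivity)]; nlinarith [sq_nonneg (x 1), sq_nonneg (x 2)]
  have k := kappa_lin hf (l := l) (by positivity) hl1
  have e1 : ‖x‖ * √l = |x 0| := by
    rw [hl, Real.sqrt_div (sq_nonneg _), Real.sqrt_sq hn.le, Real.sqrt_sq_eq_abs]; field_simp
  have e2 : ‖x‖ * √(1 - l) = √(x 1 ^ 2 + x 2 ^ 2) := by
    have : 1 - l = (x 1 ^ 2 + x 2 ^ 2) / ‖x‖ ^ 2 := by rw [hl]; field_simp; linarith
    rw [this, Real.sqrt_div (by positivity), Real.sqrt_sq hn.le]; field_simp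
  have s := av_scale hf ‖x‖ (√l) (√(1 - l))
  rw [e1, e2, k] at s
  have s2 : av (fun x => ‖x‖ ^ 2 * f x) (x 0) √(x 1 ^ 2 + x 2 ^ 2) =
      av (fun x => ‖x‖ ^ 2 * f x) |x 0| √(x 1 ^ 2 + x 2 ^ 2) := by
    rcases abs_cases (x 0) with h | h
    · rw [h.1]
    · rw [h.1, av_even hf]
  rw [s2, s, hl]
  field_simp

end axial

end partE

section partF
open MeasureTheory
abbrev Kb : Set E3 := Metric.closedBall 0 1

lemma isCompact_Kb : IsCompact Kb := isCompact_closedBall _ _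

lemma setInt_iso (U : E3 ≃ₗᵢ[ℝ] E3) (g : E3 → ℝ) :
    ∫ x in Kb, g (U x) = ∫ x in Kb, g x := by
  have h := (U.measurePreserving).setIntegral_preimage_emb
    U.toHomeomorph.measurableEmbedding g Kb
  rw [← h]
  congr 2
  ext x; simp

def qq (x : E3) : ℝ := (3 * x 0 ^ 2 - ‖x‖ ^ 2) / 2

lemma continuous_qq : Continuous qq := by unfold qq; fun_prop

lemma qq_rotv (φ : ℝ) (x : E3) : qq (rotv φ x) = qq x := by
  obtain ⟨U, hU⟩ := exists_rotv φ
  unfold qq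
  rw [← hU, U.norm_map, hU]; simp [rotv, mk3]

lemma T_e1 {f : E3 → ℝ} {B : ℝ} (hf : RFF f B 0) :
    ∫ x in Kb, qq x * (‖x‖ ^ 2 * f x) = f (mk3 1 0 0) * ∫ x in Kb, qq x ^ 2 := by
  have hc := hf.cont
  have h1 : ∀ φ, ∫ x in Kb, qq x * (‖rotv φ x‖ ^ 2 * f (rotv φ x)) =
      ∫ x in Kb, qq x * (‖x‖ ^ 2 * f x) := fun φ => by
    obtain ⟨U, hU⟩ := exists_rotv φ
    have := setInt_iso U (fun x => qq x * (‖x‖ ^ 2 * f x))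
    rw [← this]
    simp only [hU, qq_rotv]
  have h2 : ∫ φ in (0:ℝ)..(2 * Real.pi), ∫ x in Kb, qq x * (‖rotv φ x‖ ^ 2 * f (rotv φ x)) =
      2 * Real.pi * ∫ x in Kb, qq x * (‖x‖ ^ 2 * f x) := by
    simp only [h1]; simp
  rw [intervalIntegral_integral_swap] at h2
  · simp only [intervalIntegral.integral_const_mul, axial hf] at h2
    have e : ∀ x, qq x * (2 * Real.pi * f (mk3 1 0 0) * (3 * x 0 ^ 2 - ‖x‖ ^ 2) / 2) =
        (2 * Real.pi * f (mk3 1 0 0)) * qq x ^ 2 := fun x => by unfold qq; ring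
    simp only [e, integral_const_mul] at h2
    have hp : (2 * Real.pi) ≠ 0 := by positivity
    apply mul_left_cancel₀ hp
    rw [← h2]; ring
  · rw [Measure.prod_restrict]
    have : ContinuousOn (Function.uncurry fun (φ : ℝ) (x : E3) =>
        qq x * (‖rotv φ x‖ ^ 2 * f (rotv φ x))) (Set.Icc 0 (2 * Real.pi) ×ˢ Kb) := by
      apply Continuous.continuousOn
      have h3 := hc.comp continuous_rotv
      exact (continuous_qq.comp continuous_snd).mul h3
    have h4 := this.integrableOn_compact (μ := (volume : Measure ℝ).prod (volume : Measure E3))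
      (isCompact_Icc.prod isCompact_Kb)
    refine h4.mono_set ?_
    rw [Set.uIoc_of_le (by positivity)]
    exact Set.prod_mono Set.Ioc_subset_Icc_self le_rfl

lemma qq_pos : 0 < ∫ x in Kb, qq x ^ 2 := by
  have hcont : Continuous fun x => qq x ^ 2 := continuous_qq.pow 2
  rw [setIntegral_pos_iff_support_of_nonneg_ae]
  · have hopen : IsOpen ({x : E3 | qq x ≠ 0} ∩ Metric.ball 0 1) :=
      (isOpen_ne_fun continuous_qq continuous_const).inter Metric.isOpen_ball
    have hne : ({x : E3 | qq x ≠ 0} ∩ Metric.ball 0 1).Nonempty := by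
      have hn : ‖mk3 (1/2) 0 0‖ ^ 2 = 1/4 := by rw [mk3_norm_sq]; norm_num
      refine ⟨mk3 (1/2) 0 0, ?_, ?_⟩
      · simp only [Set.mem_ofPred_eq, qq, hn]
        simp [mk3]; norm_num
      · rw [mem_ball_zero_iff]
        nlinarith [norm_nonneg (mk3 (1/2) 0 0)]
    refine lt_of_lt_of_le (hopen.measure_pos volume hne) (measure_mono ?_)
    rintro x ⟨h1, h2⟩
    exact ⟨by simpa using h1, Metric.ball_subset_closedBall h2⟩
  · exact Filter.Eventually.of_forall fun x => by positivity
  · exact hcont.continuousOn.integrableOn_compact isCompact_Kb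

lemma T_p {f : E3 → ℝ} {B : ℝ} (hf : RFF f B 0) (p : E3) :
    ∫ x in Kb, (3 * inner ℝ p x ^ 2 - ‖p‖ ^ 2 * ‖x‖ ^ 2) / 2 * (‖x‖ ^ 2 * f x) =
      ‖p‖ ^ 2 * f p * ∫ x in Kb, qq x ^ 2 := by
  by_cases hp : p = 0
  · subst hp; simp
  have hn : 0 < ‖p‖ := by simpa using hp
  obtain ⟨U, hU, _⟩ := exists_iso_map (mk3 1 0 0) (‖p‖⁻¹ • p)
    (by rw [norm_e1, norm_smul, norm_inv, norm_norm, inv_mul_cancel₀ hn.ne'])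
  have h := T_e1 (hf.comp U)
  have hp' : p = ‖p‖ • U (mk3 1 0 0) := by rw [hU, smul_smul, mul_inv_cancel₀ hn.ne', one_smul]
  have hfp : f (U (mk3 1 0 0)) = f p := by rw [hU, hf.smul (inv_ne_zero hn.ne') hp]
  rw [← setInt_iso U]
  have e : ∀ x : E3, (3 * inner ℝ p (U x) ^ 2 - ‖p‖ ^ 2 * ‖U x‖ ^ 2) / 2 * (‖U x‖ ^ 2 * f (U x)) =
      ‖p‖ ^ 2 * (qq x * (‖x‖ ^ 2 * f (U x))) := fun x => by
    have : inner ℝ p (U x) = ‖p‖ * x 0 := by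
      conv_lhs => rw [hp']
      rw [real_inner_smul_left, U.inner_map_map]
      conv_lhs => rw [← mk3_eta x]
      rw [inner_mk3]; ring
    rw [this, U.norm_map]; unfold qq; ring
  simp only [e, integral_const_mul]
  rw [h, hfp]; ring

/-- Real Gleason theorem in dimension 3, parallelogram form -/
lemma realGleason {f : E3 → ℝ} {B w : ℝ} (hf : RFF f B w) (p q : E3) :
    ‖p + q‖ ^ 2 * f (p + q) + ‖p - q‖ ^ 2 * f (p - q) =
      2 * (‖p‖ ^ 2 * f p) + 2 * (‖q‖ ^ 2 * f q) := by
  have hg : RFF (fun x => f x - w / 3) (B + |w / 3|) 0 :=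
    ⟨fun x hx => (abs_sub _ _).trans (by have := hf.bdd x hx; linarith),
     fun u v x h1 h2 h3 h4 h5 h6 => by
      have := hf.frame u v x h1 h2 h3 h4 h5 h6; linarith⟩
  have hpl := parallelogram_law_with_norm ℝ p q
  have t1 := T_p hg (p + q)
  have t2 := T_p hg (p - q)
  have t3 := T_p hg p
  have t4 := T_p hg q
  have hc := hg.cont
  have ci : ∀ p : E3, IntegrableOn (fun x => (3 * inner ℝ p x ^ 2 - ‖p‖ ^ 2 * ‖x‖ ^ 2) / 2 *
      (‖x‖ ^ 2 * (f x - w / 3))) Kb := fun p => by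
    refine ContinuousOn.integrableOn_compact isCompact_Kb (Continuous.continuousOn ?_)
    exact Continuous.mul (by fun_prop) hc
  have key : (∫ x in Kb, (3 * inner ℝ (p + q) x ^ 2 - ‖p + q‖ ^ 2 * ‖x‖ ^ 2) / 2 *
      (‖x‖ ^ 2 * (f x - w / 3))) + (∫ x in Kb, (3 * inner ℝ (p - q) x ^ 2 - ‖p - q‖ ^ 2 * ‖x‖ ^ 2) / 2 *
      (‖x‖ ^ 2 * (f x - w / 3))) = 2 * (∫ x in Kb, (3 * inner ℝ p x ^ 2 - ‖p‖ ^ 2 * ‖x‖ ^ 2) / 2 *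
      (‖x‖ ^ 2 * (f x - w / 3))) + 2 * (∫ x in Kb, (3 * inner ℝ q x ^ 2 - ‖q‖ ^ 2 * ‖x‖ ^ 2) / 2 *
      (‖x‖ ^ 2 * (f x - w / 3))) := by
    rw [← integral_const_mul, ← integral_const_mul, ← integral_add (ci _) (ci _),
      ← integral_add ((ci _).const_mul 2) ((ci _).const_mul 2)]
    congr 1; ext x
    rw [inner_add_left, inner_sub_left]
    linear_combination (-(‖x‖ ^ 2) / 2 * (‖x‖ ^ 2 * (f x - w / 3))) * hpl
  rw [t1, t2, t3, t4] at key
  have hq := qq_pos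
  have := mul_right_cancel₀ hq.ne' (show
    (‖p + q‖ ^ 2 * (f (p + q) - w / 3) + ‖p - q‖ ^ 2 * (f (p - q) - w / 3)) * (∫ x in Kb, qq x ^ 2) =
    (2 * (‖p‖ ^ 2 * (f p - w / 3)) + 2 * (‖q‖ ^ 2 * (f q - w / 3))) * (∫ x in Kb, qq x ^ 2) by linarith)
  linear_combination this + w / 3 * hpl

end partF

section partG

section PMsec
variable {H K : Type*} [NormedAddCommGroup H] [InnerProductSpace ℂ H] [CompleteSpace H]
  [NormedAddCommGroup K] [InnerProductSpace ℂ K] [CompleteSpace K]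

lemma mulA (f g : H →L[ℂ] H) (x : H) : (f * g) x = f (g x) := rfl

/-- bounded finitely additive real measure on projections -/
structure PM (m : (H →L[ℂ] H) → ℝ) (C : ℝ) : Prop where
  bdd : ∀ p, IsStarProjection p → |m p| ≤ C
  add : ∀ p q, IsStarProjection p → IsStarProjection q → p * q = 0 → m (p + q) = m p + m q

lemma PM.zero {m : (H →L[ℂ] H) → ℝ} {C : ℝ} (hm : PM m C) : m 0 = 0 := by
  have := hm.add 0 0 (IsStarProjection.zero _) (IsStarProjection.zero _) (by simp)
  simp at this; exact this

lemma PM.C_nonneg {m : (H →L[ℂ] H) → ℝ} {C : ℝ} (hm : PM m C) : 0 ≤ C :=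
  (abs_nonneg _).trans (hm.bdd 0 (IsStarProjection.zero _))

lemma mul_sum_zero {R ι : Type*} [Ring R] (p : ι → R) (horth : ∀ i j, i ≠ j → p i * p j = 0)
    (s : Finset ι) (a : ι) (ha : a ∉ s) : p a * ∑ i ∈ s, p i = 0 := by
  rw [Finset.mul_sum]
  refine Finset.sum_eq_zero fun i hi => horth a i ?_
  rintro rfl; exact ha hi

lemma proj_sum {ι : Type*} (p : ι → H →L[ℂ] H) (hp : ∀ i, IsStarProjection (p i))
    (horth : ∀ i j, i ≠ j → p i * p j = 0) (s : Finset ι) : IsStarProjection (∑ i ∈ s, p i) := by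
  classical
  induction s using Finset.induction_on with
  | empty => simp
  | insert a s ha ih =>
    rw [Finset.sum_insert ha]
    exact (hp a).add ih (mul_sum_zero p horth s a ha)

lemma PM.sum {m : (H →L[ℂ] H) → ℝ} {C : ℝ} (hm : PM m C) {ι : Type*} (p : ι → H →L[ℂ] H)
    (hp : ∀ i, IsStarProjection (p i))
    (horth : ∀ i j, i ≠ j → p i * p j = 0) (s : Finset ι) :
    m (∑ i ∈ s, p i) = ∑ i ∈ s, m (p i) := by
  classical
  induction s using Finset.induction_on with
  | empty => simpa using hm.zero
  | insert a s ha ih =>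
    rw [Finset.sum_insert ha, Finset.sum_insert ha, hm.add _ _ (hp a) (proj_sum p hp horth s)
      (mul_sum_zero p horth s a ha), ih]

/-- columns -/
def col {n : ℕ} (z : Fin n → K →L[ℂ] H) (A : Fin n → K →L[ℂ] K) : K →L[ℂ] H :=
  ∑ i, z i ∘L A i

def pr (X : K →L[ℂ] H) : H →L[ℂ] H := X ∘L adjoint X

def Ort {n : ℕ} (z : Fin n → K →L[ℂ] H) : Prop :=
  ∀ i j, adjoint (z i) ∘L z j = if i = j then ContinuousLinearMap.id ℂ K else 0

lemma adj_col_comp {n : ℕ} {z : Fin n → K →L[ℂ] H} (hz : Ort z) (A B : Fin n → K →L[ℂ] K) :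
    adjoint (col z A) ∘L col z B = ∑ i, star (A i) * B i := by
  ext x
  simp only [col, map_sum, adjoint_comp, comp_apply, sum_apply, mulA, star_eq_adjoint]
  rw [Finset.sum_comm]
  refine Finset.sum_congr rfl fun i _ => ?_
  rw [Finset.sum_eq_single i, ← comp_apply (adjoint (z i)), hz i i]
  · simp
  · intro j _ hj
    rw [← comp_apply (adjoint (z i)), hz i j, if_neg hj.symm]; simp
  · simp

lemma pr_sa (X : K →L[ℂ] H) : IsSelfAdjoint (pr X) := by
  rw [isSelfAdjoint_iff, star_eq_adjoint, pr, adjoint_comp, adjoint_adjoint]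

lemma pr_proj {X : K →L[ℂ] H} (e : K →L[ℂ] K) (h : adjoint X ∘L X = e) (he : X ∘L e = X) :
    IsStarProjection (pr X) := by
  refine ⟨?_, pr_sa X⟩
  unfold IsIdempotentElem pr
  ext x
  have h1 := fun y => DFunLike.congr_fun h y
  have h2 := fun y => DFunLike.congr_fun he y
  simp only [comp_apply] at h1 h2
  simp only [mulA, comp_apply, h1, h2]

lemma pr_proj_iso {X : K →L[ℂ] H} (h : adjoint X ∘L X = 1) :
    IsStarProjection (pr X) := pr_proj 1 h (by ext; simp)

lemma pr_orth {X Y : K →L[ℂ] H} (h : adjoint X ∘L Y = 0) : pr X * pr Y = 0 := by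
  unfold pr
  ext x
  have h1 := fun y => DFunLike.congr_fun h y
  simp only [comp_apply, zero_apply] at h1
  simp only [mulA, comp_apply, h1, map_zero, zero_apply]

def mat {n : ℕ} (z : Fin n → K →L[ℂ] H) (M : Fin n → Fin n → K →L[ℂ] K) : H →L[ℂ] H :=
  ∑ i, ∑ j, z i ∘L M i j ∘L adjoint (z j)

lemma pr_col {n : ℕ} (z : Fin n → K →L[ℂ] H) (A : Fin n → K →L[ℂ] K) :
    pr (col z A) = mat z (fun i j => A i * star (A j)) := by
  ext x
  simp only [pr, col, mat, map_sum, adjoint_comp, comp_apply, sum_apply, mulA,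
    star_eq_adjoint]
  rw [Finset.sum_comm]

lemma mat_add {n : ℕ} (z : Fin n → K →L[ℂ] H) (M N : Fin n → Fin n → K →L[ℂ] K) :
    mat z M + mat z N = mat z (fun i j => M i j + N i j) := by
  ext x
  simp [mat, Finset.sum_add_distrib]

/-! ### The general frame function -/

variable {Ω : Type*} [TopologicalSpace Ω]

open Classical in
def coef (u : Ω → E3) (i : Fin 3) : C(Ω, ℝ) :=
  if h : Continuous (fun ω => u ω i / ‖u ω‖) then ⟨_, h⟩ else 0

lemma coef_apply {u : Ω → E3} (hu : Continuous u) (h0 : ∀ ω, u ω ≠ 0) (i : Fin 3) (ω : Ω) :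
    coef u i ω = u ω i / ‖u ω‖ := by
  have : Continuous (fun ω => u ω i / ‖u ω‖) := by
    refine Continuous.div ?_ hu.norm (fun ω => norm_ne_zero_iff.2 (h0 ω))
    fun_prop
  simp [coef, this]

def genf (m : (H →L[ℂ] H) → ℝ) (z : Fin 3 → K →L[ℂ] H) (Φ : C(Ω, ℝ) →ₙ+* (K →L[ℂ] K))
    (u : Ω → E3) : ℝ := m (pr (col z (fun i => Φ (coef u i))))

lemma sum_coef {u v : Ω → E3} (hu : Continuous u) (h0 : ∀ ω, u ω ≠ 0) (hv : Continuous v)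
    (h0' : ∀ ω, v ω ≠ 0) (ω : Ω) : ∑ i, coef u i ω * coef v i ω
      = inner ℝ (u ω) (v ω) / (‖u ω‖ * ‖v ω‖) := by
  simp only [coef_apply hu h0, coef_apply hv h0', PiLp.inner_apply, Fin.sum_univ_three]
  simp
  ring

lemma sum_coef_self {u : Ω → E3} (hu : Continuous u) (h0 : ∀ ω, u ω ≠ 0) :
    ∑ i, coef u i * coef u i = 1 := by
  ext ω
  have := sum_coef hu h0 hu h0 ω
  rw [real_inner_self_eq_norm_mul_norm, div_self] at this
  · simpa using this
  · have := norm_ne_zero_iff.2 (h0 ω); positivity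

lemma sum_coef_orth {u v : Ω → E3} (hu : Continuous u) (h0 : ∀ ω, u ω ≠ 0) (hv : Continuous v)
    (h0' : ∀ ω, v ω ≠ 0) (h : ∀ ω, inner ℝ (u ω) (v ω) = 0) :
    ∑ i, coef u i * coef v i = 0 := by
  ext ω
  have := sum_coef hu h0 hv h0' ω
  rw [h, zero_div] at this
  simpa using this

theorem genf_FF {m : (H →L[ℂ] H) → ℝ} {C : ℝ} (hm : PM m C) {z : Fin 3 → K →L[ℂ] H} (hz : Ort z)
    (Φ : C(Ω, ℝ) →ₙ+* (K →L[ℂ] K)) (hΦ : ∀ f, star (Φ f) = Φ f) :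
    FF (genf m z Φ) C (m (mat z (fun i j => if i = j then Φ 1 else 0))) := by
  have key : ∀ u v : Ω → E3, adjoint (col z (fun i => Φ (coef u i))) ∘L
      (col z (fun i => Φ (coef v i))) = Φ (∑ i, coef u i * coef v i) := by
    intro u v
    rw [adj_col_comp hz]; simp [hΦ, map_sum]
  have hP : ∀ u : Ω → E3, Continuous u → (∀ ω, u ω ≠ 0) →
      IsStarProjection (pr (col z (fun i => Φ (coef u i)))) := by
    intro u hu h0
    refine pr_proj (Φ 1) (by rw [key, sum_coef_self hu h0]) ?_
    have : ∀ g, Φ g * Φ 1 = Φ g := fun g => by rw [← map_mul, mul_one]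
    have h2 : ∀ g y, Φ g (Φ 1 y) = Φ g y := fun g y => by
      rw [← mulA, this]
    ext y
    simp [col, sum_apply, h2]
  refine ⟨fun u hu h0 => hm.bdd _ (hP u hu h0), ?_⟩
  intro u v x hF
  have o1 : pr (col z (fun i => Φ (coef u i))) * pr (col z (fun i => Φ (coef v i))) = 0 := by
    refine pr_orth ?_
    rw [key, sum_coef_orth hF.cu hF.nu hF.cv hF.nv hF.uv, map_zero]
  have o2 : pr (col z (fun i => Φ (coef u i))) * pr (col z (fun i => Φ (coef x i))) = 0 := by
    refine pr_orth ?_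
    rw [key, sum_coef_orth hF.cu hF.nu hF.cx hF.nx hF.ux, map_zero]
  have o3 : pr (col z (fun i => Φ (coef v i))) * pr (col z (fun i => Φ (coef x i))) = 0 := by
    refine pr_orth ?_
    rw [key, sum_coef_orth hF.cv hF.nv hF.cx hF.nx hF.vx, map_zero]
  have p1 := hP u hF.cu hF.nu
  have p2 := hP v hF.cv hF.nv
  have p3 := hP x hF.cx hF.nx
  unfold genf
  rw [← hm.add _ _ p1 p2 o1, ← hm.add _ _ (p1.add p2 o1) p3 (by rw [add_mul, o2, o3, add_zero])]
  congr 1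
  rw [pr_col, pr_col, pr_col, mat_add, mat_add]
  congr 1
  funext i j
  simp only [hΦ, ← map_mul, ← map_add]
  have hO : ∀ ω, coef u i ω * coef u j ω + coef v i ω * coef v j ω + coef x i ω * coef x j ω
      = if i = j then 1 else 0 := by
    intro ω
    let O : Matrix (Fin 3) (Fin 3) ℝ := fun k l => (![coef u l ω, coef v l ω, coef x l ω]) k
    have hOO : O * O.transpose = 1 := by
      have e1 := congrArg (fun f : C(Ω, ℝ) => f ω) (sum_coef_self hF.cu hF.nu)
      have e2 := congrArg (fun f : C(Ω, ℝ) => f ω) (sum_coef_self hF.cv hF.nv)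
      have e3 := congrArg (fun f : C(Ω, ℝ) => f ω) (sum_coef_self hF.cx hF.nx)
      have e4 := congrArg (fun f : C(Ω, ℝ) => f ω) (sum_coef_orth hF.cu hF.nu hF.cv hF.nv hF.uv)
      have e5 := congrArg (fun f : C(Ω, ℝ) => f ω) (sum_coef_orth hF.cu hF.nu hF.cx hF.nx hF.ux)
      have e6 := congrArg (fun f : C(Ω, ℝ) => f ω) (sum_coef_orth hF.cv hF.nv hF.cx hF.nx hF.vx)
      simp [Fin.sum_univ_three] at e1 e2 e3 e4 e5 e6
      ext k l
      fin_cases k <;> fin_cases l <;>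
        simp only [Matrix.mul_apply, Fin.sum_univ_three, Matrix.transpose_apply] <;> simp [O] <;> linarith
    have h2 := mul_eq_one_comm.1 hOO
    have h3 := congrFun (congrFun h2 i) j
    simp only [Matrix.mul_apply, Fin.sum_univ_three, Matrix.transpose_apply] at h3
    simp [O, Matrix.one_apply] at h3
    exact h3
  have : coef u i * coef u j + coef v i * coef v j + coef x i * coef x j
      = if i = j then 1 else 0 := by
    ext ω
    have := hO ω
    split_ifs with h <;> simpa [h] using this
  rw [this]
  split_ifs <;> simp

end PMsec

end partG

section partH

section RGsec
variable {H K : Type*} [NormedAddCommGroup H] [InnerProductSpace ℂ H] [CompleteSpace H]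
  [NormedAddCommGroup K] [InnerProductSpace ℂ K] [CompleteSpace K]

def PhiU (q : K →L[ℂ] K) (hq : q * q = q) : C(Unit, ℝ) →ₙ+* (K →L[ℂ] K) where
  toFun f := f () • q
  map_zero' := by simp
  map_add' f g := by simp [add_smul]
  map_mul' f g := by
    simp only [ContinuousMap.coe_mul, Pi.mul_apply]
    rw [smul_mul_smul_comm, hq]

lemma coef_mk3 (a b c : ℝ) (h : a ^ 2 + b ^ 2 + c ^ 2 = 1) (i : Fin 3) :
    coef (fun _ : Unit => mk3 a b c) i () = ![a, b, c] i := by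
  rw [coef_apply (by fun_prop) (fun _ => mk3_ne (by rw [h]; norm_num))]
  have : ‖mk3 a b c‖ = 1 := by
    have := mk3_norm_sq a b c
    rw [h] at this
    nlinarith [norm_nonneg (mk3 a b c)]
  rw [this, div_one]
  rfl

theorem pm_RG {m : (H →L[ℂ] H) → ℝ} {C : ℝ} (hm : PM m C) {z : Fin 3 → K →L[ℂ] H} (hz : Ort z)
    {q : K →L[ℂ] K} (hq : IsStarProjection q) {c s : ℝ} (hcs : c ^ 2 + s ^ 2 = 1) :
    m (pr (col z ![c • q, s • q, 0])) + m (pr (col z ![c • q, -(s • q), 0]))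
      = 2 * (c ^ 2 * m (pr (z 0 ∘L q))) + 2 * (s ^ 2 * m (pr (z 1 ∘L q))) := by
  have hq1 : q * q = q := hq.1
  have hq2 : star q = q := hq.2
  have hFF := genf_FF hm hz (PhiU q hq1) (by
    intro f
    change star (f () • q) = f () • q
    rw [star_smul, hq2]; simp)
  set f := genf m z (PhiU q hq1) with hfdef
  have hR : RFF (fun x => f (fun _ => x)) C _ := ⟨fun x hx => hFF.bdd _ continuous_const (fun _ => hx),
    fun u v x hu hv hx h1 h2 h3 => hFF.frame _ _ _ ⟨continuous_const, continuous_const,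
      continuous_const, fun _ => hu, fun _ => hv, fun _ => hx, fun _ => h1, fun _ => h2, fun _ => h3⟩⟩
  have hval : ∀ a b : ℝ, a ^ 2 + b ^ 2 = 1 →
      f (fun _ => mk3 a b 0) = m (pr (col z ![a • q, b • q, 0])) := by
    intro a b hab
    rw [hfdef]
    unfold genf
    congr 3
    funext i
    change (coef (fun _ : Unit => mk3 a b 0) i ()) • q = _
    rw [coef_mk3 a b 0 (by linarith)]
    fin_cases i <;> simp
  have h := realGleason hR (mk3 c 0 0) (mk3 0 s 0)
  have e1 : mk3 c 0 0 + mk3 0 s 0 = mk3 c s 0 := by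
    ext i; fin_cases i <;> simp [mk3]
  have e2 : mk3 c 0 0 - mk3 0 s 0 = mk3 c (-s) 0 := by
    ext i; fin_cases i <;> simp [mk3]
  rw [e1, e2] at h
  simp only [mk3_norm_sq] at h
  rw [hval c s hcs, hval c (-s) (by rw [neg_sq, hcs])] at h
  have s1 : c ^ 2 * f (fun _ => mk3 c 0 0) = c ^ 2 * m (pr (z 0 ∘L q)) := by
    by_cases hc : c = 0
    · simp [hc]
    · have : mk3 c 0 0 = c • mk3 1 0 0 := by ext i; fin_cases i <;> simp [mk3]
      have h2 := hR.smul hc (mk3_ne (a := 1) (b := 0) (c := 0) (by norm_num))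
      rw [this, h2, hval 1 0 (by norm_num)]
      congr 3
      ext x; simp [col, Fin.sum_univ_three]
  have s2 : s ^ 2 * f (fun _ => mk3 0 s 0) = s ^ 2 * m (pr (z 1 ∘L q)) := by
    by_cases hc : s = 0
    · simp [hc]
    · have : mk3 0 s 0 = s • mk3 0 1 0 := by ext i; fin_cases i <;> simp [mk3]
      have h2 := hR.smul hc (mk3_ne (a := 0) (b := 1) (c := 0) (by norm_num))
      rw [this, h2, hval 0 1 (by norm_num)]
      congr 3
      ext x; simp [col, Fin.sum_univ_three]
  rw [← s1, ← s2, ← neg_smul]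
  have e3 : c ^ 2 + s ^ 2 + 0 ^ 2 = 1 := by linarith
  have e4 : c ^ 2 + (-s) ^ 2 + 0 ^ 2 = 1 := by rw [neg_sq]; linarith
  rw [e3, e4] at h
  linarith

theorem pm_Cop (C η : ℝ) (hη : 0 < η) : ∃ ε > 0, ∀ (H K : Type u) [NormedAddCommGroup H]
    [InnerProductSpace ℂ H] [CompleteSpace H] [NormedAddCommGroup K] [InnerProductSpace ℂ K]
    [CompleteSpace K] (m : (H →L[ℂ] H) → ℝ), PM m C → ∀ (z : Fin 3 → K →L[ℂ] H), Ort z →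
    ∀ c s : K →L[ℂ] K, IsSelfAdjoint s → 0 ≤ c → c * c + s * s = 1 → ‖s‖ ≤ ε →
    |m (pr (z 0)) - m (pr (col z ![c, s, 0]))| ≤ η := by
  obtain ⟨ε, hε, h⟩ := lemC1 C η hη
  refine ⟨min (ε / 2) (1 / 2), by positivity, ?_⟩
  intro H K _ _ _ _ _ _ m hm z hz c s hs hc hcs hsn
  let Φ0 := cfcHom (R := ℝ) (a := s) hs
  have hFF := genf_FF hm hz (Φ0 : C(spectrum ℝ s, ℝ) →ₙ+* (K →L[ℂ] K)) (by
    intro f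
    change star (Φ0 f) = Φ0 f
    rw [← map_star]; simp)
  have hsp : ∀ ω : spectrum ℝ s, |(ω : ℝ)| ≤ min (ε / 2) (1 / 2) := by
    intro ω
    have h1 := spectrum.norm_le_norm_mul_of_mem ω.2
    have h2 : ‖(1 : K →L[ℂ] K)‖ ≤ 1 := ContinuousLinearMap.norm_id_le
    rw [Real.norm_eq_abs] at h1
    nlinarith [norm_nonneg s]
  have hsp1 : ∀ ω : spectrum ℝ s, (ω : ℝ) ^ 2 ≤ 1 / 4 := by
    intro ω
    have := (hsp ω).trans (min_le_right _ _)
    rw [← sq_abs]; nlinarith [abs_nonneg (ω : ℝ)]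
  have hsp2 : ∀ ω : spectrum ℝ s, (ω : ℝ) ^ 2 ≤ ε ^ 2 / 4 := by
    intro ω
    have := (hsp ω).trans (min_le_left _ _)
    rw [← sq_abs]; nlinarith [abs_nonneg (ω : ℝ)]
  have key := h (spectrum ℝ s) _ _ hFF (fun ω => Real.sqrt (1 - (ω : ℝ) ^ 2)) (fun ω => (ω : ℝ))
    (by fun_prop) (by fun_prop) (fun ω => by
      rw [Real.sq_sqrt (by linarith [hsp1 ω])]; ring) (fun ω => by
      have h0 := Real.sqrt_nonneg (1 - (ω : ℝ) ^ 2)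
      have h1 := Real.sq_sqrt (show 0 ≤ 1 - (ω : ℝ) ^ 2 by linarith [hsp1 ω])
      have h2 := hsp2 ω
      nlinarith)
  have v1 : genf m z (Φ0 : C(spectrum ℝ s, ℝ) →ₙ+* (K →L[ℂ] K)) (fun _ => mk3 1 0 0)
      = m (pr (z 0)) := by
    unfold genf
    congr 2
    have hn : ‖mk3 1 0 0‖ = 1 := by
      have := mk3_norm_sq 1 0 0
      nlinarith [norm_nonneg (mk3 1 0 0)]
    have : ∀ i, coef (fun _ : spectrum ℝ s => mk3 1 0 0) i = if i = 0 then 1 else 0 := by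
      intro i
      ext ω
      rw [coef_apply (by fun_prop) (fun _ => mk3_ne (by norm_num)), hn]
      fin_cases i <;> simp [mk3]
    have h1 : (Φ0 : C(spectrum ℝ s, ℝ) →ₙ+* (K →L[ℂ] K)) 1 = 1 := map_one Φ0
    ext x
    simp [col, this, Fin.sum_univ_three, h1]
  have v2 : genf m z (Φ0 : C(spectrum ℝ s, ℝ) →ₙ+* (K →L[ℂ] K))
      (fun ω => mk3 (Real.sqrt (1 - (ω : ℝ) ^ 2)) (ω : ℝ) 0)
      = m (pr (col z ![c, s, 0])) := by
    unfold genf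
    have hcf : ∀ i ω, coef (fun ω : spectrum ℝ s => mk3 (Real.sqrt (1 - (ω : ℝ) ^ 2)) (ω : ℝ) 0) i ω
        = ![Real.sqrt (1 - (ω : ℝ) ^ 2), (ω : ℝ), 0] i := by
      intro i ω
      have h1 : ∀ ω : spectrum ℝ s, (Real.sqrt (1 - (ω : ℝ) ^ 2)) ^ 2 + (ω : ℝ) ^ 2 + 0 ^ 2 = 1 := by
        intro ω
        rw [Real.sq_sqrt (by linarith [hsp1 ω])]; ring
      rw [coef_apply (by fun_prop) (fun ω => mk3_ne (by rw [h1]; norm_num))]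
      have : ‖mk3 (Real.sqrt (1 - (ω : ℝ) ^ 2)) (ω : ℝ) 0‖ = 1 := by
        have := mk3_norm_sq (Real.sqrt (1 - (ω : ℝ) ^ 2)) (ω : ℝ) 0
        rw [h1] at this
        nlinarith [norm_nonneg (mk3 (Real.sqrt (1 - (ω : ℝ) ^ 2)) (ω : ℝ) 0)]
      rw [this, div_one]
      rfl
    congr 3
    funext i
    change Φ0 (coef _ i) = _
    fin_cases i
    · let g : C(spectrum ℝ s, ℝ) := ⟨fun ω => Real.sqrt (1 - (ω : ℝ) ^ 2), by fun_prop⟩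
      have hg : coef (fun ω : spectrum ℝ s => mk3 (Real.sqrt (1 - (ω : ℝ) ^ 2)) (ω : ℝ) 0) 0 = g := by
        ext ω; rw [hcf]; rfl
      change Φ0 (coef _ 0) = c
      rw [hg]
      have hid : Φ0 ((ContinuousMap.id ℝ).restrict (spectrum ℝ s)) = s := cfcHom_id hs
      have hg2 : Φ0 g * Φ0 g = 1 - s * s := by
        have h1 : (1 : K →L[ℂ] K) - s * s = Φ0 (1 - ((ContinuousMap.id ℝ).restrict (spectrum ℝ s))
            * ((ContinuousMap.id ℝ).restrict (spectrum ℝ s))) := by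
          simp only [map_sub, map_mul, map_one, hid]
        rw [h1, ← map_mul]
        congr 1
        ext ω
        have := Real.mul_self_sqrt (show 0 ≤ 1 - (ω : ℝ) ^ 2 by linarith [hsp1 ω])
        simp [g, this]; ring
      have hg0 : 0 ≤ Φ0 g := by
        have : Φ0 g = cfc (fun x : ℝ => Real.sqrt (1 - x ^ 2)) s := by
          rw [cfc_apply _ s hs (by fun_prop)]
          rfl
        rw [this]
        exact cfc_nonneg (fun x _ => Real.sqrt_nonneg _)
      have r1 := CFC.sqrt_unique hg2 hg0
      have r2 := CFC.sqrt_unique (show c * c = 1 - s * s by rw [← hcs]; abel) hc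
      rw [← r1, r2]
    · have hg : coef (fun ω : spectrum ℝ s => mk3 (Real.sqrt (1 - (ω : ℝ) ^ 2)) (ω : ℝ) 0) 1
          = (ContinuousMap.id ℝ).restrict (spectrum ℝ s) := by
        ext ω; rw [hcf]; rfl
      change Φ0 (coef _ 1) = s
      rw [hg]
      exact cfcHom_id hs
    · have hg : coef (fun ω : spectrum ℝ s => mk3 (Real.sqrt (1 - (ω : ℝ) ^ 2)) (ω : ℝ) 0) 2
          = 0 := by
        ext ω; rw [hcf]; rfl
      change Φ0 (coef _ 2) = 0
      rw [hg, map_zero]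
  rw [v1, v2] at key
  exact key

end RGsec

end partH

section partI

section SRsec
variable {K : Type*} [NormedAddCommGroup K] [InnerProductSpace ℂ K] [CompleteSpace K]

lemma starProj_isStarProj (N : Submodule ℂ K) [N.HasOrthogonalProjection] :
    IsStarProjection N.starProjection := by
  exact isStarProjection_starProjection

lemma starProj_commute (N : Submodule ℂ K) [N.HasOrthogonalProjection] (y : K →L[ℂ] K)
    (h1 : ∀ x ∈ N, y x ∈ N) (h2 : ∀ x ∈ N, star y x ∈ N) : Commute y N.starProjection := by
  set P := N.starProjection with hP
  have hs : star P = P := (starProj_isStarProj N).2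
  have e1 : P * (y * P) = y * P := by
    ext x
    exact Submodule.starProjection_eq_self_iff.2 (h1 _ (Submodule.starProjection_apply_mem N x))
  have e2 : P * (star y * P) = star y * P := by
    ext x
    exact Submodule.starProjection_eq_self_iff.2 (h2 _ (Submodule.starProjection_apply_mem N x))
  have e3 := congrArg star e2
  simp only [star_mul, star_star, hs] at e3
  change y * P = P * y
  rw [← e1, ← e3, mul_assoc]

lemma spectral_cut (x : K →L[ℂ] K) (hx : IsSelfAdjoint x) : ∃ P : K →L[ℂ] K, IsStarProjection P ∧
    (∀ y, Commute y x → Commute y P) ∧ 0 ≤ x * P ∧ x * (1 - P) ≤ 0 := by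
  set b := x⁺ with hb
  set c := x⁻ with hc
  have hbc : b * c = 0 := CFC.posPart_mul_negPart x
  have hx2 : x = b - c := (CFC.posPart_sub_negPart x hx).symm
  have hb0 : 0 ≤ b := CFC.posPart_nonneg x
  have hc0 : 0 ≤ c := CFC.negPart_nonneg x
  have hbs : star b = b := hb0.isSelfAdjoint
  have hcs : star c = c := hc0.isSelfAdjoint
  let N : Submodule ℂ K := LinearMap.ker (b : K →ₗ[ℂ] K)
  have hN : ∀ v, v ∈ N ↔ b v = 0 := fun v => by simp [N]
  have hclosed : IsClosed (N : Set K) := by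
    have : (N : Set K) = b ⁻¹' {0} := by ext v; simp [hN]
    rw [this]; exact isClosed_singleton.preimage b.continuous
  haveI : CompleteSpace N := hclosed.completeSpace_coe
  have hP := starProj_isStarProj N
  set P := N.starProjection
  have hs : star P = P := hP.2
  have bP : b * P = 0 := by
    ext v; exact (hN _).1 (Submodule.starProjection_apply_mem N v)
  have Pc : P * c = c := by
    ext v
    refine Submodule.starProjection_eq_self_iff.2 ((hN _).2 ?_)
    change (b * c) v = 0
    rw [hbc]; rfl
  have cP : c * P = c := by
    have := congrArg star Pc
    rwa [star_mul, hs, hcs] at this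
  refine ⟨1 - P, hP.one_sub, ?_, ?_, ?_⟩
  · intro y hy
    have hyb : Commute b y := by
      rw [hb, CFC.posPart_def]
      exact (Commute.cfcₙ_real hy.symm _)
    have hyb2 : Commute b (star y) := by
      have := congrArg star hyb.eq
      simp only [star_mul, hbs] at this
      exact this.symm
    refine (Commute.one_right y).sub_right (starProj_commute N y ?_ ?_)
    · intro v hv
      rw [hN] at hv ⊢
      rw [← mulA, hyb.eq, mulA, hv, map_zero]
    · intro v hv
      rw [hN] at hv ⊢
      rw [← mulA, hyb2.eq, mulA, hv, map_zero]
  · have : x * (1 - P) = b := by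
      rw [hx2, mul_sub, mul_one, sub_mul, bP, cP]; abel
    rw [this]; exact hb0
  · have : x * (1 - (1 - P)) = -c := by
      rw [hx2, sub_sub_cancel, sub_mul, bP, cP]; abel
    rw [this]; exact neg_nonpos.2 hc0

lemma conj_nonneg' {P x : K →L[ℂ] K} (hP : IsStarProjection P) (hx : 0 ≤ x) (hc : Commute x P) :
    0 ≤ x * P := by
  have h := star_right_conjugate_nonneg hx P
  have hs : star P = P := hP.2
  have h2 : P * P = P := hP.1
  rw [hs, ← hc.eq, mul_assoc, h2] at h
  exact h

structure IsRes {ι : Type*} [Fintype ι] (a : K →L[ℂ] K) (q : ι → K →L[ℂ] K) : Prop where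
  proj : ∀ j, IsStarProjection (q j)
  orth : ∀ i j, i ≠ j → q i * q j = 0
  sum : ∑ j, q j = 1
  comm : ∀ j y, Commute y a → Commute y (q j)

lemma IsRes.comm_self {ι : Type*} [Fintype ι] {a : K →L[ℂ] K} {q : ι → K →L[ℂ] K}
    (h : IsRes a q) (j : ι) : Commute a (q j) := h.comm j a (Commute.refl a)

lemma IsRes.mono {ι : Type*} [Fintype ι] {a b : K →L[ℂ] K} {q : ι → K →L[ℂ] K}
    (h : IsRes b q) (hab : ∀ y, Commute y a → Commute y b) : IsRes a q :=
  ⟨h.proj, h.orth, h.sum, fun j y hy => h.comm j y (hab y hy)⟩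

lemma IsRes.prod {ι κ : Type*} [Fintype ι] [Fintype κ] {a : K →L[ℂ] K} {q : ι → K →L[ℂ] K}
    {r : κ → K →L[ℂ] K} (h : IsRes a q) (h' : IsRes a r) :
    IsRes a (fun x : ι × κ => q x.1 * r x.2) := by
  have hc : ∀ i j, Commute (q i) (r j) := fun i j => h'.comm j _ (h.comm_self i).symm
  refine ⟨fun x => (h.proj _).mul (h'.proj _) (hc _ _), ?_, ?_, ?_⟩
  · rintro ⟨i, j⟩ ⟨i', j'⟩ hne
    simp only
    rw [mul_assoc, ← mul_assoc (r j), ← (hc i' j).eq, mul_assoc, ← mul_assoc]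
    by_cases hi : i = i'
    · have hj : j ≠ j' := by rintro rfl; exact hne (by rw [hi])
      rw [h'.orth _ _ hj, mul_zero]
    · rw [h.orth _ _ hi, zero_mul]
  · rw [Fintype.sum_prod_type]
    simp only
    simp_rw [← Finset.mul_sum, h'.sum, mul_one]
    exact h.sum
  · intro x y hy
    exact (h.comm _ y hy).mul_right (h'.comm _ y hy)

lemma SR01 (n : ℕ) : ∀ a : K →L[ℂ] K, 0 ≤ a → a ≤ 1 → ∃ (ι : Type) (_ : Fintype ι)
    (q : ι → K →L[ℂ] K) (l : ι → ℝ), IsRes a q ∧ (∀ j, 0 ≤ l j ∧ l j ≤ 1) ∧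
      ‖a - ∑ j, l j • q j‖ ≤ (1 / 2) ^ n := by
  induction n with
  | zero =>
    intro a h0 h1
    refine ⟨Unit, inferInstance, fun _ => 1, fun _ => 0, ⟨fun _ => IsStarProjection.one _, ?_, ?_, ?_⟩,
      fun _ => by norm_num, ?_⟩
    · intro i j hij; exact absurd rfl hij
    · simp
    · intro j y _; exact Commute.one_right y
    · simpa using (CStarAlgebra.norm_le_one_iff_of_nonneg a h0).2 h1
  | succ n ih =>
    intro a h0 h1
    have ha : IsSelfAdjoint a := h0.isSelfAdjoint
    have hx : IsSelfAdjoint (a + a - 1) := (ha.add ha).sub (IsSelfAdjoint.one _)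
    obtain ⟨P, hP, hPc, hP1, hP2⟩ := spectral_cut (a + a - 1) hx
    have hcomm : ∀ y, Commute y a → Commute y P := fun y hy =>
      hPc y ((hy.add_right hy).sub_right (Commute.one_right y))
    have hPP : P * P = P := hP.1
    have haP : Commute a P := hcomm a (Commute.refl a)
    have h0' : 0 ≤ a + a - P := by
      have e : a + a - P = (a + a - 1) * P + (a + a) * (1 - P) := by noncomm_ring
      rw [e]
      refine add_nonneg hP1 (conj_nonneg' hP.one_sub (add_nonneg h0 h0) ?_)
      exact (Commute.one_right _).sub_right (haP.add_left haP)
    have h1' : a + a - P ≤ 1 := by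
      rw [← sub_nonneg]
      have e : 1 - (a + a - P) = -((a + a - 1) * (1 - P)) + ((1 - a) + (1 - a)) * P := by
        noncomm_ring
      rw [e]
      have h3 : 0 ≤ 1 - a := sub_nonneg.2 h1
      refine add_nonneg (neg_nonneg.2 hP2) (conj_nonneg' hP (add_nonneg h3 h3) ?_)
      have := (Commute.one_left P).sub_left haP
      exact this.add_left this
    obtain ⟨ι, _, q, l, hq, hl, hn⟩ := ih (a + a - P) h0' h1'
    have hq' : IsRes a q := hq.mono fun y hy => (hy.add_right hy).sub_right (hcomm y hy)
    have hB : IsRes a (fun t : Bool => if t then P else 1 - P) := by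
      refine ⟨?_, ?_, ?_, ?_⟩
      · intro t; cases t
        · simpa using hP.one_sub
        · simpa using hP
      · intro s t hst
        cases s <;> cases t <;> simp at hst ⊢ <;> simp [sub_mul, mul_sub, hPP]
      · simp
      · intro t y hy; cases t
        · simpa using (Commute.one_right y).sub_right (hcomm y hy)
        · simpa using hcomm y hy
    refine ⟨ι × Bool, inferInstance, _, fun x => (l x.1 + if x.2 then 1 else 0) / 2,
      hq'.prod hB, ?_, ?_⟩
    · rintro ⟨j, t⟩
      have := hl j
      cases t <;> simp <;> constructor <;> linarith
    · have e : a - ∑ x : ι × Bool, ((l x.1 + if x.2 then 1 else 0) / 2) •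
          (q x.1 * if x.2 then P else 1 - P) = (1 / 2 : ℝ) • (a + a - P - ∑ j, l j • q j) := by
        have e1 : ∑ x : ι × Bool, ((l x.1 + if x.2 then 1 else 0) / 2) •
          (q x.1 * if x.2 then P else 1 - P)
          = (1 / 2 : ℝ) • (∑ j, l j • q j) + (1 / 2 : ℝ) • ((∑ j, q j) * P) := by
          rw [Fintype.sum_prod_type, Finset.sum_mul, Finset.smul_sum, Finset.smul_sum,
            ← Finset.sum_add_distrib]
          refine Finset.sum_congr rfl fun j _ => ?_
          simp only [Fintype.sum_bool, if_true, Bool.false_eq_true, if_false, mul_sub, mul_one]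
          module
        rw [e1, hq.sum, one_mul]
        module
      rw [e, norm_smul, pow_succ]
      norm_num
      linarith

lemma SRsa (a : K →L[ℂ] K) (ha : IsSelfAdjoint a) (ε : ℝ) (hε : 0 < ε) :
    ∃ (ι : Type) (_ : Fintype ι) (q : ι → K →L[ℂ] K) (l : ι → ℝ), IsRes a q ∧
      ‖a - ∑ j, l j • q j‖ ≤ ε := by
  set t := ‖a‖ + 1 with ht
  have htp : 0 < t := by positivity
  have hle : a ≤ algebraMap ℝ _ ‖a‖ := IsSelfAdjoint.le_algebraMap_norm_self ha
  have hge : -algebraMap ℝ _ ‖a‖ ≤ a := IsSelfAdjoint.neg_algebraMap_norm_le_self ha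
  have h1le : algebraMap ℝ (K →L[ℂ] K) ‖a‖ ≤ t • 1 := by
    rw [Algebra.algebraMap_eq_smul_one, ht, add_smul, one_smul]
    exact le_add_of_nonneg_right zero_le_one
  set a' := (1 / (2 * t)) • (a + t • 1) with ha'
  have h0 : 0 ≤ a' := by
    refine smul_nonneg (by positivity) ?_
    have := (neg_le_neg h1le).trans hge
    exact neg_le_iff_add_nonneg.1 this
  have h1 : a' ≤ 1 := by
    have : a + t • 1 ≤ (2 * t) • (1 : K →L[ℂ] K) := by
      have e : (2 * t) • (1 : K →L[ℂ] K) = t • 1 + t • 1 := by module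
      rw [e]
      exact add_le_add (hle.trans h1le) le_rfl
    have h2 := smul_le_smul_of_nonneg_left this (show 0 ≤ 1 / (2 * t) by positivity)
    rwa [smul_smul, one_div_mul_cancel (by positivity), one_smul] at h2
  obtain ⟨n, hn⟩ := exists_pow_lt_of_lt_one (show 0 < ε / (2 * t) by positivity)
    (show (1 / 2 : ℝ) < 1 by norm_num)
  obtain ⟨ι, _, q, l, hq, -, hnn⟩ := SR01 n a' h0 h1
  refine ⟨ι, inferInstance, q, fun j => 2 * t * l j - t, hq.mono fun y hy => ?_, ?_⟩
  · exact (hy.add_right ((Commute.one_right y).smul_right t)).smul_right _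
  · have e : a - ∑ j, (2 * t * l j - t) • q j = (2 * t) • (a' - ∑ j, l j • q j) := by
      have e2 : (2 * t) • a' = a + t • 1 := by
        rw [ha', smul_smul, mul_one_div_cancel (by positivity), one_smul]
      have e3 : ∑ j, (2 * t * l j) • q j = (2 * t) • ∑ j, l j • q j := by
        simp only [Finset.smul_sum, smul_smul]
      simp only [sub_smul, Finset.sum_sub_distrib, e3]
      rw [← Finset.smul_sum, hq.sum, smul_sub, e2]
      abel
    rw [e, norm_smul, Real.norm_of_nonneg (by positivity)]
    have := hnn.trans hn.le
    rw [le_div_iff₀ (by positivity)] at this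
    linarith
end SRsec

end partI

section partJ

section Musec
variable {K : Type*} [NormedAddCommGroup K] [InnerProductSpace ℂ K] [CompleteSpace K]

lemma PM.sum_abs {m : (K →L[ℂ] K) → ℝ} {C : ℝ} (hm : PM m C) {ι : Type*} (s : Finset ι)
    (p : ι → K →L[ℂ] K) (hp : ∀ i, IsStarProjection (p i))
    (horth : ∀ i j, i ≠ j → p i * p j = 0) : ∑ i ∈ s, |m (p i)| ≤ 2 * C := by
  classical
  rw [← Finset.sum_filter_add_sum_filter_not s (fun i => 0 ≤ m (p i))]
  have h1 : ∑ i ∈ s with 0 ≤ m (p i), |m (p i)| ≤ C := by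
    rw [Finset.sum_congr rfl (fun i hi => abs_of_nonneg (Finset.mem_filter.1 hi).2),
      ← hm.sum p hp horth]
    exact (le_abs_self _).trans (hm.bdd _ (proj_sum p hp horth _))
  have h2 : ∑ i ∈ s with ¬ 0 ≤ m (p i), |m (p i)| ≤ C := by
    rw [Finset.sum_congr rfl (fun i hi => abs_of_neg (not_le.1 (Finset.mem_filter.1 hi).2)),
      Finset.sum_neg_distrib, ← hm.sum p hp horth]
    exact (neg_le_abs _).trans (hm.bdd _ (proj_sum p hp horth _))
  linarith

lemma CB {m : (K →L[ℂ] K) → ℝ} {C : ℝ} (hm : PM m C) {ι : Type*} [Fintype ι]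
    (p : ι → K →L[ℂ] K) (hp : ∀ i, IsStarProjection (p i))
    (horth : ∀ i j, i ≠ j → p i * p j = 0) (l : ι → ℝ) :
    |∑ i, l i * m (p i)| ≤ 2 * C * ‖∑ i, l i • p i‖ := by
  classical
  set X := ∑ i, l i • p i with hX
  have hl : ∀ i, |l i * m (p i)| ≤ ‖X‖ * |m (p i)| := by
    intro i
    by_cases h0 : p i = 0
    · rw [h0, hm.zero]; simp
    · rw [abs_mul]
      refine mul_le_mul_of_nonneg_right ?_ (abs_nonneg _)
      have h1 : X * p i = l i • p i := by
        rw [hX, Finset.sum_mul, Finset.sum_eq_single i]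
        · rw [smul_mul_assoc, (hp i).1]
        · intro j _ hj; rw [smul_mul_assoc, horth j i hj, smul_zero]
        · simp
      have h2 := norm_mul_le X (p i)
      rw [h1, norm_smul, Real.norm_eq_abs] at h2
      exact le_of_mul_le_mul_right h2 (norm_pos_iff.2 h0)
  calc |∑ i, l i * m (p i)| ≤ ∑ i, |l i * m (p i)| := Finset.abs_sum_le_sum_abs _ _
    _ ≤ ∑ i, ‖X‖ * |m (p i)| := Finset.sum_le_sum fun i _ => hl i
    _ = ‖X‖ * ∑ i, |m (p i)| := by rw [Finset.mul_sum]
    _ ≤ ‖X‖ * (2 * C) := mul_le_mul_of_nonneg_left (hm.sum_abs _ p hp horth) (norm_nonneg _)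
    _ = _ := by ring

lemma CB2 {m : (K →L[ℂ] K) → ℝ} {C : ℝ} (hm : PM m C) {ι κ : Type*} [Fintype ι] [Fintype κ]
    {a : K →L[ℂ] K} {q : ι → K →L[ℂ] K} {r : κ → K →L[ℂ] K} (h : IsRes a q) (h' : IsRes a r)
    (l : ι → ℝ) (k : κ → ℝ) :
    |∑ i, l i * m (q i) - ∑ j, k j * m (r j)| ≤ 2 * C * ‖∑ i, l i • q i - ∑ j, k j • r j‖ := by
  have hpr := h.prod h'
  have hc : ∀ i j, Commute (q i) (r j) := fun i j => h'.comm j _ (h.comm_self i).symm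
  have e := CB hm _ hpr.proj hpr.orth (fun x => l x.1 - k x.2)
  have m1 : ∀ i, m (q i) = ∑ j, m (q i * r j) := by
    intro i
    rw [← hm.sum (fun j => q i * r j) (fun j => hpr.proj (i, j))
      (fun j j' hj => hpr.orth (i, j) (i, j') (by simpa using hj)), ← Finset.mul_sum, h'.sum, mul_one]
  have m2 : ∀ j, m (r j) = ∑ i, m (q i * r j) := by
    intro j
    rw [← hm.sum (fun i => q i * r j) (fun i => hpr.proj (i, j))
      (fun i i' hi => hpr.orth (i, j) (i', j) (by simpa using hi)), ← Finset.sum_mul, h.sum, one_mul]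
  have e1 : ∑ x : ι × κ, (l x.1 - k x.2) * m (q x.1 * r x.2)
      = ∑ i, l i * m (q i) - ∑ j, k j * m (r j) := by
    simp only [sub_mul, Finset.sum_sub_distrib]
    congr 1
    · rw [Fintype.sum_prod_type]
      exact Finset.sum_congr rfl fun i _ => by rw [m1 i, Finset.mul_sum]
    · rw [Fintype.sum_prod_type, Finset.sum_comm]
      exact Finset.sum_congr rfl fun j _ => by rw [m2 j, Finset.mul_sum]
  have e2 : ∑ x : ι × κ, (l x.1 - k x.2) • (q x.1 * r x.2)
      = ∑ i, l i • q i - ∑ j, k j • r j := by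
    simp only [sub_smul, Finset.sum_sub_distrib]
    congr 1
    · rw [Fintype.sum_prod_type]
      refine Finset.sum_congr rfl fun i _ => ?_
      simp only
      rw [← Finset.smul_sum, ← Finset.mul_sum, h'.sum, mul_one]
    · rw [Fintype.sum_prod_type, Finset.sum_comm]
      refine Finset.sum_congr rfl fun j _ => ?_
      simp only
      rw [← Finset.smul_sum, ← Finset.sum_mul, h.sum, one_mul]
  rw [e1, e2] at e
  exact e

def IsMu (m : (K →L[ℂ] K) → ℝ) (C : ℝ) (a : K →L[ℂ] K) (r : ℝ) : Prop :=
  ∀ (ι : Type) [Fintype ι] (q : ι → K →L[ℂ] K) (l : ι → ℝ), IsRes a q →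
    |r - ∑ j, l j * m (q j)| ≤ 2 * C * ‖a - ∑ j, l j • q j‖

lemma IsRes.one (a : K →L[ℂ] K) : IsRes a (fun _ : Unit => (1 : K →L[ℂ] K)) :=
  ⟨fun _ => IsStarProjection.one _, fun i j hij => absurd rfl hij, by simp,
    fun j y _ => Commute.one_right y⟩

lemma exists_IsMu {m : (K →L[ℂ] K) → ℝ} {C : ℝ} (hm : PM m C) (a : K →L[ℂ] K) :
    ∃ r, IsMu m C a r := by
  let S : Set ℝ := {x | ∃ (ι : Type) (_ : Fintype ι) (q : ι → K →L[ℂ] K) (l : ι → ℝ), IsRes a q ∧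
    x = ∑ j, l j * m (q j) - 2 * C * ‖a - ∑ j, l j • q j‖}
  have hC := hm.C_nonneg
  have hub : ∀ (ι : Type) [Fintype ι] (q : ι → K →L[ℂ] K) (l : ι → ℝ), IsRes a q → ∀ x ∈ S,
      x ≤ ∑ j, l j * m (q j) + 2 * C * ‖a - ∑ j, l j • q j‖ := by
    intro ι _ q l hq x ⟨κ, _, r, k, hr, hx⟩
    have h1 := (abs_le.1 (CB2 hm hr hq k l)).2
    have h2 : ‖∑ j, k j • r j - ∑ j, l j • q j‖ ≤ ‖a - ∑ j, k j • r j‖ + ‖a - ∑ j, l j • q j‖ := by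
      rw [norm_sub_rev a (∑ j, k j • r j)]
      exact norm_sub_le_norm_sub_add_norm_sub _ _ _
    have h3 := mul_le_mul_of_nonneg_left h2 (show 0 ≤ 2 * C by positivity)
    rw [hx]; linarith
  have hne : S.Nonempty := ⟨_, Unit, inferInstance, _, fun _ => 0, IsRes.one a, rfl⟩
  have hbdd : BddAbove S := ⟨_, hub Unit _ (fun _ => 0) (IsRes.one a)⟩
  refine ⟨sSup S, fun ι _ q l hq => abs_le.2 ⟨?_, ?_⟩⟩
  · have := le_csSup hbdd (show _ ∈ S from ⟨ι, inferInstance, q, l, hq, rfl⟩)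
    linarith
  · have := csSup_le hne (hub ι q l hq)
    linarith

lemma IsMu.unique {m : (K →L[ℂ] K) → ℝ} {C r r' : ℝ} (hC : 0 ≤ C) {a : K →L[ℂ] K}
    (ha : IsSelfAdjoint a) {C' : ℝ} (hC' : 0 ≤ C') (h : IsMu m C a r) (h' : IsMu m C' a r') :
    r = r' := by
  rw [← sub_eq_zero, ← abs_eq_zero]
  refine le_antisymm (le_of_forall_pos_le_add fun ε hε => ?_) (abs_nonneg _)
  obtain ⟨ι, _, q, l, hq, hn⟩ := SRsa a ha (ε / (2 * C + 2 * C' + 1)) (by positivity)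
  have h1 := h ι q l hq
  have h2 := h' ι q l hq
  rw [le_div_iff₀ (by positivity)] at hn
  have h3 : |r - r'| ≤ |r - ∑ j, l j * m (q j)| + |r' - ∑ j, l j * m (q j)| := by
    rw [abs_sub_comm r']
    exact abs_sub_le _ _ _
  nlinarith [norm_nonneg (a - ∑ j, l j • q j)]

/-- the integral of `a` against `m` -/
def muv (m : (K →L[ℂ] K) → ℝ) (C : ℝ) (a : K →L[ℂ] K) : ℝ :=
  open Classical in if h : ∃ r, IsMu m C a r then h.choose else 0

lemma muv_spec {m : (K →L[ℂ] K) → ℝ} {C : ℝ} (hm : PM m C) (a : K →L[ℂ] K) :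
    IsMu m C a (muv m C a) := by
  have h := exists_IsMu hm a
  rw [muv, dif_pos h]; exact h.choose_spec

lemma muv_bound {m : (K →L[ℂ] K) → ℝ} {C : ℝ} (hm : PM m C) (a : K →L[ℂ] K) :
    |muv m C a| ≤ 2 * C * ‖a‖ := by
  have := muv_spec hm a Unit _ (fun _ => 0) (IsRes.one a)
  simpa using this

lemma muv_proj {m : (K →L[ℂ] K) → ℝ} {C : ℝ} (hm : PM m C) {p : K →L[ℂ] K}
    (hp : IsStarProjection p) : muv m C p = m p := by
  have hpp : p * p = p := hp.1
  have hB : IsRes p (fun t : Bool => if t then p else 1 - p) := by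
    refine ⟨?_, ?_, ?_, ?_⟩
    · intro t; cases t
      · simpa using hp.one_sub
      · simpa using hp
    · intro s t hst
      cases s <;> cases t <;> simp at hst ⊢ <;> simp [sub_mul, mul_sub, hpp]
    · simp
    · intro t y hy; cases t
      · simpa using (Commute.one_right y).sub_right hy
      · simpa using hy
  have := muv_spec hm p Bool _ (fun t => if t then 1 else 0) hB
  simp at this
  linarith

lemma muv_affine {m : (K →L[ℂ] K) → ℝ} {C : ℝ} (hm : PM m C) {a : K →L[ℂ] K}
    (ha : IsSelfAdjoint a) (s t : ℝ) :
    muv m C (s • a + t • 1) = s * muv m C a + t * m 1 := by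
  have hC := hm.C_nonneg
  have hsa : IsSelfAdjoint (s • a + t • (1 : K →L[ℂ] K)) := by
    refine IsSelfAdjoint.add ?_ ?_
    · exact (IsSelfAdjoint.all s).smul ha
    · exact (IsSelfAdjoint.all t).smul (IsSelfAdjoint.one _)
  by_cases hs : s = 0
  · subst hs
    have := muv_spec hm ((0 : ℝ) • a + t • (1 : K →L[ℂ] K)) Unit _ (fun _ => t) (IsRes.one _)
    simp at this
    simp
    linarith
  refine (muv_spec hm (s • a + t • (1 : K →L[ℂ] K))).unique hC hsa hC ?_
  intro ι _ q l hq
  have hq' : IsRes a q := hq.mono fun y hy =>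
    (hy.smul_right s).add_right ((Commute.one_right y).smul_right t)
  have h := muv_spec hm a ι q (fun j => (l j - t) / s) hq'
  have e1 : ∑ j, (l j - t) / s * m (q j) = (∑ j, l j * m (q j) - t * m 1) / s := by
    rw [← hq.sum, hm.sum q hq.proj hq.orth, Finset.mul_sum, ← Finset.sum_sub_distrib,
      Finset.sum_div]
    exact Finset.sum_congr rfl fun j _ => by ring
  have e2 : s • a + t • (1 : K →L[ℂ] K) - ∑ j, l j • q j = s • (a - ∑ j, ((l j - t) / s) • q j) := by
    rw [smul_sub, Finset.smul_sum]
    simp only [smul_smul, mul_div_cancel₀ _ hs, sub_smul, Finset.sum_sub_distrib]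
    rw [← Finset.smul_sum, hq.sum]
    abel
  rw [e1] at h
  rw [e2, norm_smul, Real.norm_eq_abs]
  have e3 : s * muv m C a + t * m 1 - ∑ j, l j * m (q j)
      = s * (muv m C a - (∑ j, l j * m (q j) - t * m 1) / s) := by
    field_simp; ring
  rw [e3, abs_mul]
  nlinarith [mul_le_mul_of_nonneg_left h (abs_nonneg s)]

end Musec

end partJ

section partK

section GKsec
variable {H K : Type*} [NormedAddCommGroup H] [InnerProductSpace ℂ H] [CompleteSpace H]
  [NormedAddCommGroup K] [InnerProductSpace ℂ K] [CompleteSpace K]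

lemma comm_sqrt {w x : K →L[ℂ] K} (hx : 0 ≤ x) (h : Commute w (x * x)) : Commute w x := by
  have e : CFC.sqrt (x * x) = x := CFC.sqrt_unique rfl hx
  have h0 : 0 ≤ x * x := Commute.mul_nonneg hx hx (Commute.refl x)
  rw [← e, CFC.sqrt_eq_real_sqrt _ h0]
  exact (Commute.cfcₙ_real h.symm _).symm

lemma sqrt_diff_norm {x x' : K →L[ℂ] K} (hx : 0 ≤ x) (hx' : 0 ≤ x') (h : Commute x x') :
    ‖x - x'‖ ^ 2 ≤ ‖x * x - x' * x'‖ := by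
  set D := x - x' with hD
  set S := x + x' with hS
  have hDsa : IsSelfAdjoint D := (IsSelfAdjoint.of_nonneg hx).sub (IsSelfAdjoint.of_nonneg hx')
  have hxx' : x * x' = x' * x := h.eq
  have e1 : x * x - x' * x' = D * S := by
    rw [hD, hS]; simp only [sub_mul, mul_add, hxx']; abel
  have hDS : D * S = S * D := by
    rw [hD, hS]; simp only [sub_mul, mul_sub, mul_add, add_mul, hxx']; abel
  have hSsa : IsSelfAdjoint S := (IsSelfAdjoint.of_nonneg hx).add (IsSelfAdjoint.of_nonneg hx')
  have hD2 : 0 ≤ D * D := by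
    have := star_mul_self_nonneg D; rwa [hDsa.star_eq] at this
  have hxx : 0 ≤ x * x' := Commute.mul_nonneg hx hx' h
  have e2 : S * S - D * D = (4 : ℝ) • (x * x') := by
    rw [hD, hS]
    have : (4 : ℝ) • (x * x') = x * x' + x * x' + x * x' + x * x' := by
      rw [show (4 : ℝ) = 1 + 1 + 1 + 1 by norm_num]; simp only [add_smul, one_smul]
    rw [this]
    simp only [sub_mul, mul_sub, mul_add, add_mul, hxx']; abel
  have hc : Commute (D * D) (S * S - D * D) := by
    apply Commute.sub_right
    · have : Commute D S := hDS
      exact (this.mul_right this).mul_left (this.mul_right this)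
    · exact Commute.refl _
  have h1 : D * D * (D * D) ≤ D * D * (S * S) := by
    rw [← sub_nonneg, ← mul_sub]
    refine Commute.mul_nonneg hD2 ?_ hc
    rw [e2]; exact smul_nonneg (by norm_num) hxx
  have hD4 : 0 ≤ D * D * (D * D) := Commute.mul_nonneg hD2 hD2 (Commute.refl _)
  have h2 := CStarAlgebra.norm_le_norm_of_nonneg_of_le hD4 h1
  have n1 : ‖D * D‖ = ‖D‖ * ‖D‖ := by
    have := CStarRing.norm_star_mul_self (x := D); rwa [hDsa.star_eq] at this
  have hDDsa : IsSelfAdjoint (D * D) := IsSelfAdjoint.of_nonneg hD2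
  have n2 : ‖D * D * (D * D)‖ = ‖D * D‖ * ‖D * D‖ := by
    have := CStarRing.norm_star_mul_self (x := D * D); rwa [hDDsa.star_eq] at this
  have n3 : D * D * (S * S) = star (D * S) * (D * S) := by
    rw [star_mul, hDsa.star_eq, hSsa.star_eq]
    have : Commute D S := hDS
    rw [mul_assoc D D, ← mul_assoc D S, hDS, ← mul_assoc, ← mul_assoc, ← mul_assoc, hDS,
      mul_assoc (S * D), hDS, ← mul_assoc]
  rw [n2, n1, n3, CStarRing.norm_star_mul_self] at h2
  rw [e1, sq]
  nlinarith [norm_nonneg (D * S), norm_nonneg D, mul_self_nonneg (‖D‖)]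

def mz (m : (H →L[ℂ] H) → ℝ) (v : K →L[ℂ] H) (p : K →L[ℂ] K) : ℝ := m (v ∘L p ∘L adjoint v)

lemma pr_proj_right (v : K →L[ℂ] H) {q : K →L[ℂ] K} (hq : IsStarProjection q) :
    pr (v ∘L q) = v ∘L q ∘L adjoint v := by
  have h1 : q * q = q := hq.1
  have h2 : star q = q := hq.2
  unfold pr
  rw [adjoint_comp, ← star_eq_adjoint q, h2]
  ext x
  have := DFunLike.congr_fun h1 (adjoint v x)
  simp only [mulA] at this
  simp only [comp_apply, this]

lemma mz_PM {m : (H →L[ℂ] H) → ℝ} {C : ℝ} (hm : PM m C) {v : K →L[ℂ] H}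
    (hv : adjoint v ∘L v = ContinuousLinearMap.id ℂ K) : PM (mz m v) C := by
  have hv' := fun y => DFunLike.congr_fun hv y
  simp only [comp_apply, id_apply] at hv'
  have hp : ∀ p : K →L[ℂ] K, IsStarProjection p → IsStarProjection (v ∘L p ∘L adjoint v) := by
    intro p hp
    have h1 : p * p = p := hp.1
    have h1' := fun y => DFunLike.congr_fun h1 y
    simp only [mulA] at h1'
    rw [← pr_proj_right v hp]
    refine pr_proj p ?_ ?_
    · rw [adjoint_comp, ← star_eq_adjoint p, show star p = p from hp.2]
      ext x; simp [hv', h1']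
    · ext x; simp [h1']
  refine ⟨fun p h => hm.bdd _ (hp p h), fun p q h1 h2 h12 => ?_⟩
  unfold mz
  rw [← hm.add _ _ (hp p h1) (hp q h2)]
  · congr 1; ext x; simp
  · have h := fun y => DFunLike.congr_fun h12 y
    simp only [mulA, zero_apply] at h
    ext x; simp [mulA, hv', h]

lemma mat_sum {n : ℕ} {ι : Type*} (s : Finset ι) (z : Fin n → K →L[ℂ] H)
    (M : ι → Fin n → Fin n → K →L[ℂ] K) :
    mat z (fun i k => ∑ j ∈ s, M j i k) = ∑ j ∈ s, mat z (M j) := by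
  classical
  induction s using Finset.induction_on with
  | empty => ext x; simp [mat]
  | insert a s ha ih =>
    rw [Finset.sum_insert ha, ← ih, mat_add]
    simp [Finset.sum_insert ha]

lemma simple_sum {m : (H →L[ℂ] H) → ℝ} {C : ℝ} (hm : PM m C) {n : ℕ} {z : Fin n → K →L[ℂ] H}
    (hz : Ort z) {ι : Type*} [Fintype ι] (q : ι → K →L[ℂ] K) (hq : ∀ j, IsStarProjection (q j))
    (horth : ∀ i j, i ≠ j → q i * q j = 0) (α : Fin n → ι → ℝ) (hα : ∀ j, ∑ i, α i j ^ 2 = 1) :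
    m (pr (col z (fun i => ∑ j, α i j • q j))) = ∑ j, m (pr (col z (fun i => α i j • q j))) := by
  classical
  have hs : ∀ j, star (q j) = q j := fun j => (hq j).2
  have hi : ∀ j, q j * q j = q j := fun j => (hq j).1
  have key : pr (col z (fun i => ∑ j, α i j • q j)) = ∑ j, pr (col z (fun i => α i j • q j)) := by
    simp only [pr_col]
    rw [← mat_sum]
    congr 1
    ext1 i; ext1 k
    rw [star_sum, Finset.sum_mul]
    refine Finset.sum_congr rfl fun j _ => ?_
    rw [Finset.mul_sum, Finset.sum_eq_single j]
    · intro b _ hb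
      rw [star_smul, hs, smul_mul_smul_comm, horth j b hb.symm, smul_zero]
    · simp
  rw [key, hm.sum]
  · intro j
    refine pr_proj (q j) ?_ ?_
    · rw [adj_col_comp hz]
      simp only [star_smul, hs, smul_mul_smul_comm, hi, ← Finset.sum_smul, star_trivial]
      have := hα j
      simp only [sq] at this
      rw [this, one_smul]
    · ext x
      have h1' := fun y => DFunLike.congr_fun (hi j) y
      simp only [mulA] at h1'
      simp [col, h1']
  · intro j k hjk
    apply pr_orth
    rw [adj_col_comp hz]
    refine Finset.sum_eq_zero fun i _ => ?_
    rw [star_smul, hs, smul_mul_smul_comm, horth j k hjk, smul_zero]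

lemma sum_sq_res {ι : Type*} [Fintype ι] {a : K →L[ℂ] K} {q : ι → K →L[ℂ] K} (h : IsRes a q)
    (l k : ι → ℝ) : (∑ j, l j • q j) * (∑ j, k j • q j) = ∑ j, (l j * k j) • q j := by
  classical
  rw [Finset.sum_mul]
  refine Finset.sum_congr rfl fun j _ => ?_
  rw [Finset.mul_sum, Finset.sum_eq_single j]
  · rw [smul_mul_smul_comm, show q j * q j = q j from (h.proj j).1]
  · intro b _ hb
    rw [smul_mul_smul_comm, h.orth j b hb.symm, smul_zero]
  · simp

lemma nonneg_res {ι : Type*} [Fintype ι] {a : K →L[ℂ] K} {q : ι → K →L[ℂ] K} (h : IsRes a q)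
    (l : ι → ℝ) (hl : ∀ j, 0 ≤ l j) : 0 ≤ ∑ j, l j • q j :=
  Finset.sum_nonneg fun j _ => smul_nonneg (hl j) (h.proj j).nonneg

lemma norm_le_one_of_sq {x y : K →L[ℂ] K} (hx : IsSelfAdjoint x) (hy : IsSelfAdjoint y)
    (h : x * x + y * y = 1) : ‖x‖ ≤ 1 := by
  have h1 : 0 ≤ x * x := by have := star_mul_self_nonneg x; rwa [hx.star_eq] at this
  have h2 : 0 ≤ y * y := by have := star_mul_self_nonneg y; rwa [hy.star_eq] at this
  have h3 : x * x ≤ 1 := by rw [← h]; exact le_add_of_nonneg_right h2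
  have h4 : ‖x * x‖ ≤ 1 := (CStarAlgebra.norm_le_one_iff_of_nonneg _ h1).2 h3
  have := CStarRing.norm_star_mul_self (x := x)
  rw [hx.star_eq] at this
  rw [this] at h4
  nlinarith [norm_nonneg x]

end GKsec

theorem pm_Cop2 (C η : ℝ) (hη : 0 < η) : ∃ ε > 0, ∀ (H K : Type u) [NormedAddCommGroup H]
    [InnerProductSpace ℂ H] [CompleteSpace H] [NormedAddCommGroup K] [InnerProductSpace ℂ K]
    [CompleteSpace K] (m : (H →L[ℂ] H) → ℝ), PM m C → ∀ (z : Fin 3 → K →L[ℂ] H), Ort z →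
    ∀ x y x' y' : K →L[ℂ] K, IsSelfAdjoint x → IsSelfAdjoint y → IsSelfAdjoint x' →
    IsSelfAdjoint y' → Commute x y → Commute x x' → Commute x y' → Commute y x' → Commute y y' →
    Commute x' y' → x * x + y * y = 1 → x' * x' + y' * y' = 1 → 0 ≤ x * x' + y * y' →
    ‖x * y' - y * x'‖ ≤ ε →
    |m (pr (col z ![x, y, 0])) - m (pr (col z ![x', y', 0]))| ≤ η := by
  obtain ⟨ε, hε, h⟩ := pm_Cop.{u} C η hη
  refine ⟨ε, hε, ?_⟩
  intro H K _ _ _ _ _ _ m hm z hz x y x' y' hx hy hx' hy' xy xx' xy' yx' yy' hxy2 h1 h2 h3 h4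
  have hx := hx.star_eq
  have hy := hy.star_eq
  have hx' := hx'.star_eq
  have hy' := hy'.star_eq
  set V := ![col z ![x, y, 0], col z ![-y, x, 0], col z ![0, 0, 1]] with hV
  have hVO : Ort V := by
    intro i j
    have h1' : y * y + x * x = 1 := by rw [add_comm]; exact h1
    fin_cases i <;> fin_cases j <;>
      simp [hV, adj_col_comp hz, Fin.sum_univ_three, hx, hy, h1, h1', xy.eq] <;> rfl
  have := h H K m hm V hVO (x * x' + y * y') (x * y' - y * x') ?_ h3 ?_ h4
  · have e : col V ![x * x' + y * y', x * y' - y * x', 0] = col z ![x', y', 0] := by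
      have e1 : x * (x * x' + y * y') + -y * (x * y' - y * x') = x' := by
        have : x * (x * x' + y * y') + -y * (x * y' - y * x') = (x * x + y * y) * x' +
          (x * y - y * x) * y' := by noncomm_ring
        rw [this, h1, xy.eq]; simp
      have e2 : y * (x * x' + y * y') + x * (x * y' - y * x') = y' := by
        have : y * (x * x' + y * y') + x * (x * y' - y * x') = (x * x + y * y) * y' +
          (y * x - x * y) * x' := by noncomm_ring
        rw [this, h1, xy.eq]; simp
      ext w
      have e1' := DFunLike.congr_fun e1 w
      have e2' := DFunLike.congr_fun e2 w
      simp only [mulA, add_apply, sub_apply, neg_apply, map_add, map_sub, map_neg] at e1' e2'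
      simp only [col, hV, Fin.sum_univ_three, Matrix.cons_val_zero, Matrix.cons_val_one,
        Matrix.cons_val_two, Matrix.head_cons, Matrix.tail_cons, add_apply, comp_apply, zero_apply,
        map_zero, add_zero, mulA, sub_apply, neg_apply, map_add, map_sub, map_neg, Matrix.cons_val]
      have f1 := congrArg (z 0) e1'
      have f2 := congrArg (z 1) e2'
      rw [← f1, ← f2]
      simp only [map_add, map_sub, map_neg]
      abel
    rwa [e] at this
  · rw [isSelfAdjoint_iff]
    simp [hx, hy, hx', hy', xy'.eq, yx'.eq]
  · have c1 : x * y = y * x := xy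
    have k1 : (x * x' + y * y') * (x * x' + y * y') = x * x * (x' * x') + y * y * (y' * y')
        + (x * y * (x' * y')  + x * y * (x' * y') ) := by
      have a1 : x * x' * (x * x') = x * x * (x' * x') := by
        rw [mul_assoc, ← mul_assoc x', ← xx'.eq]; noncomm_ring
      have a2 : y * y' * (y * y') = y * y * (y' * y') := by
        rw [mul_assoc, ← mul_assoc y', ← yy'.eq]; noncomm_ring
      have a3 : x * x' * (y * y') = x * y * (x' * y') := by
        rw [mul_assoc, ← mul_assoc x', ← yx'.eq]; noncomm_ring
      have a4 : y * y' * (x * x') = x * y * (x' * y') := by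
        rw [mul_assoc, ← mul_assoc y', ← xy'.eq, mul_assoc, ← mul_assoc y, ← c1, hxy2.eq]
      rw [mul_add, add_mul, add_mul, a1, a2, a3, a4]; abel
    have k2 : (x * y' - y * x') * (x * y' - y * x') = x * x * (y' * y') + y * y * (x' * x')
        - (x * y * (x' * y')  + x * y * (x' * y') ) := by
      have a1 : x * y' * (x * y') = x * x * (y' * y') := by
        rw [mul_assoc, ← mul_assoc y', ← xy'.eq]; noncomm_ring
      have a2 : y * x' * (y * x') = y * y * (x' * x') := by
        rw [mul_assoc, ← mul_assoc x', ← yx'.eq]; noncomm_ring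
      have a3 : x * y' * (y * x') = x * y * (x' * y') := by
        rw [mul_assoc, ← mul_assoc y', ← yy'.eq, mul_assoc, ← hxy2.eq, ← mul_assoc]
      have a4 : y * x' * (x * y') = x * y * (x' * y') := by
        rw [mul_assoc, ← mul_assoc x', ← xx'.eq, mul_assoc, ← mul_assoc y, ← c1]
      rw [mul_sub, sub_mul, sub_mul, a1, a2, a3, a4]; abel
    rw [k1, k2]
    have : x * x * (x' * x') + y * y * (y' * y') + (x * y * (x' * y') + x * y * (x' * y')) +
      (x * x * (y' * y') + y * y * (x' * x') - (x * y * (x' * y') + x * y * (x' * y')))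
      = (x * x + y * y) * (x' * x' + y' * y') := by noncomm_ring
    rw [this, h1, h2, one_mul]

end partK

section partL

section GLsec
variable {H K : Type u} [NormedAddCommGroup H] [InnerProductSpace ℂ H] [CompleteSpace H]
  [NormedAddCommGroup K] [InnerProductSpace ℂ K] [CompleteSpace K]

theorem Aprime {m : (H →L[ℂ] H) → ℝ} {C : ℝ} (hm : PM m C) {z : Fin 3 → K →L[ℂ] H} (hz : Ort z)
    {a x y : K →L[ℂ] K} (hx : 0 ≤ x) (hy : 0 ≤ y) (hxa : x * x = a) (hya : y * y = 1 - a) :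
    m (pr (col z ![x, y, 0])) + m (pr (col z ![x, -y, 0]))
      = 2 * muv (mz m (z 0)) C a + 2 * muv (mz m (z 1)) C (1 - a) := by
  have hC := hm.C_nonneg
  have hz0 : PM (mz m (z 0)) C := mz_PM hm (by simpa using hz 0 0)
  have hz1 : PM (mz m (z 1)) C := mz_PM hm (by simpa using hz 1 1)
  have ha0 : 0 ≤ a := by rw [← hxa]; exact Commute.mul_nonneg hx hx (Commute.refl _)
  have ha1 : 0 ≤ 1 - a := by rw [← hya]; exact Commute.mul_nonneg hy hy (Commute.refl _)
  have hcx : ∀ w, Commute w a → Commute w x := fun w hw => comm_sqrt hx (by rwa [hxa])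
  have hcy : ∀ w, Commute w a → Commute w y := fun w hw => comm_sqrt hy (by
    rw [hya]; exact (Commute.one_right w).sub_right hw)
  have hxy : Commute x y := hcy x (by rw [← hxa]; exact (Commute.refl x).mul_right (Commute.refl x))
  have hsum : x * x + y * y = 1 := by rw [hxa, hya]; abel
  rw [← sub_eq_zero, ← abs_eq_zero]
  refine le_antisymm (le_of_forall_pos_le_add fun η hη => ?_) (abs_nonneg _)
  obtain ⟨ε, hε, hcop⟩ := pm_Cop2.{u} C (η / 4) (by positivity)
  obtain ⟨n, hn⟩ := exists_pow_lt_of_lt_one (show 0 < min ((ε / 2) ^ 2) (η / (16 * (C + 1))) by positivity)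
    (show (1 / 2 : ℝ) < 1 by norm_num)
  obtain ⟨ι, _, q, l, hq, hl, hnorm⟩ := SR01 n a ha0 (sub_nonneg.1 ha1)
  have hd1 : ‖a - ∑ j, l j • q j‖ ≤ (ε / 2) ^ 2 := hnorm.trans (hn.le.trans (min_le_left _ _))
  have hd2 : ‖a - ∑ j, l j • q j‖ ≤ η / (16 * (C + 1)) :=
    hnorm.trans (hn.le.trans (min_le_right _ _))
  set s : ι → ℝ := fun j => Real.sqrt (l j) with hs
  set t : ι → ℝ := fun j => Real.sqrt (1 - l j) with ht
  have hs0 : ∀ j, 0 ≤ s j := fun j => Real.sqrt_nonneg _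
  have ht0 : ∀ j, 0 ≤ t j := fun j => Real.sqrt_nonneg _
  have hss : ∀ j, s j * s j = l j := fun j => Real.mul_self_sqrt (hl j).1
  have htt : ∀ j, t j * t j = 1 - l j := fun j => Real.mul_self_sqrt (by linarith [(hl j).2])
  set x' := ∑ j, s j • q j with hx'
  set y' := ∑ j, t j • q j with hy'
  have hx'0 : 0 ≤ x' := nonneg_res hq s hs0
  have hy'0 : 0 ≤ y' := nonneg_res hq t ht0
  have hxx' : x' * x' = ∑ j, l j • q j := by rw [hx', sum_sq_res hq]; simp only [hss]
  have h1l : ∑ j, (1 - l j) • q j = 1 - ∑ j, l j • q j := by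
    simp only [sub_smul, one_smul, Finset.sum_sub_distrib, hq.sum]
  have hyy' : y' * y' = 1 - ∑ j, l j • q j := by
    rw [hy', sum_sq_res hq]; simp only [htt, h1l]
  have hcomm' : ∀ (w : K →L[ℂ] K), Commute w a → ∀ k : ι → ℝ, Commute w (∑ j, k j • q j) := by
    intro w hw k
    exact Commute.sum_right _ _ _ fun j _ => (hq.comm j w hw).smul_right _
  have hxa' : Commute x a := by rw [← hxa]; exact (Commute.refl x).mul_right (Commute.refl x)
  have hya' : Commute y a := (hcy a (Commute.refl a)).symm
  have c1 : Commute x x' := hcomm' x hxa' s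
  have c2 : Commute x y' := hcomm' x hxa' t
  have c3 : Commute y x' := hcomm' y hya' s
  have c4 : Commute y y' := hcomm' y hya' t
  have c5 : Commute x' y' := hcomm' x' (hcomm' a (Commute.refl a) s).symm t
  have hsum' : x' * x' + y' * y' = 1 := by rw [hxx', hyy']; abel
  have sx := IsSelfAdjoint.of_nonneg hx
  have sy := IsSelfAdjoint.of_nonneg hy
  have sx' := IsSelfAdjoint.of_nonneg hx'0
  have sy' := IsSelfAdjoint.of_nonneg hy'0
  have hpos : 0 ≤ x * x' + y * y' := add_nonneg (Commute.mul_nonneg hx hx'0 c1)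
    (Commute.mul_nonneg hy hy'0 c4)
  have nx : ‖x - x'‖ ≤ ε / 2 := by
    have := sqrt_diff_norm hx hx'0 c1
    rw [hxa, hxx'] at this
    exact le_of_sq_le_sq (this.trans hd1) (by positivity)
  have ny : ‖y - y'‖ ≤ ε / 2 := by
    have := sqrt_diff_norm hy hy'0 c4
    rw [hya, hyy', show (1 : K →L[ℂ] K) - a - (1 - ∑ j, l j • q j) = -(a - ∑ j, l j • q j) by abel,
      norm_neg] at this
    exact le_of_sq_le_sq (this.trans hd1) (by positivity)
  have nx1 : ‖x'‖ ≤ 1 := norm_le_one_of_sq sx' sy' hsum'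
  have ny1 : ‖y'‖ ≤ 1 := norm_le_one_of_sq sy' sx' (by rw [add_comm]; exact hsum')
  have ncr : ‖x * y' - y * x'‖ ≤ ε := by
    have e : x * y' - y * x' = (x - x') * y' - (y - y') * x' := by
      rw [sub_mul, sub_mul, c5.eq]; abel
    rw [e]
    calc _ ≤ ‖(x - x') * y'‖ + ‖(y - y') * x'‖ := norm_sub_le _ _
      _ ≤ ‖x - x'‖ * ‖y'‖ + ‖y - y'‖ * ‖x'‖ := add_le_add (norm_mul_le _ _) (norm_mul_le _ _)
      _ ≤ ε / 2 * 1 + ε / 2 * 1 := by gcongr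
      _ = ε := by ring
  have A1 := hcop H K m hm z hz x y x' y' sx sy sx' sy' hxy c1 c2 c3 c4 c5 hsum hsum' hpos ncr
  have A2 := hcop H K m hm z hz x (-y) x' (-y') sx sy.neg sx' sy'.neg hxy.neg_right c1 c2.neg_right
    c3.neg_left c4.neg_left.neg_right c5.neg_right (by simpa using hsum) (by simpa using hsum')
    (by simpa using hpos) (by
      rw [show x * -y' - -y * x' = -(x * y' - y * x') by noncomm_ring, norm_neg]; exact ncr)
  have B1 : m (pr (col z ![x', y', 0])) = ∑ j, m (pr (col z ![s j • q j, t j • q j, 0])) := by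
    have := simple_sum hm hz q hq.proj hq.orth ![s, t, 0] (by
      intro j; simp [Fin.sum_univ_three, sq, hss, htt])
    convert this using 4
    · ext1 i; fin_cases i <;> simp [hx', hy']
    · simp [col, Fin.sum_univ_three]
  have B2 : m (pr (col z ![x', -y', 0])) = ∑ j, m (pr (col z ![s j • q j, -(t j • q j), 0])) := by
    have := simple_sum hm hz q hq.proj hq.orth ![s, -t, 0] (by
      intro j; simp [Fin.sum_univ_three, sq, hss, htt])
    convert this using 4
    · ext1 i; fin_cases i <;> simp [hx', hy']
    · simp [col, Fin.sum_univ_three]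
  have B3 : m (pr (col z ![x', y', 0])) + m (pr (col z ![x', -y', 0]))
      = 2 * ∑ j, l j * mz m (z 0) (q j) + 2 * ∑ j, (1 - l j) * mz m (z 1) (q j) := by
    rw [B1, B2, ← Finset.sum_add_distrib, Finset.mul_sum, Finset.mul_sum, ← Finset.sum_add_distrib]
    refine Finset.sum_congr rfl fun j _ => ?_
    have := pm_RG hm hz (hq.proj j) (c := s j) (s := t j) (by rw [sq, sq, hss, htt]; ring)
    rw [this, sq, sq, hss, htt, pr_proj_right _ (hq.proj j), pr_proj_right _ (hq.proj j)]
    rfl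
  have D1 := muv_spec hz0 a ι q l hq
  have hq1 : IsRes (1 - a) q := hq.mono (fun w hw => by
    have := (Commute.one_right w).sub_right hw; simpa using this)
  have D2 := muv_spec hz1 (1 - a) ι q (fun j => 1 - l j) hq1
  rw [h1l, show (1 : K →L[ℂ] K) - a - (1 - ∑ j, l j • q j) = -(a - ∑ j, l j • q j) by abel,
      norm_neg] at D2
  have hb : 2 * C * ‖a - ∑ j, l j • q j‖ ≤ η / 8 := by
    calc _ ≤ 2 * C * (η / (16 * (C + 1))) := by gcongr
      _ ≤ η / 8 := by
        rw [mul_div_assoc', div_le_div_iff₀ (by positivity) (by norm_num)]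
        nlinarith
  have D1 := D1.trans hb
  have D2 := D2.trans hb
  rw [abs_le] at *
  constructor <;> linarith [A1.1, A1.2, A2.1, A2.2, D1.1, D1.2, D2.1, D2.2]

end GLsec

end partL

section partM

section GMsec
variable {H K : Type u} [NormedAddCommGroup H] [InnerProductSpace ℂ H] [CompleteSpace H]
  [NormedAddCommGroup K] [InnerProductSpace ℂ K] [CompleteSpace K]

lemma adj_zero_symm {v w : K →L[ℂ] H} (h : adjoint v ∘L w = 0) : adjoint w ∘L v = 0 := by
  have := congrArg adjoint h
  rw [adjoint_comp, adjoint_adjoint] at this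
  simpa using this

lemma ident {m : (H →L[ℂ] H) → ℝ} {C : ℝ} (hm : PM m C) {v w1 w2 w3 : K →L[ℂ] H}
    {α α' β β' κ κ' κi : K →L[ℂ] K}
    (sα : adjoint α = α) (sα' : adjoint α' = α') (sβ : adjoint β = β) (sβ' : adjoint β' = β')
    (sκ : adjoint κ = κ) (sκ' : adjoint κ' = κ')
    (hα : α * α + α' * α' = 1) (hβ : β * β + β' * β' = 1)
    (hκ' : κ * κ + κ' * κ' = 1) (hκ : κ * κ = α * α + β * β) (hκi : κ * κi = 1)
    (hv : adjoint v ∘L v = ContinuousLinearMap.id ℂ K)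
    (h1 : adjoint w1 ∘L w1 = ContinuousLinearMap.id ℂ K)
    (h2 : adjoint w2 ∘L w2 = ContinuousLinearMap.id ℂ K)
    (h3 : adjoint w3 ∘L w3 = ContinuousLinearMap.id ℂ K)
    (v1 : adjoint v ∘L w1 = 0) (v2 : adjoint v ∘L w2 = 0) (v3 : adjoint v ∘L w3 = 0)
    (h12 : α' ∘L (adjoint w1 ∘L w2) ∘L β' = - (α * β))
    (h123 : w3 ∘L (κ' * κ) = w1 ∘L (α' * α) + w2 ∘L (β' * β)) :
    m (pr (v ∘L α + w1 ∘L α')) + m (pr (v ∘L β + w2 ∘L β')) = m (pr (v ∘L κ + w3 ∘L κ')) +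
      m (pr (w1 ∘L α') + pr (w2 ∘L β') - pr (w3 ∘L κ')) := by
  have v1' := adj_zero_symm v1
  have v2' := adj_zero_symm v2
  have v3' := adj_zero_symm v3
  have pv := fun y => DFunLike.congr_fun hv y
  have p1 := fun y => DFunLike.congr_fun h1 y
  have p2 := fun y => DFunLike.congr_fun h2 y
  have p3 := fun y => DFunLike.congr_fun h3 y
  have q1 := fun y => DFunLike.congr_fun v1 y
  have q2 := fun y => DFunLike.congr_fun v2 y
  have q3 := fun y => DFunLike.congr_fun v3 y
  have q1' := fun y => DFunLike.congr_fun v1' y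
  have q2' := fun y => DFunLike.congr_fun v2' y
  have q3' := fun y => DFunLike.congr_fun v3' y
  have r12 := fun y => DFunLike.congr_fun h12 y
  have r123 := fun y => DFunLike.congr_fun h123 y
  have r123' := fun y => DFunLike.congr_fun (congrArg adjoint h123) y
  have eα := fun y => DFunLike.congr_fun hα y
  have eβ := fun y => DFunLike.congr_fun hβ y
  have eκ := fun y => DFunLike.congr_fun hκ y
  have eκ' := fun y => DFunLike.congr_fun hκ' y
  have eκi := fun y => DFunLike.congr_fun hκi y
  have sm : ∀ f g : K →L[ℂ] K, adjoint (f * g) = adjoint g * adjoint f := fun f g => adjoint_comp f g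
  have o1 : ∀ y : K, (1 : K →L[ℂ] K) y = y := fun y => rfl
  simp only [comp_apply, id_apply, zero_apply, mulA, add_apply, o1, neg_apply, map_add,
    adjoint_comp, sm, sκ, sκ', sα, sα', sβ, sβ'] at pv p1 p2 p3 q1 q2 q3 q1' q2' q3' r12 r123 r123' eα eβ eκ eκ' eκi
  set X := v ∘L α + w1 ∘L α' with hX
  set Y := v ∘L β + w2 ∘L β' with hY
  set Z := v ∘L κ + w3 ∘L κ' with hZ
  have aX : adjoint X = α ∘L adjoint v + α' ∘L adjoint w1 := by
    rw [hX, map_add, adjoint_comp, adjoint_comp, sα, sα']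
  have aY : adjoint Y = β ∘L adjoint v + β' ∘L adjoint w2 := by
    rw [hY, map_add, adjoint_comp, adjoint_comp, sβ, sβ']
  have aZ : adjoint Z = κ ∘L adjoint v + κ' ∘L adjoint w3 := by
    rw [hZ, map_add, adjoint_comp, adjoint_comp, sκ, sκ']
  have XX : adjoint X ∘L X = 1 := by
    rw [aX, hX]; ext y; simp [pv, p1, q1, q1', eα]
  have YY : adjoint Y ∘L Y = 1 := by
    rw [aY, hY]; ext y; simp [pv, p2, q2, q2', eβ]
  have ZZ : adjoint Z ∘L Z = 1 := by
    rw [aZ, hZ]; ext y; simp [pv, p3, q3, q3', eκ']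
  have XY : adjoint X ∘L Y = 0 := by
    rw [aX, hY]; ext y; simp [pv, q2, q1', r12]
  have YX := adj_zero_symm XY
  have hZX : Z = X ∘L (α * κi) + Y ∘L (β * κi) := by
    ext y
    have a1 := r123 (κi y)
    have a2 := eκ (κi y)
    simp only [eκi] at a1 a2
    simp only [hZ, hX, hY, add_apply, comp_apply, mulA, a1, a2, map_add]
    abel
  have XZ : adjoint X ∘L Z = α * κi := by
    rw [hZX, comp_add, ← comp_assoc, ← comp_assoc, XX, XY]; ext y; simp [mulA]
  have YZ : adjoint Y ∘L Z = β * κi := by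
    rw [hZX, comp_add, ← comp_assoc, ← comp_assoc, YX, YY]; ext y; simp [mulA]
  have jX := pr_proj_iso XX
  have jY := pr_proj_iso YY
  have jZ := pr_proj_iso ZZ
  have oXY := pr_orth XY
  have jP := jX.add jY oXY
  have hPZ : (pr X + pr Y) * pr Z = pr Z := by
    ext y
    have b1 := DFunLike.congr_fun XZ (adjoint Z y)
    have b2 := DFunLike.congr_fun YZ (adjoint Z y)
    have b3 := DFunLike.congr_fun hZX (adjoint Z y)
    simp only [comp_apply, add_apply, mulA] at b1 b2 b3
    simp only [pr, mulA, add_apply, comp_apply, b1, b2, ← b3]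
  have hZP : pr Z * (pr X + pr Y) = pr Z := by
    have := congrArg star hPZ
    rwa [star_mul, jP.2.star_eq, jZ.2.star_eq] at this
  have jR : IsStarProjection (pr X + pr Y - pr Z) := by
    refine ⟨?_, jP.2.sub jZ.2⟩
    unfold IsIdempotentElem
    rw [mul_sub, sub_mul, sub_mul, hPZ, hZP, show pr Z * pr Z = pr Z from jZ.1,
      show (pr X + pr Y) * (pr X + pr Y) = pr X + pr Y from jP.1]; abel
  have e1 := hm.add _ _ jX jY oXY
  have e2 := hm.add _ _ jZ jR (by
    rw [mul_sub, hZP, show pr Z * pr Z = pr Z from jZ.1, sub_self])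
  rw [add_sub_cancel, e1] at e2
  rw [e2]
  congr 2
  ext y
  simp only [pr, aX, aY, aZ, adjoint_comp, sα', sβ', sκ', sα, sβ, sκ, sub_apply, add_apply, comp_apply, hX, hY, hZ,
    map_add, eκ, r123]
  have c1 := congrArg v (r123' y)
  simp only [map_add] at c1
  rw [c1]
  abel

lemma Ort3 {z0 z1 z2 : K →L[ℂ] H} (h0 : adjoint z0 ∘L z0 = ContinuousLinearMap.id ℂ K)
    (h1 : adjoint z1 ∘L z1 = ContinuousLinearMap.id ℂ K)
    (h2 : adjoint z2 ∘L z2 = ContinuousLinearMap.id ℂ K)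
    (h01 : adjoint z0 ∘L z1 = 0) (h02 : adjoint z0 ∘L z2 = 0) (h12 : adjoint z1 ∘L z2 = 0) :
    Ort ![z0, z1, z2] := by
  have h10 := adj_zero_symm h01
  have h20 := adj_zero_symm h02
  have h21 := adj_zero_symm h12
  intro i j
  fin_cases i <;> fin_cases j <;> simp [h0, h1, h2, h01, h02, h12, h10, h20, h21]

lemma Aprime' {m : (H →L[ℂ] H) → ℝ} {C : ℝ} (hm : PM m C) {v w u : K →L[ℂ] H}
    (h0 : adjoint v ∘L v = ContinuousLinearMap.id ℂ K)
    (h1 : adjoint w ∘L w = ContinuousLinearMap.id ℂ K)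
    (h2 : adjoint u ∘L u = ContinuousLinearMap.id ℂ K)
    (h01 : adjoint v ∘L w = 0) (h02 : adjoint v ∘L u = 0) (h12 : adjoint w ∘L u = 0)
    {x y : K →L[ℂ] K} (hx : 0 ≤ x) (hy : 0 ≤ y) (hxy : x * x + y * y = 1) :
    m (pr (v ∘L x + w ∘L y)) + m (pr ((-v) ∘L x + w ∘L y))
      = 2 * muv (mz m v) C (x * x) + 2 * muv (mz m w) C (y * y) := by
  have := Aprime hm (Ort3 h0 h1 h2 h01 h02 h12) hx hy rfl (by rw [← hxy]; abel)
  simp only [Matrix.cons_val_zero, Matrix.cons_val_one] at this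
  rw [show (1 : K →L[ℂ] K) - x * x = y * y by rw [← hxy]; abel] at this
  rw [← this]
  have e1 : v ∘L x + w ∘L y = col ![v, w, u] ![x, y, 0] := by
    simp [col, Fin.sum_univ_three]
  have e2 : (-v) ∘L x + w ∘L y = - (col ![v, w, u] ![x, -y, 0]) := by
    simp [col, Fin.sum_univ_three, add_comm]
  have e3 : ∀ X : K →L[ℂ] H, pr (-X) = pr X := fun X => by simp [pr]
  rw [e1, e2, e3]

def PhiD (m : (H →L[ℂ] H) → ℝ) (C : ℝ) (w1 w2 w3 : K →L[ℂ] H) (α' β' κ' : K →L[ℂ] K) : ℝ :=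
  muv (mz m w3) C (κ' * κ') + m (pr (w1 ∘L α') + pr (w2 ∘L β') - pr (w3 ∘L κ'))
    - muv (mz m w1) C (α' * α') - muv (mz m w2) C (β' * β')

lemma delta_eq {m : (H →L[ℂ] H) → ℝ} {C : ℝ} (hm : PM m C) {v u w1 w2 w3 : K →L[ℂ] H}
    {α α' β β' κ κ' κi : K →L[ℂ] K}
    (sα : 0 ≤ α) (sα' : 0 ≤ α') (sβ : 0 ≤ β) (sβ' : 0 ≤ β')
    (sκ : 0 ≤ κ) (sκ' : 0 ≤ κ')
    (hα : α * α + α' * α' = 1) (hβ : β * β + β' * β' = 1)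
    (hκ' : κ * κ + κ' * κ' = 1) (hκ : κ * κ = α * α + β * β) (hκi : κ * κi = 1)
    (hv : adjoint v ∘L v = ContinuousLinearMap.id ℂ K)
    (hu : adjoint u ∘L u = ContinuousLinearMap.id ℂ K)
    (h1 : adjoint w1 ∘L w1 = ContinuousLinearMap.id ℂ K)
    (h2 : adjoint w2 ∘L w2 = ContinuousLinearMap.id ℂ K)
    (h3 : adjoint w3 ∘L w3 = ContinuousLinearMap.id ℂ K)
    (v1 : adjoint v ∘L w1 = 0) (v2 : adjoint v ∘L w2 = 0) (v3 : adjoint v ∘L w3 = 0)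
    (vu : adjoint v ∘L u = 0)
    (u1 : adjoint w1 ∘L u = 0) (u2 : adjoint w2 ∘L u = 0) (u3 : adjoint w3 ∘L u = 0)
    (h12 : α' ∘L (adjoint w1 ∘L w2) ∘L β' = - (α * β))
    (h123 : w3 ∘L (κ' * κ) = w1 ∘L (α' * α) + w2 ∘L (β' * β)) :
    muv (mz m v) C (α * α) + muv (mz m v) C (β * β) - muv (mz m v) C (κ * κ)
      = PhiD m C w1 w2 w3 α' β' κ' := by
  have sa : ∀ {x : K →L[ℂ] K}, 0 ≤ x → adjoint x = x := fun hx => (IsSelfAdjoint.of_nonneg hx).star_eq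
  have i1 := ident hm (sa sα) (sa sα') (sa sβ) (sa sβ') (sa sκ) (sa sκ') hα hβ hκ' hκ hκi hv h1 h2 h3
    v1 v2 v3 h12 h123
  have i2 := ident hm (sa sα) (sa sα') (sa sβ) (sa sβ') (sa sκ) (sa sκ') hα hβ hκ' hκ hκi
    (v := -v) (by simpa using hv) h1 h2 h3
    (by simpa using v1) (by simpa using v2) (by simpa using v3) h12 h123
  have a1 := Aprime' hm hv h1 hu v1 vu u1 sα sα' hα
  have a2 := Aprime' hm hv h2 hu v2 vu u2 sβ sβ' hβ
  have a3 := Aprime' hm hv h3 hu v3 vu u3 sκ sκ' hκ'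
  unfold PhiD
  linarith

lemma invsqrt {h : K →L[ℂ] K} {δ : ℝ} (hδ : 0 < δ) (hh : δ • 1 ≤ h) : ∃ g k : K →L[ℂ] K,
    0 ≤ g ∧ g * g = h ∧ g * k = 1 ∧ k * g = 1 ∧ IsSelfAdjoint k ∧ ‖k‖ ^ 2 ≤ 1 / δ := by
  have h1 : (0 : K →L[ℂ] K) ≤ 1 := zero_le_one
  have h0 : 0 ≤ h := (smul_nonneg hδ.le h1).trans hh
  have hg := CFC.sqrt_mul_sqrt_self h h0
  set g := CFC.sqrt h with hgdef
  have hg0 : 0 ≤ g := CFC.sqrt_nonneg h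
  have hu : IsUnit h := by
    refine CStarAlgebra.isUnit_of_le (δ • (1 : K →L[ℂ] K)) hh ?_
    rw [IsStrictlyPositive.iff_of_unital]
    exact ⟨smul_nonneg hδ.le h1, (isUnit_one.smul (Units.mk0 δ hδ.ne'))⟩
  have hug : IsUnit g := (CFC.isUnit_sqrt_iff h h0).2 hu
  obtain ⟨U, hU⟩ := hug
  have k1 : g * ↑U⁻¹ = 1 := by rw [← hU]; simp
  have k2 : ↑U⁻¹ * g = 1 := by rw [← hU]; simp
  set k : K →L[ℂ] K := ↑U⁻¹ with hk
  have ks : star k = k := by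
    have e1 := congrArg star k1
    rw [star_mul, (IsSelfAdjoint.of_nonneg hg0).star_eq, star_one] at e1
    calc star k = star k * (g * k) := by rw [k1, mul_one]
      _ = k := by rw [← mul_assoc, e1, one_mul]
  refine ⟨g, k, hg0, hg, k1, k2, ks, ?_⟩
  have e2 := star_left_conjugate_le_conjugate hh k
  rw [ks, ← hg, ← mul_assoc k g, k2, one_mul, k1, mul_smul_comm, mul_one, smul_mul_assoc] at e2
  have hkk : 0 ≤ k * k := by have := star_mul_self_nonneg k; rwa [ks] at this
  have e3 := (CStarAlgebra.norm_le_one_iff_of_nonneg _ (smul_nonneg hδ.le hkk)).2 e2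
  have n1 := CStarRing.norm_star_mul_self (x := k)
  rw [ks] at n1
  rw [norm_smul, n1, Real.norm_of_nonneg hδ.le] at e3
  rw [le_div_iff₀ hδ, sq]; linarith

end GMsec

end partM

section partN

section GNsec
variable {H K : Type u} [NormedAddCommGroup H] [InnerProductSpace ℂ H] [CompleteSpace H]
  [NormedAddCommGroup K] [InnerProductSpace ℂ K] [CompleteSpace K]

lemma norm_sq_le_of_le {a α : K →L[ℂ] K} {t : ℝ} (ht : 0 ≤ t) (hα : 0 ≤ α) (h : α * α = a)
    (ha : a ≤ t • 1) : ‖α‖ ^ 2 ≤ t := by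
  have h0 : 0 ≤ a := by rw [← h]; exact Commute.mul_nonneg hα hα (Commute.refl _)
  have h1 := CStarAlgebra.norm_le_norm_of_nonneg_of_le h0 ha
  have h2 : ‖t • (1 : K →L[ℂ] K)‖ ≤ t := by
    rw [norm_smul, Real.norm_of_nonneg ht]
    exact mul_le_of_le_one_right ht norm_id_le
  have n1 := CStarRing.norm_star_mul_self (x := α)
  rw [(IsSelfAdjoint.of_nonneg hα).star_eq, h] at n1
  rw [sq, ← n1]; linarith

lemma delta_const {m : (H →L[ℂ] H) → ℝ} {C : ℝ} (hm : PM m C) {z1 z2 : K →L[ℂ] H}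
    (h1 : adjoint z1 ∘L z1 = ContinuousLinearMap.id ℂ K)
    (h2 : adjoint z2 ∘L z2 = ContinuousLinearMap.id ℂ K) (h12 : adjoint z1 ∘L z2 = 0)
    {a b : K →L[ℂ] K} (ha : (1 / 16 : ℝ) • 1 ≤ a) (ha' : a ≤ (1 / 8 : ℝ) • 1)
    (hb : (1 / 16 : ℝ) • 1 ≤ b) (hb' : b ≤ (1 / 8 : ℝ) • 1) : ∃ Φ : ℝ, ∀ v u : K →L[ℂ] H,
      adjoint v ∘L v = ContinuousLinearMap.id ℂ K → adjoint u ∘L u = ContinuousLinearMap.id ℂ K →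
      adjoint v ∘L u = 0 → adjoint v ∘L z1 = 0 → adjoint v ∘L z2 = 0 → adjoint u ∘L z1 = 0 →
      adjoint u ∘L z2 = 0 →
      muv (mz m v) C a + muv (mz m v) C b - muv (mz m v) C (a + b) = Φ := by
  have hs : ∀ s t : ℝ, s • (1 : K →L[ℂ] K) + t • 1 = (s + t) • 1 := fun s t => (add_smul _ _ _).symm
  have hc : (1 / 8 : ℝ) • (1 : K →L[ℂ] K) ≤ a + b := by
    have := add_le_add ha hb; rw [hs] at this; convert this using 2; norm_num
  have hc' : a + b ≤ (1 / 4 : ℝ) • 1 := by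
    have := add_le_add ha' hb'; rw [hs] at this; convert this using 2; norm_num
  have hsub : ∀ (x : K →L[ℂ] K) (t : ℝ), x ≤ t • 1 → (1 - t) • (1 : K →L[ℂ] K) ≤ 1 - x := by
    intro x t hx
    rw [sub_smul, one_smul]; exact sub_le_sub_left hx 1
  obtain ⟨α, αi, pα, eα, -⟩ := invsqrt (by norm_num) ha
  obtain ⟨β, βi, pβ, eβ, -⟩ := invsqrt (by norm_num) hb
  obtain ⟨κ, κi, pκ, eκ, κ1, κ2, κs, -⟩ := invsqrt (by norm_num) hc
  obtain ⟨α', α'i, pα', eα', α'1, α'2, α's, α'n⟩ := invsqrt (by norm_num) (hsub _ _ ha')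
  obtain ⟨β', β'i, pβ', eβ', β'1, β'2, β's, β'n⟩ := invsqrt (by norm_num) (hsub _ _ hb')
  obtain ⟨κ', κ'i, pκ', eκ', κ'1, κ'2, κ's, -⟩ := invsqrt (by norm_num) (hsub _ _ hc')
  have nα := norm_sq_le_of_le (by norm_num) pα eα ha'
  have nβ := norm_sq_le_of_le (by norm_num) pβ eβ hb'
  set γ := -(α'i * (α * β) * β'i) with hγ
  have nγ : ‖γ‖ ≤ 1 := by
    have : ‖γ‖ ≤ (‖α'i‖ * ‖β'i‖) * (‖α‖ * ‖β‖) := by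
      rw [hγ, norm_neg]
      calc _ ≤ ‖α'i * (α * β)‖ * ‖β'i‖ := norm_mul_le _ _
        _ ≤ ‖α'i‖ * (‖α‖ * ‖β‖) * ‖β'i‖ := by
          gcongr; exact (norm_mul_le _ _).trans (by gcongr; exact norm_mul_le _ _)
        _ = _ := by ring
    have e1 : ‖α'i‖ * ‖β'i‖ ≤ 8 / 7 := by
      norm_num at α'n β'n
      nlinarith [sq_nonneg (‖α'i‖ - ‖β'i‖)]
    have e2 : ‖α‖ * ‖β‖ ≤ 1 / 8 := by nlinarith [sq_nonneg (‖α‖ - ‖β‖)]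
    calc _ ≤ _ := this
      _ ≤ 8 / 7 * (1 / 8) := by gcongr
      _ ≤ 1 := by norm_num
  have pγ : 0 ≤ 1 - star γ * γ := by
    rw [sub_nonneg, ← CStarAlgebra.norm_le_one_iff_of_nonneg _ (star_mul_self_nonneg γ),
      CStarRing.norm_star_mul_self]
    nlinarith [norm_nonneg γ]
  have eσ := CFC.sqrt_mul_sqrt_self _ pγ
  have pσ := CFC.sqrt_nonneg (1 - star γ * γ)
  set σ := CFC.sqrt (1 - star γ * γ) with hσ
  have sa : ∀ {x : K →L[ℂ] K}, 0 ≤ x → star x = x := fun hx => (IsSelfAdjoint.of_nonneg hx).star_eq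
  have sα := sa pα
  have sβ := sa pβ
  have sκ := sa pκ
  have sα' := sa pα'
  have sβ' := sa pβ'
  have sκ' := sa pκ'
  have sσ := sa pσ
  have sκi : star κi = κi := κs
  have sκ'i : star κ'i = κ'i := κ's
  set z : Fin 2 → K →L[ℂ] H := ![z1, z2] with hz
  have h21 := adj_zero_symm h12
  have hzO : Ort z := by
    intro i j; fin_cases i <;> fin_cases j <;> simp [hz, h1, h2, h12, h21]
  have g1 : α' * γ * β' = -(α * β) := by
    rw [hγ, show α' * -(α'i * (α * β) * β'i) * β' = - ((α' * α'i) * (α * β) * (β'i * β')) by noncomm_ring,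
      α'1, β'2, one_mul, mul_one]
  have g2 : β' * star γ * α' = - (β * α) := by
    have := congrArg star g1
    simpa [sα', sβ', sα, sβ, mul_assoc] using this
  have g3 : star γ * γ + σ * σ = 1 := by rw [eσ]; abel
  set w2 := col z ![γ, σ] with hw2
  set w3 := col z ![(α' * α + γ * (β' * β)) * (κi * κ'i), σ * (β' * β) * (κi * κ'i)] with hw3
  have hz1 : z1 = col z ![1, 0] := by ext x; simp [col, hz]
  have i2 : adjoint w2 ∘L w2 = ContinuousLinearMap.id ℂ K := by
    rw [hw2, adj_col_comp hzO]
    simp [Fin.sum_univ_two, sσ, g3]; rfl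
  have i3 : adjoint w3 ∘L w3 = ContinuousLinearMap.id ℂ K := by
    rw [hw3, adj_col_comp hzO]
    simp only [Fin.sum_univ_two, Matrix.cons_val_zero, Matrix.cons_val_one, star_mul, star_add,
      sα, sα', sβ, sβ', sκi, sκ'i, sσ]
    have e1 : κ'i * κi * (α * α' + β * β' * star γ) * ((α' * α + γ * (β' * β)) * (κi * κ'i)) +
        κ'i * κi * (β * β' * σ) * (σ * (β' * β) * (κi * κ'i)) =
        κ'i * (κi * (α * (α' * α') * α + α * (α' * γ * β') * β + β * (β' * star γ * α') * α
          + β * β' * (star γ * γ + σ * σ) * (β' * β)) * κi) * κ'i := by noncomm_ring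
    have e2 : α * (α' * α') * α + α * (α' * γ * β') * β + β * (β' * star γ * α') * α
          + β * β' * (star γ * γ + σ * σ) * (β' * β) = κ * (κ' * κ') * κ := by
      rw [g1, g2, g3, eα', eκ', ← eα, show β * β' * 1 * (β' * β) = β * (β' * β') * β by noncomm_ring,
        eβ', ← eβ]
      have : κ * (1 - (α * α + β * β)) * κ = κ * κ - κ * (α * α + β * β) * κ := by noncomm_ring
      rw [this]
      have k2 : κ * κ = α * α + β * β := by rw [eκ, eα, eβ]
      have : κ * (α * α + β * β) * κ = (κ * κ) * (κ * κ) := by rw [← k2]; noncomm_ring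
      rw [this, k2]; noncomm_ring
    have e3 : κ * (κ' * κ') * κ = κ * κ' * (κ' * κ) := by noncomm_ring
    have e4 : κ'i * (κi * (κ * κ' * (κ' * κ)) * κi) * κ'i
      = κ'i * ((κi * κ) * κ' * (κ' * (κ * κi))) * κ'i := by noncomm_ring
    have hcκ : κ'i * (1 * κ' * (κ' * 1)) * κ'i = (κ'i * κ') * (κ' * κ'i) := by noncomm_ring
    have e1' : κ'i * κi * (α * α' + β * β' * star γ) * ((α' * α + γ * (β' * β)) * (κi * κ'i)) +
        κ'i * κi * (β * β' * σ) * (σ * (β' * β) * (κi * κ'i)) = 1 := by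
      rw [e1, e2, e3, e4, κ1, κ2, hcκ, κ'1, κ'2, one_mul]
    change _ = (1 : K →L[ℂ] K)
    simpa [mul_assoc] using e1'
  have i12 : α' ∘L (adjoint z1 ∘L w2) ∘L β' = - (α * β) := by
    rw [hw2]
    conv_lhs => rw [hz1, adj_col_comp hzO]
    rw [← g1]; ext x; simp [Fin.sum_univ_two, mulA]
  have i123 : w3 ∘L (κ' * κ) = z1 ∘L (α' * α) + w2 ∘L (β' * β) := by
    have e : ∀ y, κi (κ'i (κ' (κ y))) = y := by
      intro y
      have : κi * (κ'i * κ' * κ) = 1 := by rw [κ'2, one_mul, κ2]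
      exact DFunLike.congr_fun this y
    ext x
    simp [hw3, hw2, col, hz, mulA, e]; abel
  refine ⟨PhiD m C z1 w2 w3 α' β' κ', fun v u hv hu hvu v1 v2 u1 u2 => ?_⟩
  have hcol : ∀ (v : K →L[ℂ] H) (A : Fin 2 → K →L[ℂ] K), adjoint v ∘L z1 = 0 → adjoint v ∘L z2 = 0 →
      adjoint v ∘L col z A = 0 := by
    intro v A h1 h2
    have p1 := fun y => DFunLike.congr_fun h1 y
    have p2 := fun y => DFunLike.congr_fun h2 y
    simp only [comp_apply, zero_apply] at p1 p2
    ext x; simp [col, hz, p1, p2]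
  have := delta_eq hm (v := v) (u := u) pα pα' pβ pβ' pκ pκ' (by rw [eα, eα']; abel)
    (by rw [eβ, eβ']; abel) (by rw [eκ, eκ']; abel) (by rw [eκ, eα, eβ]) κ1 hv hu h1 i2 i3 v1
    (hcol v _ v1 v2) (hcol v _ v1 v2) hvu (adj_zero_symm u1) (adj_zero_symm (hcol u _ u1 u2))
    (adj_zero_symm (hcol u _ u1 u2)) i12 i123
  rw [eα, eβ, eκ] at this
  exact this

/-- infinite orthogonal family of isometries -/
def OrtN (z : ℕ → K →L[ℂ] H) : Prop :=
  ∀ i j, adjoint (z i) ∘L z j = if i = j then ContinuousLinearMap.id ℂ K else 0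

lemma OrtN.iso {z : ℕ → K →L[ℂ] H} (h : OrtN z) (i : ℕ) :
    adjoint (z i) ∘L z i = ContinuousLinearMap.id ℂ K := by simpa using h i i

lemma OrtN.orth {z : ℕ → K →L[ℂ] H} (h : OrtN z) {i j : ℕ} (hij : i ≠ j) :
    adjoint (z i) ∘L z j = 0 := by simpa [hij] using h i j

lemma Mn_PM {m : (H →L[ℂ] H) → ℝ} {C : ℝ} (hm : PM m C) {z : ℕ → K →L[ℂ] H} (hz : OrtN z) (n : ℕ) :
    PM (fun p => ∑ i ∈ Finset.range n, mz m (z i) p) C := by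
  refine ⟨fun p hp => ?_, fun p q hp hq hpq => ?_⟩
  · have h1 : p * p = p := hp.1
    have h1' := fun y => DFunLike.congr_fun h1 y
    simp only [mulA] at h1'
    have hs : adjoint p = p := hp.2
    have hj : ∀ i, IsStarProjection (pr (z i ∘L p)) := fun i => by
      have hv' := fun y => DFunLike.congr_fun (hz.iso i) y
      simp only [comp_apply, id_apply] at hv'
      refine pr_proj p ?_ ?_
      · rw [adjoint_comp, hs]
        ext x; simp [hv', h1']
      · ext x; simp [h1']
    have ho : ∀ i j, i ≠ j → pr (z i ∘L p) * pr (z j ∘L p) = 0 := fun i j hij => by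
      apply pr_orth
      rw [adjoint_comp]
      have hv' := fun y => DFunLike.congr_fun (hz.orth hij) y
      simp only [comp_apply, zero_apply] at hv'
      ext x; simp [hv']
    have e : ∑ i ∈ Finset.range n, mz m (z i) p = m (∑ i ∈ Finset.range n, pr (z i ∘L p)) := by
      rw [hm.sum _ hj ho]
      exact Finset.sum_congr rfl fun i _ => by rw [pr_proj_right _ hp]; rfl
    rw [e]
    exact hm.bdd _ (proj_sum _ hj ho _)
  · rw [← Finset.sum_add_distrib]
    exact Finset.sum_congr rfl fun i _ => (mz_PM hm (hz.iso i)).add p q hp hq hpq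

lemma Mn_muv {m : (H →L[ℂ] H) → ℝ} {C : ℝ} (hm : PM m C) {z : ℕ → K →L[ℂ] H} (hz : OrtN z) (n : ℕ)
    {a : K →L[ℂ] K} (ha : IsSelfAdjoint a) :
    |∑ i ∈ Finset.range n, muv (mz m (z i)) C a| ≤ 2 * C * ‖a‖ := by
  have hM := Mn_PM hm hz n
  have hC := hm.C_nonneg
  have h1 : IsMu (fun p => ∑ i ∈ Finset.range n, mz m (z i) p) (n * C) a
      (∑ i ∈ Finset.range n, muv (mz m (z i)) C a) := by
    intro ι _ q l hq
    simp only [Finset.mul_sum]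
    rw [Finset.sum_comm, ← Finset.sum_sub_distrib]
    refine (Finset.abs_sum_le_sum_abs _ _).trans ?_
    refine (Finset.sum_le_sum fun i _ => muv_spec (mz_PM hm (hz.iso i)) a ι q l hq).trans ?_
    simp; apply le_of_eq; ring
  rw [IsMu.unique (by positivity) ha hC h1 (muv_spec hM a)]
  exact muv_bound hM a

lemma delta_zero {m : (H →L[ℂ] H) → ℝ} {C : ℝ} (hm : PM m C) {z : ℕ → K →L[ℂ] H} (hz : OrtN z)
    {a b : K →L[ℂ] K} (ha : (1 / 16 : ℝ) • 1 ≤ a) (ha' : a ≤ (1 / 8 : ℝ) • 1)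
    (hb : (1 / 16 : ℝ) • 1 ≤ b) (hb' : b ≤ (1 / 8 : ℝ) • 1) :
    muv (mz m (z 0)) C (a + b) = muv (mz m (z 0)) C a + muv (mz m (z 0)) C b := by
  obtain ⟨Φ, hΦ⟩ := delta_const hm (hz.iso 1) (hz.iso 2) (hz.orth (by norm_num)) ha ha' hb hb'
  have h0 := hΦ (z 0) (z 3) (hz.iso 0) (hz.iso 3) (hz.orth (by norm_num)) (hz.orth (by norm_num))
    (hz.orth (by norm_num)) (hz.orth (by norm_num)) (hz.orth (by norm_num))
  have hi : ∀ i, muv (mz m (z (i + 4))) C a + muv (mz m (z (i + 4))) C b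
      - muv (mz m (z (i + 4))) C (a + b) = Φ := fun i =>
    hΦ (z (i + 4)) (z 3) (hz.iso _) (hz.iso 3) (hz.orth (by omega)) (hz.orth (by omega))
    (hz.orth (by omega)) (hz.orth (by omega)) (hz.orth (by omega))
  have h1 : (0 : K →L[ℂ] K) ≤ 1 := zero_le_one
  have sa : IsSelfAdjoint a := IsSelfAdjoint.of_nonneg ((smul_nonneg (by norm_num) h1).trans ha)
  have sb : IsSelfAdjoint b := IsSelfAdjoint.of_nonneg ((smul_nonneg (by norm_num) h1).trans hb)
  have hz4 : OrtN (fun i => z (i + 4)) := by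
    intro i j; simp [hz (i + 4) (j + 4)]
  set B := 2 * C * ‖a‖ + 2 * C * ‖b‖ + 2 * C * ‖a + b‖ with hB
  have key : ∀ n : ℕ, n * |Φ| ≤ B := by
    intro n
    have e : (n : ℝ) * Φ = ∑ i ∈ Finset.range n, muv (mz m (z (i + 4))) C a +
      ∑ i ∈ Finset.range n, muv (mz m (z (i + 4))) C b -
      ∑ i ∈ Finset.range n, muv (mz m (z (i + 4))) C (a + b) := by
      rw [← Finset.sum_add_distrib, ← Finset.sum_sub_distrib, Finset.sum_congr rfl (fun i _ => hi i)]
      simp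
    have b1 := abs_le.1 (Mn_muv hm hz4 n sa)
    have b2 := abs_le.1 (Mn_muv hm hz4 n sb)
    have b3 := abs_le.1 (Mn_muv hm hz4 n (sa.add sb))
    rw [show (n : ℝ) * |Φ| = |n * Φ| by rw [abs_mul]; simp, e, abs_le]
    constructor <;> linarith [b1.1, b1.2, b2.1, b2.2, b3.1, b3.2]
  have hΦ0 : Φ = 0 := by
    by_contra hne
    have : 0 < |Φ| := abs_pos.2 hne
    obtain ⟨n, hn⟩ := exists_nat_gt (B / |Φ|)
    rw [div_lt_iff₀ this] at hn
    linarith [key n]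
  linarith

end GNsec

end partN

section partO
open scoped ComplexStarModule
section GOsec
variable {H K : Type u} [NormedAddCommGroup H] [InnerProductSpace ℂ H] [CompleteSpace H]
  [NormedAddCommGroup K] [InnerProductSpace ℂ K] [CompleteSpace K]

lemma exists_clm (μ : (K →L[ℂ] K) → ℝ) (B : ℝ)
    (hadd : ∀ a b, IsSelfAdjoint a → IsSelfAdjoint b → μ (a + b) = μ a + μ b)
    (hsmul : ∀ (s : ℝ) a, IsSelfAdjoint a → μ (s • a) = s * μ a)
    (hB : ∀ a, IsSelfAdjoint a → |μ a| ≤ B * ‖a‖) :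
    ∃ ψ : (K →L[ℂ] K) →L[ℂ] ℂ, ∀ a, IsSelfAdjoint a → ψ a = μ a := by
  have hsub : ∀ a b, IsSelfAdjoint a → IsSelfAdjoint b → μ (a - b) = μ a - μ b := by
    intro a b ha hb
    have := hadd a ((-1 : ℝ) • b) ha ((IsSelfAdjoint.all _).smul hb)
    rw [hsmul _ _ hb] at this
    rw [show a - b = a + (-1 : ℝ) • b by simp [sub_eq_add_neg], this]; ring
  let L : (K →L[ℂ] K) →ₗ[ℂ] ℂ :=
    { toFun := fun x => (μ (ℜ x) : ℂ) + Complex.I * (μ (ℑ x) : ℂ)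
      map_add' := fun x y => by
        simp only [map_add, AddSubgroup.coe_add]
        rw [hadd _ _ (ℜ x).2 (ℜ y).2, hadd _ _ (ℑ x).2 (ℑ y).2]
        push_cast; ring
      map_smul' := fun c x => by
        have e1 : μ (ℜ (c • x) : K →L[ℂ] K) = c.re * μ (ℜ x) - c.im * μ (ℑ x) := by
          rw [realPart_smul, AddSubgroupClass.coe_sub, selfAdjoint.val_smul, selfAdjoint.val_smul,
            hsub _ _ ((IsSelfAdjoint.all _).smul (ℜ x).2) ((IsSelfAdjoint.all _).smul (ℑ x).2),
            hsmul _ _ (ℜ x).2, hsmul _ _ (ℑ x).2]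
        have e2 : μ (ℑ (c • x) : K →L[ℂ] K) = c.re * μ (ℑ x) + c.im * μ (ℜ x) := by
          rw [imaginaryPart_smul, AddSubgroup.coe_add, selfAdjoint.val_smul, selfAdjoint.val_smul,
            hadd _ _ ((IsSelfAdjoint.all _).smul (ℑ x).2) ((IsSelfAdjoint.all _).smul (ℜ x).2),
            hsmul _ _ (ℜ x).2, hsmul _ _ (ℑ x).2]
        rw [e1, e2]
        simp only [RingHom.id_apply, smul_eq_mul]
        apply Complex.ext <;> simp <;> ring }
  have hb0 : ∀ x : K →L[ℂ] K, ‖(ℜ x : K →L[ℂ] K)‖ ≤ ‖x‖ := fun x => realPart.norm_le x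
  have hb1 : ∀ x : K →L[ℂ] K, ‖(ℑ x : K →L[ℂ] K)‖ ≤ ‖x‖ := fun x => imaginaryPart.norm_le x
  refine ⟨L.mkContinuous (2 * |B|) fun x => ?_, fun a ha => ?_⟩
  · change ‖(μ (ℜ x) : ℂ) + Complex.I * (μ (ℑ x) : ℂ)‖ ≤ _
    refine (norm_add_le _ _).trans ?_
    rw [norm_mul, Complex.norm_I, one_mul, Complex.norm_real, Complex.norm_real]
    have a1 : ‖μ (ℜ x)‖ ≤ |B| * ‖x‖ := (hB _ (ℜ x).2).trans
      (mul_le_mul (le_abs_self B) (hb0 x) (norm_nonneg _) (abs_nonneg _))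
    have a2 : ‖μ (ℑ x)‖ ≤ |B| * ‖x‖ := (hB _ (ℑ x).2).trans
      (mul_le_mul (le_abs_self B) (hb1 x) (norm_nonneg _) (abs_nonneg _))
    linarith
  · change (μ (ℜ a) : ℂ) + Complex.I * (μ (ℑ a) : ℂ) = _
    have h0 : μ 0 = 0 := by simpa using hsmul 0 0 (IsSelfAdjoint.zero _)
    rw [ha.coe_realPart, ha.imaginaryPart]
    simp [h0]

lemma smul_one_bounds {a : K →L[ℂ] K} (ha : IsSelfAdjoint a) {s : ℝ} (hs : 0 < s)
    (h : s * ‖a‖ ≤ 1 / 32) : (1 / 16 : ℝ) • 1 ≤ s • a + (3 / 32 : ℝ) • (1 : K →L[ℂ] K) ∧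
      s • a + (3 / 32 : ℝ) • (1 : K →L[ℂ] K) ≤ (1 / 8 : ℝ) • 1 := by
  have h1 : (0 : K →L[ℂ] K) ≤ 1 := zero_le_one
  have hle : a ≤ ‖a‖ • 1 := by
    have := IsSelfAdjoint.le_algebraMap_norm_self ha; rwa [Algebra.algebraMap_eq_smul_one] at this
  have hge : -(‖a‖ • 1) ≤ a := by
    have := IsSelfAdjoint.neg_algebraMap_norm_le_self ha
    rwa [Algebra.algebraMap_eq_smul_one] at this
  have u1 : s • a ≤ (1 / 32 : ℝ) • 1 := by
    calc s • a ≤ s • (‖a‖ • (1 : K →L[ℂ] K)) := smul_le_smul_of_nonneg_left hle hs.le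
      _ = (s * ‖a‖) • 1 := smul_smul _ _ _
      _ ≤ _ := smul_le_smul_of_nonneg_right h h1
  have u2 : -((1 / 32 : ℝ) • (1 : K →L[ℂ] K)) ≤ s • a := by
    calc -((1 / 32 : ℝ) • (1 : K →L[ℂ] K)) ≤ -((s * ‖a‖) • 1) :=
          neg_le_neg (smul_le_smul_of_nonneg_right h h1)
      _ = s • (-(‖a‖ • (1 : K →L[ℂ] K))) := by rw [smul_neg, smul_smul]
      _ ≤ _ := smul_le_smul_of_nonneg_left hge hs.le
  constructor
  · calc (1 / 16 : ℝ) • (1 : K →L[ℂ] K) = -((1 / 32 : ℝ) • 1) + (3 / 32 : ℝ) • 1 := by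
          rw [← neg_smul, ← add_smul]; norm_num
      _ ≤ _ := add_le_add u2 le_rfl
  · calc s • a + (3 / 32 : ℝ) • (1 : K →L[ℂ] K) ≤ (1 / 32 : ℝ) • 1 + (3 / 32 : ℝ) • 1 :=
          add_le_add u1 le_rfl
      _ = _ := by rw [← add_smul]; norm_num

theorem Lin {m : (H →L[ℂ] H) → ℝ} {C : ℝ} (hm : PM m C) {z : ℕ → K →L[ℂ] H} (hz : OrtN z) :
    ∃ ψ : (K →L[ℂ] K) →L[ℂ] ℂ, ∀ p, IsStarProjection p → ψ p = m (z 0 ∘L p ∘L adjoint (z 0)) := by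
  have hP := mz_PM hm (hz.iso 0)
  obtain ⟨ψ, hψ⟩ := exists_clm (muv (mz m (z 0)) C) (2 * C) (by
    intro a b ha hb
    set s := 1 / (32 * (‖a‖ + ‖b‖ + 1)) with hs
    have hs0 : 0 < s := by positivity
    have hsa : s * ‖a‖ ≤ 1 / 32 := by
      rw [hs, div_mul_eq_mul_div, div_le_div_iff₀ (by positivity) (by norm_num)]
      nlinarith [norm_nonneg a, norm_nonneg b]
    have hsb : s * ‖b‖ ≤ 1 / 32 := by
      rw [hs, div_mul_eq_mul_div, div_le_div_iff₀ (by positivity) (by norm_num)]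
      nlinarith [norm_nonneg a, norm_nonneg b]
    obtain ⟨a1, a2⟩ := smul_one_bounds ha hs0 hsa
    obtain ⟨b1, b2⟩ := smul_one_bounds hb hs0 hsb
    have := delta_zero hm hz a1 a2 b1 b2
    rw [muv_affine hP ha, muv_affine hP hb, show s • a + (3 / 32 : ℝ) • 1 + (s • b + (3 / 32 : ℝ) • 1)
      = s • (a + b) + (3 / 16 : ℝ) • (1 : K →L[ℂ] K) by
        rw [smul_add, show (3 / 16 : ℝ) = 3 / 32 + 3 / 32 by norm_num, add_smul (3 / 32 : ℝ)]; abel,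
      muv_affine hP (ha.add hb)] at this
    have h2 : s * muv (mz m (z 0)) C (a + b) = s * (muv (mz m (z 0)) C a + muv (mz m (z 0)) C b) := by
      linarith
    exact mul_left_cancel₀ hs0.ne' h2)
    (by
      intro s a ha
      have := muv_affine hP ha s 0
      simpa using this)
    (fun a _ => muv_bound hP a)
  refine ⟨ψ, fun p hp => ?_⟩
  rw [hψ p hp.2, muv_proj hP hp]; rfl

lemma vanish_sa {ψ : (H →L[ℂ] H) →L[ℂ] ℂ} {h : H →L[ℂ] H} (hh : IsStarProjection h)
    (hψ : ∀ q, IsStarProjection q → h * q = q → ψ q = 0) {a : H →L[ℂ] H} (ha : IsSelfAdjoint a)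
    (hha : h * a = a) : ψ a = 0 := by
  have hah : a * h = a := by
    have := congrArg star hha
    rwa [star_mul, ha.star_eq, hh.2.star_eq] at this
  have hhh : h * h = h := hh.1
  rw [← norm_eq_zero]
  refine le_antisymm (le_of_forall_pos_le_add fun ε hε => ?_) (norm_nonneg _)
  obtain ⟨ι, _, q, l, hq, hn⟩ := SRsa a ha (ε / (‖ψ‖ + 1)) (by positivity)
  have hc : ∀ j, Commute h (q j) := fun j => hq.comm j h (by
    change h * a = a * h
    rw [hha, hah])
  have e0 : ψ (h * ∑ j, l j • q j) = 0 := by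
    rw [Finset.mul_sum, map_sum]
    refine Finset.sum_eq_zero fun j _ => ?_
    have e1 : ψ (h * q j) = 0 := hψ _ (hh.mul (hq.proj j) (hc j)) (by rw [← mul_assoc, hhh])
    have e2 : h * l j • q j = (l j : ℂ) • (h * q j) := by
      rw [mul_smul_comm]; rfl
    rw [e2, map_smul, e1, smul_zero]
  have e3 : ψ a = ψ (h * (a - ∑ j, l j • q j)) := by
    rw [mul_sub, map_sub, e0, hha, sub_zero]
  rw [e3, zero_add]
  have hn1 : ‖h‖ ≤ 1 := hh.norm_le
  calc _ ≤ ‖ψ‖ * ‖h * (a - ∑ j, l j • q j)‖ := ψ.le_opNorm _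
    _ ≤ ‖ψ‖ * (1 * (ε / (‖ψ‖ + 1))) := by
      gcongr
      exact (norm_mul_le _ _).trans (mul_le_mul hn1 hn (norm_nonneg _) zero_le_one)
    _ ≤ ε := by
      rw [one_mul, mul_div_assoc', div_le_iff₀ (by positivity)]
      nlinarith [norm_nonneg ψ]

lemma vanish {ψ : (H →L[ℂ] H) →L[ℂ] ℂ} {h : H →L[ℂ] H} (hh : IsStarProjection h)
    (hψ : ∀ q, IsStarProjection q → h * q = q → ψ q = 0) {x : H →L[ℂ] H} (h1 : h * x = x)
    (h2 : x * h = x) : ψ x = 0 := by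
  have hs : star h = h := hh.2
  have s1 : star x * h = star x := by
    have := congrArg star h1; rwa [star_mul, hs] at this
  have s2 : h * star x = star x := by
    have := congrArg star h2; rwa [star_mul, hs] at this
  have hr : h * (ℜ x : H →L[ℂ] H) = ℜ x := by
    rw [realPart_apply_coe, mul_smul_comm, mul_add, h1, s2]
  have hi : h * (ℑ x : H →L[ℂ] H) = ℑ x := by
    rw [imaginaryPart_apply_coe, mul_smul_comm, mul_smul_comm, mul_sub, h1, s2]
  rw [← realPart_add_I_smul_imaginaryPart x, map_add, map_smul, vanish_sa hh hψ (ℜ x).2 hr,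
    vanish_sa hh hψ (ℑ x).2 hi]
  simp

theorem room {m : (H →L[ℂ] H) → ℝ} {C : ℝ} (hm : PM m C) {S : ℕ → H →L[ℂ] H} (hS : OrtN S)
    {g J : H →L[ℂ] H} (hg : IsStarProjection g) (hJ : adjoint J ∘L J = ContinuousLinearMap.id ℂ H)
    (hgJ : g * J = 0) :
    ∃ ψ : (H →L[ℂ] H) →L[ℂ] ℂ, ∀ p, IsStarProjection p → g * p = p → ψ p = m p := by
  have hgg : g * g = g := hg.1
  have hgs : star g = g := hg.2
  let N : Submodule ℂ H := LinearMap.ker (1 - g : H →L[ℂ] H).toLinearMap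
  have hN : IsClosed (N : Set H) := ContinuousLinearMap.isClosed_ker (1 - g : H →L[ℂ] H)
  have memN : ∀ x, x ∈ N ↔ g x = x := by
    intro x
    change (1 - g : H →L[ℂ] H) x = 0 ↔ _
    rw [sub_apply, sub_eq_zero, eq_comm]; rfl
  haveI : CompleteSpace N := hN.completeSpace_coe
  set i : N →L[ℂ] H := N.subtypeL with hi
  have hii : adjoint i ∘L i = ContinuousLinearMap.id ℂ N := by
    ext1 x
    apply ext_inner_left ℂ
    intro y
    rw [comp_apply, adjoint_inner_right]; rfl
  have gi : ∀ x, g (i x) = i x := fun x => (memN _).1 x.2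
  have hii' := fun y => DFunLike.congr_fun hii y
  simp only [comp_apply, id_apply] at hii'
  have iig : ∀ x, i (adjoint i x) = g x := by
    intro x
    have hx : g (g x) = g x := DFunLike.congr_fun hgg x
    have e1 : i (adjoint i (g x)) = g x := by
      have := hii' ⟨g x, (memN _).2 hx⟩
      have e : i ⟨g x, (memN _).2 hx⟩ = g x := rfl
      rw [e] at this
      rw [this]; rfl
    have e2 : adjoint i (g x) = adjoint i x := by
      apply ext_inner_left ℂ
      intro y
      rw [adjoint_inner_right, adjoint_inner_right, ← adjoint_inner_left, ← star_eq_adjoint, hgs, gi]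
    rw [← e1, e2]
  have iJ : ∀ x, adjoint i (J x) = 0 := by
    intro x
    have h0 : g (J x) = 0 := DFunLike.congr_fun hgJ x
    have := iig (J x)
    rw [h0] at this
    have h2 := congrArg (adjoint i) this
    rw [hii', map_zero] at h2; exact h2
  have hJ' := fun y => DFunLike.congr_fun hJ y
  simp only [comp_apply, id_apply] at hJ'
  let z : ℕ → N →L[ℂ] H := fun n => Nat.casesOn n i (fun k => J ∘L S k ∘L i)
  have hz : OrtN z := by
    have hJi : ∀ k, adjoint i ∘L (J ∘L S k ∘L i) = 0 := fun k => by
      ext1 x; simp [iJ]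
    intro a b
    rcases a with _ | a <;> rcases b with _ | b
    · simpa [z] using hii
    · simpa [z] using hJi b
    · simpa [z] using adj_zero_symm (hJi a)
    · simp only [z, Nat.add_right_cancel_iff]
      have := fun y => DFunLike.congr_fun (hS a b) y
      ext1 x
      simp only [comp_apply, adjoint_comp, hJ'] at this ⊢
      rw [this]
      split_ifs with h
      · simp [hii']
      · simp
  obtain ⟨ψ, hψ⟩ := Lin hm hz
  let c : (H →L[ℂ] H) →L[ℂ] (N →L[ℂ] N) :=
    (ContinuousLinearMap.compL ℂ N H N (adjoint i)).comp ((ContinuousLinearMap.compL ℂ N H H).flip i)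
  have hc : ∀ x, c x = adjoint i ∘L (x ∘L i) := fun x => rfl
  refine ⟨ψ.comp c, fun p hp hgp => ?_⟩
  have hps : star p = p := hp.2
  have hpp : p * p = p := hp.1
  have hpg : p * g = p := by
    have := congrArg star hgp; rwa [star_mul, hgs, hps] at this
  have hpp' := fun y => DFunLike.congr_fun hpp y
  have hgp' := fun y => DFunLike.congr_fun hgp y
  have hpg' := fun y => DFunLike.congr_fun hpg y
  simp only [mulA] at hpp' hgp' hpg'
  have hcp : IsStarProjection (c p) := by
    constructor
    · unfold IsIdempotentElem
      rw [hc]; ext1 x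
      simp [mulA, iig, hpp', hgp']
    · rw [isSelfAdjoint_iff, hc, star_eq_adjoint, adjoint_comp, adjoint_comp, adjoint_adjoint,
        ← star_eq_adjoint p, hps]; rfl
  rw [comp_apply, hψ _ hcp]
  congr 2
  ext1 x
  simp [z, hc, iig, hgp', hpg']

end GOsec

end partO

section partP

section GPsec
variable {H : Type u} [NormedAddCommGroup H] [InnerProductSpace ℂ H] [CompleteSpace H]

lemma basis_ext {ι : Type*} (b : HilbertBasis ι ℂ H) {T T' : H →L[ℂ] H}
    (h : ∀ i, T (b i) = T' (b i)) : T = T' := by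
  refine ContinuousLinearMap.ext_on (s := Set.range b) ?_ ?_
  · exact Submodule.dense_iff_topologicalClosure_eq_top.2 b.dense_span
  · rintro _ ⟨i, rfl⟩; exact h i

lemma basis_zero {ι : Type*} (b : HilbertBasis ι ℂ H) {T : H →L[ℂ] H}
    (h : ∀ i j, ⟪b i, T (b j)⟫ = 0) : T = 0 := by
  refine basis_ext b fun j => ?_
  apply b.repr.injective
  ext i
  rw [b.repr_apply_apply, h]; simp

lemma iso_of_orthonormal {ι : Type*} (b : HilbertBasis ι ℂ H) {x : ι → H}
    (hx : Orthonormal ℂ x) : ∃ J : H →L[ℂ] H, (∀ i, J (b i) = x i) ∧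
      adjoint J ∘L J = ContinuousLinearMap.id ℂ H := by
  classical
  refine ⟨(hx.orthogonalFamily.linearIsometry.comp
    b.repr.toLinearIsometry).toContinuousLinearMap, fun i => ?_, ?_⟩
  · change hx.orthogonalFamily.linearIsometry (b.repr (b i)) = x i
    rw [b.repr_self, OrthogonalFamily.linearIsometry_apply_single]
    simp
  · exact (ContinuousLinearMap.norm_map_iff_adjoint_comp_self _).1 fun y => by
      simp

lemma cuntz {ι : Type*} [Infinite ι] (b : HilbertBasis ι ℂ H) :
    ∃ R₁ R₂ : H →L[ℂ] H, adjoint R₁ ∘L R₁ = ContinuousLinearMap.id ℂ H ∧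
      adjoint R₂ ∘L R₂ = ContinuousLinearMap.id ℂ H ∧ adjoint R₁ ∘L R₂ = 0 ∧
      R₁ ∘L adjoint R₁ + R₂ ∘L adjoint R₂ = 1 := by
  classical
  obtain ⟨e⟩ : Nonempty (ι ⊕ ι ≃ ι) := by
    rw [← Cardinal.eq]
    simp [Cardinal.mk_sum, Cardinal.add_eq_self (Cardinal.aleph0_le_mk ι)]
  obtain ⟨R₁, h1, h1'⟩ := iso_of_orthonormal b
    (b.orthonormal.comp (fun i => e (Sum.inl i)) (e.injective.comp Sum.inl_injective))
  obtain ⟨R₂, h2, h2'⟩ := iso_of_orthonormal b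
    (b.orthonormal.comp (fun i => e (Sum.inr i)) (e.injective.comp Sum.inr_injective))
  have h12 : adjoint R₁ ∘L R₂ = 0 := by
    refine basis_zero b fun i j => ?_
    rw [comp_apply, adjoint_inner_right, h1, h2]
    apply b.orthonormal.2
    simp
  refine ⟨R₁, R₂, h1', h2', h12, basis_ext b fun k => ?_⟩
  have h21 := adj_zero_symm h12
  have p1 := fun y => DFunLike.congr_fun h1' y
  have p2 := fun y => DFunLike.congr_fun h2' y
  have p3 := fun y => DFunLike.congr_fun h12 y
  have p4 := fun y => DFunLike.congr_fun h21 y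
  simp only [comp_apply, id_apply, zero_apply] at p1 p2 p3 p4
  have o1 : ∀ y, (1 : H →L[ℂ] H) y = y := fun y => rfl
  obtain ⟨s, rfl⟩ := e.surjective k
  rcases s with i | i
  · have : b (e (Sum.inl i)) = R₁ (b i) := (h1 i).symm
    simp [this, p1, p4, o1]
  · have : b (e (Sum.inr i)) = R₂ (b i) := (h2 i).symm
    simp [this, p2, p3, o1]

lemma cuntz_ortN {R₁ R₂ : H →L[ℂ] H} (h1 : adjoint R₁ ∘L R₁ = ContinuousLinearMap.id ℂ H)
    (h2 : adjoint R₂ ∘L R₂ = ContinuousLinearMap.id ℂ H) (h12 : adjoint R₁ ∘L R₂ = 0) :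
    OrtN (fun n => R₂ ^ n * R₁) := by
  have a1 : star R₁ * R₁ = 1 := h1
  have a2 : star R₂ * R₂ = 1 := h2
  have a3 : star R₁ * R₂ = 0 := h12
  have a4 : star R₂ * R₁ = 0 := adj_zero_symm h12
  have key : ∀ n, star (R₂ ^ n) * R₂ ^ n = 1 := by
    intro n
    induction n with
    | zero => simp
    | succ k ih =>
      rw [pow_succ, star_mul, mul_assoc, ← mul_assoc (star (R₂ ^ k)), ih, one_mul, a2]
  have lt : ∀ i k, star (R₂ ^ i * R₁) * (R₂ ^ (i + (k + 1)) * R₁) = 0 := by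
    intro i k
    rw [star_mul, pow_add, mul_assoc, mul_assoc (R₂ ^ i), ← mul_assoc (star (R₂ ^ i)), key,
      one_mul, pow_succ', mul_assoc, ← mul_assoc, a3, zero_mul]
  intro i j
  change star (R₂ ^ i * R₁) * (R₂ ^ j * R₁) = _
  rcases lt_trichotomy i j with h | h | h
  · obtain ⟨k, rfl⟩ := Nat.exists_eq_add_of_lt h
    rw [if_neg h.ne, add_assoc, lt]
  · subst h
    rw [if_pos rfl, star_mul, mul_assoc, ← mul_assoc (star (R₂ ^ i)), key, one_mul, a1]; rfl
  · obtain ⟨k, rfl⟩ := Nat.exists_eq_add_of_lt h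
    rw [if_neg h.ne', add_assoc, ← star_star (R₂ ^ j * R₁), ← star_mul, lt, star_zero]
end GPsec

end partP

section partQ

section GQsec
variable {H : Type u} [NormedAddCommGroup H] [InnerProductSpace ℂ H] [CompleteSpace H]

def kk (i j : Fin 3) : Fin 3 :=
  if i = 0 ∨ j = 0 then (if i = 1 ∨ j = 1 then 2 else 1) else 0

lemma kk_left : ∀ i j, kk i j ≠ i := by decide
lemma kk_right : ∀ i j, kk i j ≠ j := by decide
lemma kk_eq : ∀ i j k : Fin 3, i ≠ j → i ≠ k → j ≠ k → kk i j = k := by decide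

lemma sum_cut {e : Fin 3 → H →L[ℂ] H} (he1 : ∑ i, e i = 1) (x : H →L[ℂ] H) :
    ∑ i, ∑ j, e i * x * e j = x := by
  simp_rw [← Finset.mul_sum, he1, mul_one, ← Finset.sum_mul, he1, one_mul]

theorem stepA {m : (H →L[ℂ] H) → ℝ} {C : ℝ} (hm : PM m C) {S : ℕ → H →L[ℂ] H} (hS : OrtN S)
    {e v : Fin 3 → H →L[ℂ] H} (he : ∀ i, IsStarProjection (e i))
    (heo : ∀ i j, i ≠ j → e i * e j = 0) (he1 : ∑ i, e i = 1)
    (hv : ∀ i, adjoint (v i) ∘L v i = ContinuousLinearMap.id ℂ H) (hev : ∀ i, e i * v i = v i) :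
    ∃ φ : (H →L[ℂ] H) →L[ℂ] ℂ, ∀ k p, IsStarProjection p → e k * p = 0 → φ p = m p := by
  have hr : ∀ k, ∃ ψ : (H →L[ℂ] H) →L[ℂ] ℂ, ∀ p, IsStarProjection p → e k * p = 0 → ψ p = m p := by
    intro k
    obtain ⟨ψ, hψ⟩ := room hm hS (he k).one_sub (hv k) (by rw [sub_mul, one_mul, hev, sub_self])
    exact ⟨ψ, fun p hp h => hψ p hp (by rw [sub_mul, one_mul, h, sub_zero])⟩
  choose ψ hψ using hr
  let φ : (H →L[ℂ] H) →L[ℂ] ℂ := ∑ i, ∑ j, (ψ (kk i j)).comp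
    (((ContinuousLinearMap.mul ℂ (H →L[ℂ] H)).flip (e j)).comp
      (ContinuousLinearMap.mul ℂ (H →L[ℂ] H) (e i)))
  have hφ : ∀ x, φ x = ∑ i, ∑ j, ψ (kk i j) (e i * x * e j) := by
    intro x
    simp only [φ, sum_apply, comp_apply, flip_apply]
    rfl
  refine ⟨φ, fun k p hp hkp => ?_⟩
  have hpk : p * e k = 0 := by
    have := congrArg star hkp
    rwa [star_mul, star_zero, (he k).2.star_eq, hp.2.star_eq] at this
  rw [← hψ k p hp hkp, hφ]
  conv_rhs => rw [← sum_cut he1 p]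
  rw [map_sum]
  refine Finset.sum_congr rfl fun i _ => ?_
  rw [map_sum]
  refine Finset.sum_congr rfl fun j _ => ?_
  by_cases hi : i = k
  · rw [hi, hkp]; simp
  by_cases hj : j = k
  · rw [hj, mul_assoc, hpk]; simp
  by_cases hij : i = j
  · subst hij
    have := vanish (ψ := ψ (kk i i) - ψ k) (h := e i) (x := e i * p * e i) (he i) ?_ ?_ ?_
    · rwa [sub_apply, sub_eq_zero] at this
    · intro q hq hiq
      have aux : ∀ l, l ≠ i → e l * q = 0 := by
        intro l hl
        rw [← hiq, ← mul_assoc, heo _ _ hl, zero_mul]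
      rw [sub_apply, hψ _ q hq (aux _ (kk_left _ _)), hψ _ q hq (aux _ (Ne.symm hi)), sub_self]
    · rw [← mul_assoc, ← mul_assoc, (he i).1.eq]
    · rw [mul_assoc, (he i).1.eq]
  · rw [kk_eq i j k hij hi hj]

theorem stepB {m : (H →L[ℂ] H) → ℝ} {C : ℝ} (hm : PM m C) {S : ℕ → H →L[ℂ] H} (hS : OrtN S)
    {e : Fin 3 → H →L[ℂ] H} (he : ∀ i, IsStarProjection (e i))
    (heo : ∀ i j, i ≠ j → e i * e j = 0) (he1 : ∑ i, e i = 1)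
    (h0 : ∀ k p, IsStarProjection p → e k * p = 0 → m p = 0)
    {J : H →L[ℂ] H} (hJ : adjoint J ∘L J = ContinuousLinearMap.id ℂ H) (hJ2 : e 2 * J = J)
    {q : H →L[ℂ] H} (hq : IsStarProjection q) (hqJ : q * J = 0) : m q = 0 := by
  have hJs : star J * J = 1 := hJ
  set r : H →L[ℂ] H := J * star J with hr
  have hrp : IsStarProjection r := pr_proj_iso hJ
  set g : H →L[ℂ] H := 1 - r with hg
  have hgp : IsStarProjection g := hrp.one_sub
  have her : ∀ i, e i * r = r * e i := by
    intro i
    have : e i * r = if i = 2 then r else 0 := by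
      split_ifs with h
      · rw [h, hr, ← mul_assoc, hJ2]
      · rw [hr, ← hJ2, ← mul_assoc, ← mul_assoc, heo _ _ h, zero_mul, zero_mul]
    have h2 := congrArg star this
    rw [star_mul, (he i).2.star_eq, hrp.2.star_eq] at h2
    rw [this, h2]
    split_ifs
    · rw [hrp.2.star_eq]
    · rw [star_zero]
  have heg : ∀ i, e i * g = g * e i := by
    intro i
    rw [hg, mul_sub, sub_mul, her, mul_one, one_mul]
  have hgq : g * q = q := by
    have : star J * q = 0 := by
      have := congrArg star hqJ
      rwa [star_mul, star_zero, hq.2.star_eq] at this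
    rw [hg, sub_mul, one_mul, hr, mul_assoc, this, mul_zero, sub_zero]
  have hqg : q * g = q := by
    rw [hg, mul_sub, mul_one, hr, ← mul_assoc, hqJ, zero_mul, sub_zero]
  obtain ⟨ψ, hψ⟩ := room hm hS hgp hJ (by
    rw [hg, sub_mul, one_mul, hr, mul_assoc, hJs, mul_one, sub_self])
  clear_value g
  have h1 : ψ q = 0 := by
    rw [← sum_cut he1 q, map_sum]
    refine Finset.sum_eq_zero fun i _ => ?_
    rw [map_sum]
    refine Finset.sum_eq_zero fun j _ => ?_
    set k := kk i j with hk
    have hki : e k * e i = 0 := heo _ _ (kk_left _ _)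
    have hjk : e j * e k = 0 := heo _ _ (Ne.symm (kk_right _ _))
    have hcg : g * (1 - e k) = (1 - e k) * g := by
      rw [mul_sub, sub_mul, heg, mul_one, one_mul]
    have hkk : e k * (1 - e k) = 0 := by rw [mul_sub, mul_one, (he k).1.eq, sub_self]
    refine vanish (h := g * (1 - e k)) ?_ ?_ ?_ ?_
    · constructor
      · change g * (1 - e k) * (g * (1 - e k)) = g * (1 - e k)
        rw [mul_assoc, ← mul_assoc (1 - e k) g, ← hcg, mul_assoc, (he k).one_sub.1.eq,
          ← mul_assoc, hgp.1.eq]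
      · change star (g * (1 - e k)) = _
        rw [star_mul, (he k).one_sub.2.star_eq, hgp.2.star_eq, hcg]
    · intro q' hq' hh
      have a1 : g * q' = q' := by
        conv_lhs => rw [← hh]
        rw [← mul_assoc, ← mul_assoc, hgp.1.eq, hh]
      have a2 : e k * q' = 0 := by
        rw [← hh, ← mul_assoc, ← mul_assoc, heg, mul_assoc g, hkk, mul_zero, zero_mul]
      rw [hψ q' hq' a1, h0 k q' hq' a2]; simp
    · rw [mul_assoc g, sub_mul, one_mul, ← mul_assoc (e k), ← mul_assoc (e k), hki, zero_mul,
        zero_mul, sub_zero, ← mul_assoc, ← mul_assoc, ← heg, mul_assoc (e i), hgq]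
    · rw [hcg, ← mul_assoc, mul_sub, mul_one, mul_assoc (e i * q), hjk, mul_zero, sub_zero,
        mul_assoc, heg, ← mul_assoc, mul_assoc (e i), hqg]
  rw [hψ q hq hgq] at h1
  exact_mod_cast h1
end GQsec

end partQ

section partR

section GRsec
variable {H : Type u} [NormedAddCommGroup H] [InnerProductSpace ℂ H] [CompleteSpace H]

def Good (T : H →L[ℂ] H) (S : Set H) : Prop :=
  (∀ x ∈ S, ‖x‖ = 1) ∧ ∀ x ∈ S, ∀ y ∈ S, x ≠ y → ⟪x, y⟫ = 0 ∧ ⟪x, T y⟫ = 0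

lemma exists_maxGood {T : H →L[ℂ] H} (hT : adjoint T = T) :
    ∃ S : Set H, Good T S ∧ ∀ y, (∀ s ∈ S, ⟪s, y⟫ = 0 ∧ ⟪T s, y⟫ = 0) → y = 0 := by
  obtain ⟨S, hS⟩ := zorn_subset {S | Good T S} (by
    intro c hc hch
    refine ⟨⋃₀ c, ⟨?_, ?_⟩, fun s hs => Set.subset_sUnion_of_mem hs⟩
    · rintro x ⟨s, hs, hx⟩
      exact (hc hs).1 x hx
    · rintro x ⟨s, hs, hx⟩ y ⟨t, ht, hy⟩ hxy
      rcases hch.total hs ht with h | h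
      · exact (hc ht).2 x (h hx) y hy hxy
      · exact (hc hs).2 x hx y (h hy) hxy)
  refine ⟨S, hS.prop, fun y hy => ?_⟩
  by_contra hy0
  have hny : ‖y‖ ≠ 0 := norm_ne_zero_iff.2 hy0
  let y' : H := ((‖y‖⁻¹ : ℝ) : ℂ) • y
  have hy'1 : ‖y'‖ = 1 := by
    simp only [y', norm_smul, Complex.norm_real, norm_inv, norm_norm]
    exact inv_mul_cancel₀ hny
  have hy' : ∀ s ∈ S, ⟪s, y'⟫ = 0 ∧ ⟪T s, y'⟫ = 0 := by
    intro s hs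
    simp only [y', inner_smul_right, (hy s hs).1, (hy s hs).2, mul_zero, and_self]
  have hT' : ∀ a b : H, ⟪T a, b⟫ = ⟪a, T b⟫ := by
    intro a b
    conv_lhs => rw [← hT]
    rw [adjoint_inner_left]
  have hg : Good T (insert y' S) := by
    refine ⟨?_, ?_⟩
    · rintro x (rfl | hx)
      · exact hy'1
      · exact hS.prop.1 x hx
    · rintro x (rfl | hx) z (rfl | hz) hxz
      · exact absurd rfl hxz
      · obtain ⟨h1, h2⟩ := hy' z hz
        constructor
        · rw [← inner_conj_symm, h1, map_zero]
        · rw [← inner_conj_symm, h2, map_zero]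
      · obtain ⟨h1, h2⟩ := hy' x hx
        exact ⟨h1, by rw [← hT', h2]⟩
      · exact hS.prop.2 x hx z hz hxz
  have hmem : y' ∈ S := hS.le_of_ge hg (Set.subset_insert _ _) (Set.mem_insert _ _)
  have := (hy' y' hmem).1
  rw [inner_self_eq_zero] at this
  rw [this, norm_zero] at hy'1
  exact zero_ne_one hy'1

lemma card_Good {ι : Type u} [Infinite ι] (b : HilbertBasis ι ℂ H) {T : H →L[ℂ] H} {S : Set H}
    (hS : ∀ y, (∀ s ∈ S, ⟪s, y⟫ = 0 ∧ ⟪T s, y⟫ = 0) → y = 0) : Cardinal.mk ι ≤ Cardinal.mk S := by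
  have hinf : S.Infinite := by
    intro hfin
    let M : Submodule ℂ H := Submodule.span ℂ (S ∪ T '' S)
    haveI : FiniteDimensional ℂ M :=
      FiniteDimensional.span_of_finite ℂ (hfin.union (hfin.image _))
    have hM : Mᗮ = ⊥ := by
      rw [Submodule.eq_bot_iff]
      intro y hy
      rw [Submodule.mem_orthogonal] at hy
      exact hS y fun s hs => ⟨hy s (Submodule.subset_span (Or.inl hs)),
        hy (T s) (Submodule.subset_span (Or.inr ⟨s, hs, rfl⟩))⟩
    rw [Submodule.orthogonal_eq_bot_iff] at hM
    rw [hM] at this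
    haveI : FiniteDimensional ℂ H := Module.Finite.equiv (Submodule.topEquiv (R := ℂ) (M := H))
    have := b.orthonormal.linearIndependent.finite
    exact not_finite ι
  haveI := hinf.to_subtype
  let A : S → Set ι := fun s => {i | ⟪(s : H), b i⟫ ≠ 0} ∪ {i | ⟪T s, b i⟫ ≠ 0}
  have hc : ∀ x : H, {i | ⟪x, b i⟫ ≠ 0}.Countable := by
    intro x
    have h := (b.orthonormal.inner_products_summable (x := x)).countable_support
    refine h.mono fun i hi => ?_
    simp only [Function.mem_support]
    intro h0
    apply hi
    have : ⟪b i, x⟫ = 0 := by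
      rw [← norm_eq_zero]; exact pow_eq_zero_iff (two_ne_zero) |>.1 h0
    rw [← inner_conj_symm, this, map_zero]
  have hA : ∀ s, (A s).Countable := fun s => (hc _).union (hc _)
  have hU : (⋃ s, A s) = Set.univ := by
    rw [Set.eq_univ_iff_forall]
    intro i
    by_contra hi
    simp only [A, Set.mem_iUnion, Set.mem_union, Set.mem_setOf_eq, not_exists, not_or,
      not_not] at hi
    have := hS (b i) fun s hs => hi ⟨s, hs⟩
    have h1 := b.orthonormal.1 i
    rw [this, norm_zero] at h1
    exact zero_ne_one h1
  rw [← Cardinal.mk_univ, ← hU]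
  refine (Cardinal.mk_iUnion_le_sum_mk).trans ?_
  refine (Cardinal.sum_le_sum _ (fun _ => Cardinal.aleph0) fun s => (hA s).le_aleph0).trans ?_
  rw [Cardinal.sum_const']
  exact (Cardinal.mul_aleph0_eq (Cardinal.aleph0_le_mk S)).le

lemma exists_two {ι : Type u} [Infinite ι] (b : HilbertBasis ι ℂ H) {T : H →L[ℂ] H}
    (hT : adjoint T = T) : ∃ J₁ J₂ : H →L[ℂ] H, adjoint J₁ ∘L J₁ = ContinuousLinearMap.id ℂ H ∧
      adjoint J₂ ∘L J₂ = ContinuousLinearMap.id ℂ H ∧ adjoint J₁ ∘L T ∘L J₂ = 0 := by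
  obtain ⟨S, hS, hmax⟩ := exists_maxGood hT
  obtain ⟨f⟩ : Nonempty (ι ⊕ ι ↪ S) := by
    rw [← Cardinal.le_def, Cardinal.mk_sum]
    simpa [Cardinal.add_eq_self (Cardinal.aleph0_le_mk ι)] using card_Good b hmax
  have ho : Orthonormal ℂ (fun s : ι ⊕ ι => (f s : H)) :=
    ⟨fun s => hS.1 _ (f s).2, fun s t hst => (hS.2 _ (f s).2 _ (f t).2 (fun h =>
      hst (f.injective (Subtype.ext h)))).1⟩
  obtain ⟨J₁, h1, h1'⟩ := iso_of_orthonormal b (ho.comp Sum.inl Sum.inl_injective)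
  obtain ⟨J₂, h2, h2'⟩ := iso_of_orthonormal b (ho.comp Sum.inr Sum.inr_injective)
  refine ⟨J₁, J₂, h1', h2', basis_zero b fun i j => ?_⟩
  rw [comp_apply, adjoint_inner_right, comp_apply, h1, h2]
  refine (hS.2 _ (f _).2 _ (f _).2 fun h => ?_).2
  have := f.injective (Subtype.ext h)
  simp at this

lemma proj_of_fix {p r : H →L[ℂ] H} (hp : IsStarProjection p) (hr : IsStarProjection r)
    (h : p * r = r) : IsStarProjection (p - r) ∧ r * (p - r) = 0 := by
  have h' : r * p = r := by
    have := congrArg star h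
    rwa [star_mul, hp.2.star_eq, hr.2.star_eq] at this
  refine ⟨⟨?_, hp.2.sub hr.2⟩, by rw [mul_sub, h', hr.1.eq, sub_self]⟩
  change (p - r) * (p - r) = p - r
  rw [sub_mul, mul_sub, mul_sub, hp.1.eq, h, h', hr.1.eq]; abel

lemma split_proj {p J₁ J₂ : H →L[ℂ] H} (hp : IsStarProjection p) (h : adjoint J₁ ∘L p ∘L J₂ = 0) :
    ∃ r, IsStarProjection r ∧ p * r = r ∧ r * J₂ = 0 ∧ (p - r) * J₁ = 0 := by
  let N : Submodule ℂ H := (LinearMap.range (p * J₁).toLinearMap).topologicalClosure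
  haveI : CompleteSpace N := (Submodule.isClosed_topologicalClosure _).completeSpace_coe
  have hpp : ∀ x, p (p x) = p x := fun x => DFunLike.congr_fun hp.1.eq x
  have hps : adjoint p = p := hp.2
  have hN : ∀ x ∈ N, p x = x := by
    have hcl : IsClosed {x | p x = x} := isClosed_eq p.continuous continuous_id
    intro x hx
    refine closure_minimal ?_ hcl hx
    rintro _ ⟨y, rfl⟩
    exact hpp _
  have hpr : p * N.starProjection = N.starProjection := by
    ext x
    exact hN _ (N.starProjection_apply_mem x)
  have hr := starProj_isStarProj N
  have hrp : N.starProjection * p = N.starProjection := by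
    have := congrArg star hpr
    rwa [star_mul, hp.2.star_eq, hr.2.star_eq] at this
  refine ⟨N.starProjection, hr, hpr, ?_, ?_⟩
  · ext x
    change N.starProjection (J₂ x) = 0
    rw [Submodule.starProjection_apply_eq_zero_iff, Submodule.orthogonal_closure]
    rw [Submodule.mem_orthogonal]
    rintro _ ⟨y, rfl⟩
    change ⟪p (J₁ y), J₂ x⟫ = 0
    have h2 : ⟪y, (adjoint J₁ ∘L p ∘L J₂) x⟫ = 0 := by rw [h]; simp
    rw [comp_apply, adjoint_inner_right, comp_apply] at h2
    rw [← h2]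
    conv_lhs => rw [← hps]
    rw [adjoint_inner_left]
  · rw [sub_mul, sub_eq_zero]
    rw [← hrp, mul_assoc]
    ext x
    refine (Submodule.starProjection_eq_self_iff.2 ?_).symm
    exact Submodule.le_topologicalClosure _ ⟨x, rfl⟩

theorem gleason_inf {ι : Type u} [Infinite ι] (b : HilbertBasis ι ℂ H)
    {m : (H →L[ℂ] H) → ℝ} {C : ℝ} (hm : PM m C) :
    ∃ φ : (H →L[ℂ] H) →L[ℂ] ℂ, ∀ p, IsStarProjection p → φ p = m p := by
  obtain ⟨R₁, R₂, h1, h2, h12, hs⟩ := cuntz b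
  have a1 : star R₁ * R₁ = 1 := h1
  have a2 : star R₂ * R₂ = 1 := h2
  have a3 : star R₁ * R₂ = 0 := h12
  have a4 : star R₂ * R₁ = 0 := adj_zero_symm h12
  have as : R₁ * star R₁ + R₂ * star R₂ = 1 := hs
  have hS := cuntz_ortN h1 h2 h12
  let v : Fin 3 → H →L[ℂ] H := ![R₁, R₂ * R₁, R₂ * R₂]
  let e : Fin 3 → H →L[ℂ] H := fun i => v i * star (v i)
  have hv : ∀ i, star (v i) * v i = 1 := by
    intro i
    fin_cases i
    · exact a1
    · change star (R₂ * R₁) * (R₂ * R₁) = 1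
      rw [star_mul, mul_assoc, ← mul_assoc (star R₂), a2, one_mul, a1]
    · change star (R₂ * R₂) * (R₂ * R₂) = 1
      rw [star_mul, mul_assoc, ← mul_assoc (star R₂) R₂, a2, one_mul, a2]
  have he : ∀ i, IsStarProjection (e i) := fun i => pr_proj_iso (hv i)
  have hev : ∀ i, e i * v i = v i := fun i => by
    change v i * star (v i) * v i = v i
    rw [mul_assoc, hv, mul_one]
  have b01 : star (v 0) * v 1 = 0 := by
    change star R₁ * (R₂ * R₁) = 0
    rw [← mul_assoc, a3, zero_mul]
  have b02 : star (v 0) * v 2 = 0 := by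
    change star R₁ * (R₂ * R₂) = 0
    rw [← mul_assoc, a3, zero_mul]
  have b12 : star (v 1) * v 2 = 0 := by
    change star (R₂ * R₁) * (R₂ * R₂) = 0
    rw [star_mul, mul_assoc, ← mul_assoc (star R₂), a2, one_mul, a3]
  have b10 : star (v 1) * v 0 = 0 := adj_zero_symm b01
  have b20 : star (v 2) * v 0 = 0 := adj_zero_symm b02
  have b21 : star (v 2) * v 1 = 0 := adj_zero_symm b12
  have hvo : ∀ i j, i ≠ j → star (v i) * v j = 0 := by
    intro i j hij
    fin_cases i <;> fin_cases j <;> first | exact absurd rfl hij | assumption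
  have heo : ∀ i j, i ≠ j → e i * e j = 0 := by
    intro i j hij
    change v i * star (v i) * (v j * star (v j)) = 0
    rw [mul_assoc, ← mul_assoc (star (v i)), hvo i j hij, zero_mul, mul_zero]
  have he1 : ∑ i, e i = 1 := by
    rw [Fin.sum_univ_three]
    change R₁ * star R₁ + R₂ * R₁ * star (R₂ * R₁) + R₂ * R₂ * star (R₂ * R₂) = 1
    have : R₂ * R₁ * star (R₂ * R₁) + R₂ * R₂ * star (R₂ * R₂)
        = R₂ * (R₁ * star R₁ + R₂ * star R₂) * star R₂ := by
      rw [star_mul, star_mul]; noncomm_ring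
    rw [add_assoc, this, as, mul_one, as]
  obtain ⟨φ, hφ⟩ := stepA hm hS he heo he1 hv hev
  have hm' : PM (fun p => m p - (φ p).re) (C + ‖φ‖) := by
    refine ⟨fun p hp => ?_, fun p q hp hq hpq => ?_⟩
    · refine (abs_sub _ _).trans (add_le_add (hm.bdd p hp) ?_)
      refine (Complex.abs_re_le_norm _).trans ((φ.le_opNorm p).trans ?_)
      exact mul_le_of_le_one_right (norm_nonneg _) hp.norm_le
    · simp only [hm.add p q hp hq hpq, map_add, Complex.add_re]; ring
  have h0 : ∀ k p, IsStarProjection p → e k * p = 0 → m p - (φ p).re = 0 := by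
    intro k p hp hk
    rw [hφ k p hp hk]; simp
  have hzero : ∀ p, IsStarProjection p → m p - (φ p).re = 0 := by
    intro p hp
    obtain ⟨J₁, J₂, j1, j2, j12⟩ := exists_two b (T := star (v 2) * p * v 2) (by
      change star _ = _
      rw [star_mul, star_mul, star_star, hp.2.star_eq, mul_assoc])
    have j1' : star J₁ * J₁ = 1 := j1
    have j2' : star J₂ * J₂ = 1 := j2
    have iso : ∀ J : H →L[ℂ] H, star J * J = 1 → star (v 2 * J) * (v 2 * J) = 1 := by
      intro J hJ
      rw [star_mul, mul_assoc, ← mul_assoc (star (v 2)), hv, one_mul, hJ]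
    obtain ⟨r, hr, hpr, hr2, hr1⟩ := split_proj (J₁ := v 2 * J₁) (J₂ := v 2 * J₂) hp (by
      have : star J₁ * (star (v 2) * p * v 2 * J₂) = 0 := j12
      change star (v 2 * J₁) * (p * (v 2 * J₂)) = 0
      rw [← this, star_mul]; simp only [mul_assoc])
    obtain ⟨hd, hrd⟩ := proj_of_fix hp hr hpr
    have e2 : ∀ J : H →L[ℂ] H, e 2 * (v 2 * J) = v 2 * J := fun J => by
      rw [← mul_assoc, hev]
    have z1 := stepB hm' hS he heo he1 h0 (iso _ j2') (e2 _) hr hr2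
    have z2 := stepB hm' hS he heo he1 h0 (iso _ j1') (e2 _) hd hr1
    have := hm'.add r (p - r) hr hd hrd
    rw [add_sub_cancel] at this
    rw [this, z1, z2, add_zero]
  obtain ⟨ψ, hψ⟩ := exists_clm (fun a : H →L[ℂ] H => (φ a).re) ‖φ‖
    (fun a b _ _ => by simp) (fun s a _ => by
      rw [show s • a = (s : ℂ) • a from (RCLike.real_smul_eq_coe_smul (K := ℂ) s a)]
      simp) (fun a _ => (Complex.abs_re_le_norm _).trans (φ.le_opNorm a))
  refine ⟨ψ, fun p hp => ?_⟩
  rw [hψ p hp.2]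
  have := hzero p hp
  exact_mod_cast (sub_eq_zero.1 this).symm
end GRsec

end partR

section partS

section GSsec
variable {H : Type u} [NormedAddCommGroup H] [InnerProductSpace ℂ H] [CompleteSpace H]

/-- the operator `|x⟩⟨x|` -/
def ket (x : H) : H →L[ℂ] H := InnerProductSpace.rankOne ℂ x x

lemma ket_apply (x y : H) : ket x y = ⟪x, y⟫ • x := rfl

lemma ket_smul (c : ℂ) (x : H) : ket (c • x) = (‖c‖ ^ 2 : ℝ) • ket x := by
  ext y
  rw [ket_apply, smul_apply, ket_apply, inner_smul_left, smul_smul,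
    RCLike.real_smul_eq_coe_smul (K := ℂ), smul_smul]
  congr 1
  have : (starRingEnd ℂ) c * c = ((‖c‖ ^ 2 : ℝ) : ℂ) := by
    rw [Complex.conj_mul']; simp
  change _ = ((‖c‖ ^ 2 : ℝ) : ℂ) * _
  rw [← this]; ring

def FQ (m : (H →L[ℂ] H) → ℝ) (x : H) : ℝ := ‖x‖ ^ 2 * m ((‖x‖ ^ 2)⁻¹ • ket x)

lemma FQ_zero (m : (H →L[ℂ] H) → ℝ) : FQ m 0 = 0 := by simp [FQ]

lemma FQ_unit (m : (H →L[ℂ] H) → ℝ) {x : H} (hx : ‖x‖ = 1) : FQ m x = m (ket x) := by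
  simp [FQ, hx]

lemma FQ_smul (m : (H →L[ℂ] H) → ℝ) (c : ℂ) (x : H) : FQ m (c • x) = ‖c‖ ^ 2 * FQ m x := by
  by_cases hc : c = 0
  · simp [hc, FQ_zero]
  have : ‖c‖ ^ 2 ≠ 0 := pow_ne_zero _ (norm_ne_zero_iff.2 hc)
  unfold FQ
  rw [ket_smul, norm_smul, smul_smul, mul_pow, mul_inv, mul_comm (‖c‖ ^ 2)⁻¹,
    mul_assoc (‖x‖ ^ 2)⁻¹, inv_mul_cancel₀ this, mul_one, mul_assoc]

lemma ket_proj {x : H} (hx : ‖x‖ = 1) : IsStarProjection (ket x) := by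
  have hxx : ⟪x, x⟫ = 1 := by rw [inner_self_eq_norm_sq_to_K, hx]; simp
  refine ⟨?_, ?_⟩
  · ext y
    change ket x (ket x y) = ket x y
    rw [ket_apply, ket_apply, inner_smul_right, hxx, mul_one]
  · change adjoint (ket x) = ket x
    exact InnerProductSpace.adjoint_rankOne x x

lemma FQ_bound {m : (H →L[ℂ] H) → ℝ} {C : ℝ} (hm : PM m C) (x : H) : |FQ m x| ≤ C * ‖x‖ ^ 2 := by
  by_cases hx : x = 0
  · simp [hx, FQ_zero]
  have hn : ‖x‖ ≠ 0 := norm_ne_zero_iff.2 hx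
  unfold FQ
  rw [abs_mul, abs_of_nonneg (sq_nonneg _), mul_comm C]
  refine mul_le_mul_of_nonneg_left (hm.bdd _ ?_) (sq_nonneg _)
  have h := ket_smul ((‖x‖⁻¹ : ℝ) : ℂ) x
  rw [Complex.norm_real, norm_inv, norm_norm, inv_pow] at h
  rw [← h]
  apply ket_proj
  rw [norm_smul, Complex.norm_real, norm_inv, norm_norm, inv_mul_cancel₀ hn]

lemma exists_perp (hdim : 2 < Module.rank ℂ H) (x y : H) :
    ∃ z : H, ‖z‖ = 1 ∧ ⟪x, z⟫ = 0 ∧ ⟪y, z⟫ = 0 := by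
  classical
  let M : Submodule ℂ H := Submodule.span ℂ {x, y}
  haveI : FiniteDimensional ℂ M := FiniteDimensional.span_of_finite ℂ (by simp)
  have hM : Mᗮ ≠ ⊥ := by
    intro h
    rw [Submodule.orthogonal_eq_bot_iff] at h
    have h1 : Module.rank ℂ M ≤ Cardinal.mk ({x, y} : Set H) := rank_span_le _
    rw [h, rank_top] at h1
    have h2 : Cardinal.mk ({x, y} : Set H) ≤ 2 := by
      refine (Cardinal.mk_insert_le).trans ?_
      rw [Cardinal.mk_singleton]; norm_num
    exact absurd (h1.trans h2) (not_le.2 hdim)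
  obtain ⟨z, hz, hz0⟩ := Submodule.exists_mem_ne_zero_of_ne_bot hM
  rw [Submodule.mem_orthogonal] at hz
  refine ⟨((‖z‖⁻¹ : ℝ) : ℂ) • z, ?_, ?_, ?_⟩
  · rw [norm_smul, Complex.norm_real, norm_inv, norm_norm,
      inv_mul_cancel₀ (norm_ne_zero_iff.2 hz0)]
  · rw [inner_smul_right, hz x (Submodule.subset_span (by simp)), mul_zero]
  · rw [inner_smul_right, hz y (Submodule.subset_span (by simp)), mul_zero]

section vecK
variable {K : Type u} [NormedAddCommGroup K] [InnerProductSpace ℂ K] [CompleteSpace K]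

lemma rk_iso {k : K} (hk : ∀ y, ⟪k, y⟫ • k = y) {w : H} (hw : ‖w‖ = 1) :
    adjoint (InnerProductSpace.rankOne ℂ w k) ∘L InnerProductSpace.rankOne ℂ w k
      = ContinuousLinearMap.id ℂ K := by
  have hww : ⟪w, w⟫ = 1 := by rw [inner_self_eq_norm_sq_to_K, hw]; simp
  rw [InnerProductSpace.adjoint_rankOne]
  ext y
  change ⟪w, ⟪k, y⟫ • w⟫ • k = y
  rw [inner_smul_right, hww, mul_one, hk]

lemma rk_ort {k : K} {w w' : H} (hw : ⟪w, w'⟫ = 0) :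
    adjoint (InnerProductSpace.rankOne ℂ w k) ∘L InnerProductSpace.rankOne ℂ w' k = 0 := by
  rw [InnerProductSpace.adjoint_rankOne]
  ext y
  change ⟪w, ⟪k, y⟫ • w'⟫ • k = 0
  rw [inner_smul_right, hw, mul_zero, zero_smul]

lemma rk_pr {k : K} (hk : ‖k‖ = 1) (w : H) :
    pr (InnerProductSpace.rankOne ℂ w k) = ket w := by
  have hkk : ⟪k, k⟫ = 1 := by rw [inner_self_eq_norm_sq_to_K, hk]; simp
  unfold pr
  rw [InnerProductSpace.adjoint_rankOne]
  ext y
  change ⟪k, ⟪w, y⟫ • k⟫ • w = ket w y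
  rw [inner_smul_right, hkk, mul_one, ket_apply]

lemma ket_RG {m : (H →L[ℂ] H) → ℝ} {C : ℝ} (hm : PM m C) {k : K} (hk1 : ‖k‖ = 1)
    (hk : ∀ y, ⟪k, y⟫ • k = y) {x y z : H} (hx : ‖x‖ = 1) (hy : ‖y‖ = 1) (hz : ‖z‖ = 1)
    (hxy : ⟪x, y⟫ = 0) (hxz : ⟪x, z⟫ = 0) (hyz : ⟪y, z⟫ = 0) {c s : ℝ} (hcs : c ^ 2 + s ^ 2 = 1) :
    m (ket ((c : ℂ) • x + (s : ℂ) • y)) + m (ket ((c : ℂ) • x - (s : ℂ) • y))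
      = 2 * (c ^ 2 * m (ket x)) + 2 * (s ^ 2 * m (ket y)) := by
  have key := pm_RG hm (Ort3 (rk_iso hk hx) (rk_iso hk hy) (rk_iso hk hz) (rk_ort hxy)
    (rk_ort hxz) (rk_ort hyz)) (q := 1) (IsStarProjection.one _) hcs
  have o1 : ∀ y, (1 : K →L[ℂ] K) y = y := fun y => rfl
  have rs : ∀ (t : ℝ) (w : H), t • w = (t : ℂ) • w :=
    fun t w => RCLike.real_smul_eq_coe_smul (K := ℂ) t w
  have rsK : ∀ (t : ℝ) (w : K), t • w = (t : ℂ) • w :=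
    fun t w => RCLike.real_smul_eq_coe_smul (K := ℂ) t w
  have c1 : col ![InnerProductSpace.rankOne ℂ x k, InnerProductSpace.rankOne ℂ y k,
      InnerProductSpace.rankOne ℂ z k] ![c • (1 : K →L[ℂ] K), s • 1, 0]
      = InnerProductSpace.rankOne ℂ ((c : ℂ) • x + (s : ℂ) • y) k := by
    ext w
    simp only [col, Fin.sum_univ_three, Matrix.cons_val_zero, Matrix.cons_val_one,
      Matrix.cons_val, add_apply, comp_apply, smul_apply, zero_apply, map_zero, add_zero, o1,
      InnerProductSpace.rankOne_apply, rsK, inner_smul_right]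
    module
  have c2 : col ![InnerProductSpace.rankOne ℂ x k, InnerProductSpace.rankOne ℂ y k,
      InnerProductSpace.rankOne ℂ z k] ![c • (1 : K →L[ℂ] K), -(s • 1), 0]
      = InnerProductSpace.rankOne ℂ ((c : ℂ) • x - (s : ℂ) • y) k := by
    ext w
    simp only [col, Fin.sum_univ_three, Matrix.cons_val_zero, Matrix.cons_val_one,
      Matrix.cons_val, add_apply, comp_apply, smul_apply, zero_apply, map_zero, add_zero, o1,
      InnerProductSpace.rankOne_apply, rsK, inner_smul_right, neg_apply, inner_neg_right]
    module
  have c3 : ∀ X : K →L[ℂ] H, X ∘L (1 : K →L[ℂ] K) = X := fun X => rfl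
  rw [c1, c2] at key
  simp only [Matrix.cons_val_zero, Matrix.cons_val_one, c3] at key
  rwa [rk_pr hk1, rk_pr hk1, rk_pr hk1, rk_pr hk1] at key
end vecK

lemma FQ_unit_par {m : (H →L[ℂ] H) → ℝ} {C : ℝ} (hm : PM m C) (hdim : 2 < Module.rank ℂ H)
    {x y : H} (hx : ‖x‖ = 1) (hy : ‖y‖ = 1) (hxy : ⟪x, y⟫ = 0) {c s : ℝ} (hcs : c ^ 2 + s ^ 2 = 1) :
    FQ m ((c : ℂ) • x + (s : ℂ) • y) + FQ m ((c : ℂ) • x - (s : ℂ) • y)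
      = 2 * (c ^ 2 * FQ m x) + 2 * (s ^ 2 * FQ m y) := by
  obtain ⟨z, hz, hxz, hyz⟩ := exists_perp hdim x y
  have hxx : ⟪x, x⟫ = 1 := by rw [inner_self_eq_norm_sq_to_K, hx]; simp
  have key := ket_RG hm (K := Submodule.span ℂ {x}) (k := ⟨x, Submodule.mem_span_singleton_self x⟩)
    hx (by
      rintro ⟨w, hw⟩
      obtain ⟨t, rfl⟩ := Submodule.mem_span_singleton.1 hw
      apply Subtype.ext
      change ⟪x, t • x⟫ • x = t • x
      rw [inner_smul_right, hxx, mul_one]) hx hy hz hxy hxz hyz hcs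
  have hyx : ⟪y, x⟫ = 0 := by rw [← inner_conj_symm, hxy, map_zero]
  have nrm : ∀ t : ℝ, c ^ 2 + t ^ 2 = 1 → ‖(c : ℂ) • x + (t : ℂ) • y‖ = 1 := by
    intro t ht
    have h : ‖(c : ℂ) • x + (t : ℂ) • y‖ ^ 2 = 1 := by
      rw [sq, norm_add_sq_eq_norm_sq_add_norm_sq_of_inner_eq_zero (𝕜 := ℂ)]
      · rw [norm_smul, norm_smul, hx, hy, mul_one, mul_one, Complex.norm_real, Complex.norm_real,
          Real.norm_eq_abs, Real.norm_eq_abs, abs_mul_abs_self, abs_mul_abs_self, ← ht]; ring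
      · rw [inner_smul_left, inner_smul_right, hxy]; simp
    exact (pow_eq_one_iff_of_nonneg (norm_nonneg _) two_ne_zero).1 h
  have n2 : ‖(c : ℂ) • x - (s : ℂ) • y‖ = 1 := by
    have := nrm (-s) (by rw [neg_sq, hcs])
    simpa [sub_eq_add_neg] using this
  rw [FQ_unit m (nrm s hcs), FQ_unit m n2, FQ_unit m hx, FQ_unit m hy]
  exact key

lemma FQ_neg (m : (H →L[ℂ] H) → ℝ) (x : H) : FQ m (-x) = FQ m x := by
  have := FQ_smul m (-1) x
  simpa using this

lemma FQ_orth_par {m : (H →L[ℂ] H) → ℝ} {C : ℝ} (hm : PM m C) (hdim : 2 < Module.rank ℂ H)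
    {x y : H} (hxy : ⟪x, y⟫ = 0) :
    FQ m (x + y) + FQ m (x - y) = 2 * FQ m x + 2 * FQ m y := by
  by_cases hx : x = 0
  · simp [hx, FQ_zero, FQ_neg]; ring
  by_cases hy : y = 0
  · simp [hy, FQ_zero]; ring
  have hx' : 0 < ‖x‖ := norm_pos_iff.2 hx
  have hy' : 0 < ‖y‖ := norm_pos_iff.2 hy
  set n : ℝ := Real.sqrt (‖x‖ ^ 2 + ‖y‖ ^ 2) with hn
  have hn2 : n ^ 2 = ‖x‖ ^ 2 + ‖y‖ ^ 2 := Real.sq_sqrt (by positivity)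
  have hnp : 0 < n := Real.sqrt_pos.2 (by positivity)
  have hxC : (‖x‖ : ℂ) ≠ 0 := by exact_mod_cast hx'.ne'
  have hyC : (‖y‖ : ℂ) ≠ 0 := by exact_mod_cast hy'.ne'
  have hnC : (n : ℂ) ≠ 0 := by exact_mod_cast hnp.ne'
  have ex : x = (‖x‖ : ℂ) • ((‖x‖ : ℂ)⁻¹ • x) := by rw [smul_smul, mul_inv_cancel₀ hxC, one_smul]
  have ey : y = (‖y‖ : ℂ) • ((‖y‖ : ℂ)⁻¹ • y) := by rw [smul_smul, mul_inv_cancel₀ hyC, one_smul]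
  have ux : ‖((‖x‖ : ℂ)⁻¹ • x)‖ = 1 := by
    rw [norm_smul, norm_inv, Complex.norm_real, norm_norm, inv_mul_cancel₀ hx'.ne']
  have uy : ‖((‖y‖ : ℂ)⁻¹ • y)‖ = 1 := by
    rw [norm_smul, norm_inv, Complex.norm_real, norm_norm, inv_mul_cancel₀ hy'.ne']
  have key := FQ_unit_par hm hdim ux uy (by
    rw [inner_smul_left, inner_smul_right, hxy]; simp) (c := ‖x‖ / n) (s := ‖y‖ / n) (by
    rw [div_pow, div_pow, ← add_div, hn2, div_self]; positivity)
  have e1 : x + y = (n : ℂ) • (((‖x‖ / n : ℝ) : ℂ) • ((‖x‖ : ℂ)⁻¹ • x)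
      + ((‖y‖ / n : ℝ) : ℂ) • ((‖y‖ : ℂ)⁻¹ • y)) := by
    rw [smul_add, smul_smul, smul_smul, smul_smul, smul_smul]
    push_cast
    rw [show (n : ℂ) * (‖x‖ / n) * (‖x‖ : ℂ)⁻¹ = 1 by field_simp,
      show (n : ℂ) * (‖y‖ / n) * (‖y‖ : ℂ)⁻¹ = 1 by field_simp, one_smul, one_smul]
  have e2 : x - y = (n : ℂ) • (((‖x‖ / n : ℝ) : ℂ) • ((‖x‖ : ℂ)⁻¹ • x)
      - ((‖y‖ / n : ℝ) : ℂ) • ((‖y‖ : ℂ)⁻¹ • y)) := by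
    rw [smul_sub, smul_smul, smul_smul, smul_smul, smul_smul]
    push_cast
    rw [show (n : ℂ) * (‖x‖ / n) * (‖x‖ : ℂ)⁻¹ = 1 by field_simp,
      show (n : ℂ) * (‖y‖ / n) * (‖y‖ : ℂ)⁻¹ = 1 by field_simp, one_smul, one_smul]
  have f1 := FQ_smul m (n : ℂ) (((‖x‖ / n : ℝ) : ℂ) • ((‖x‖ : ℂ)⁻¹ • x)
      + ((‖y‖ / n : ℝ) : ℂ) • ((‖y‖ : ℂ)⁻¹ • y))
  have f2 := FQ_smul m (n : ℂ) (((‖x‖ / n : ℝ) : ℂ) • ((‖x‖ : ℂ)⁻¹ • x)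
      - ((‖y‖ / n : ℝ) : ℂ) • ((‖y‖ : ℂ)⁻¹ • y))
  rw [← e1] at f1
  rw [← e2] at f2
  have f3 := FQ_smul m (‖x‖ : ℂ) ((‖x‖ : ℂ)⁻¹ • x)
  rw [← ex] at f3
  have f4 := FQ_smul m (‖y‖ : ℂ) ((‖y‖ : ℂ)⁻¹ • y)
  rw [← ey] at f4
  simp only [Complex.norm_real, norm_norm, Real.norm_eq_abs, sq_abs] at f1 f2 f3 f4
  rw [f1, f2, f3, f4, ← mul_add, key]
  field_simp

theorem FQ_par {m : (H →L[ℂ] H) → ℝ} {C : ℝ} (hm : PM m C) (hdim : 2 < Module.rank ℂ H)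
    (x y : H) : FQ m (x + y) + FQ m (x - y) = 2 * FQ m x + 2 * FQ m y := by
  obtain ⟨z, hz, hxz, hyz⟩ := exists_perp hdim x y
  have hzx : ⟪z, x⟫ = 0 := by rw [← inner_conj_symm, hxz, map_zero]
  have hzy : ⟪z, y⟫ = 0 := by rw [← inner_conj_symm, hyz, map_zero]
  have hzz : ⟪z, z⟫ = 1 := by rw [inner_self_eq_norm_sq_to_K, hz]; simp
  set α : ℂ := -⟪x, y⟫ with hα
  have k1 := FQ_orth_par hm hdim (x := x + z) (y := y + α • z) (by
    simp only [inner_add_left, inner_add_right, inner_smul_right, hxz, hzy, hzz, hα]; ring)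
  have k2 := FQ_orth_par hm hdim (x := x - z) (y := y - α • z) (by
    simp only [inner_sub_left, inner_sub_right, inner_smul_right, hxz, hzy, hzz, hα]; ring)
  have l1 := FQ_orth_par hm hdim (x := x + y) (y := (1 + α) • z) (by
    simp only [inner_add_left, inner_smul_right, hxz, hyz]; ring)
  have l2 := FQ_orth_par hm hdim (x := x - y) (y := (1 - α) • z) (by
    simp only [inner_sub_left, inner_smul_right, hxz, hyz]; ring)
  have l3 := FQ_orth_par hm hdim (x := x) (y := z) hxz
  have l4 := FQ_orth_par hm hdim (x := y) (y := α • z) (by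
    simp only [inner_smul_right, hyz]; ring)
  rw [FQ_smul] at l1 l2 l4
  rw [show x + z + (y + α • z) = x + y + (1 + α) • z by module,
    show x + z - (y + α • z) = x - y + (1 - α) • z by module] at k1
  rw [show x - z + (y - α • z) = x + y - (1 + α) • z by module,
    show x - z - (y - α • z) = x - y - (1 - α) • z by module] at k2
  have hp := parallelogram_law_with_norm ℂ (1 : ℂ) α
  rw [norm_one] at hp
  have hp' : ‖1 + α‖ ^ 2 * FQ m z + ‖1 - α‖ ^ 2 * FQ m z = 2 * (1 + ‖α‖ ^ 2) * FQ m z := by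
    rw [← add_mul]; congr 1; linarith
  linarith
end GSsec

end partS

section partT

section GTsec
variable {H : Type u} [NormedAddCommGroup H] [InnerProductSpace ℂ H] [CompleteSpace H]

def BQ (F : H → ℝ) (x y : H) : ℝ := (F (x + y) - F (x - y)) / 4

lemma BQ_symm {F : H → ℝ} (hneg : ∀ x, F (-x) = F x) (x y : H) : BQ F x y = BQ F y x := by
  unfold BQ
  rw [add_comm x y, ← hneg (x - y), neg_sub]

lemma BQ_add {F : H → ℝ} (hneg : ∀ x, F (-x) = F x)
    (hpar : ∀ x y, F (x + y) + F (x - y) = 2 * F x + 2 * F y) (x x' y : H) :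
    BQ F (x + x') y = BQ F x y + BQ F x' y := by
  have mid : ∀ a b, BQ F (a + b) y + BQ F (a - b) y = 2 * BQ F a y := by
    intro a b
    have h1 := hpar (a + y) b
    have h2 := hpar (a - y) b
    unfold BQ
    rw [show a + b + y = a + y + b by abel, show a + b - y = a - y + b by abel,
      show a - b + y = a + y - b by abel, show a - b - y = a - y - b by abel]
    linarith
  have hz : BQ F 0 y = 0 := by simp [BQ, hneg]
  have dbl : ∀ a, BQ F (a + a) y = 2 * BQ F a y := by
    intro a
    have := mid a a
    rwa [sub_self, hz, add_zero] at this
  have h := mid ((2 : ℂ)⁻¹ • (x + x')) ((2 : ℂ)⁻¹ • (x - x'))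
  rw [← dbl, show (2 : ℂ)⁻¹ • (x + x') + (2 : ℂ)⁻¹ • (x - x') = x by module,
    show (2 : ℂ)⁻¹ • (x + x') - (2 : ℂ)⁻¹ • (x - x') = x' by module,
    show (2 : ℂ)⁻¹ • (x + x') + (2 : ℂ)⁻¹ • (x + x') = x + x' by module] at h
  exact h.symm

lemma BQ_real {F : H → ℝ} {C : ℝ} (hneg : ∀ x, F (-x) = F x)
    (hpar : ∀ x y, F (x + y) + F (x - y) = 2 * F x + 2 * F y)
    (hb : ∀ x, |F x| ≤ C * ‖x‖ ^ 2) (x : H) :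
    ∃ L : H →L[ℝ] ℝ, ∀ y, L y = BQ F x y := by
  have hadd : ∀ y y', BQ F x (y + y') = BQ F x y + BQ F x y' := by
    intro y y'
    rw [BQ_symm hneg, BQ_add hneg hpar, BQ_symm hneg y, BQ_symm hneg y']
  let f : H →+ ℝ := AddMonoidHom.mk' (fun y => BQ F x y) hadd
  have hC : ∀ x, |F x| ≤ |C| * ‖x‖ ^ 2 := fun x =>
    (hb x).trans (mul_le_mul_of_nonneg_right (le_abs_self C) (sq_nonneg _))
  have hf : Continuous f := by
    refine f.continuous_of_isBounded_nhds_zero (Metric.ball_mem_nhds 0 one_pos) ?_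
    rw [isBounded_iff_forall_norm_le]
    refine ⟨|C| * (‖x‖ + 1) ^ 2, ?_⟩
    rintro _ ⟨y, hy, rfl⟩
    rw [mem_ball_zero_iff] at hy
    change |BQ F x y| ≤ _
    have b1 : |F (x + y)| ≤ |C| * (‖x‖ + 1) ^ 2 := (hC _).trans (by
      gcongr; exact (norm_add_le _ _).trans (by linarith))
    have b2 : |F (x - y)| ≤ |C| * (‖x‖ + 1) ^ 2 := (hC _).trans (by
      gcongr; exact (norm_sub_le _ _).trans (by linarith))
    unfold BQ
    have hp : 0 ≤ |C| * (‖x‖ + 1) ^ 2 := by positivity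
    rw [abs_le] at b1 b2 ⊢
    constructor <;> linarith [b1.1, b1.2, b2.1, b2.2]
  exact ⟨f.toRealLinearMap hf, fun y => rfl⟩

theorem gleason_fin [FiniteDimensional ℂ H] (hdim : 2 < Module.rank ℂ H)
    {m : (H →L[ℂ] H) → ℝ} {C : ℝ} (hm : PM m C) :
    ∃ φ : (H →L[ℂ] H) →L[ℂ] ℂ, ∀ p, IsStarProjection p → φ p = m p := by
  set F := FQ m with hF
  have hneg : ∀ x, F (-x) = F x := FQ_neg m
  have hpar := FQ_par hm hdim
  choose L hL using BQ_real hneg hpar (FQ_bound hm)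
  have hI : ∀ x y, BQ F (Complex.I • x) (Complex.I • y) = BQ F x y := by
    intro x y
    unfold BQ
    rw [← smul_add, ← smul_sub, hF, FQ_smul, FQ_smul]; simp
  have hsm : ∀ (t : ℝ) x y, BQ F x ((t : ℂ) • y) = t * BQ F x y := by
    intro t x y
    rw [← hL, ← hL, show ((t : ℂ) • y) = t • y from (RCLike.real_smul_eq_coe_smul (K := ℂ) t y).symm,
      map_smul, smul_eq_mul]
  have hsm' : ∀ (t : ℝ) x y, BQ F ((t : ℂ) • x) y = t * BQ F x y := by
    intro t x y
    rw [BQ_symm hneg, hsm, BQ_symm hneg]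
  have haddr : ∀ x y y', BQ F x (y + y') = BQ F x y + BQ F x y' := by
    intro x y y'
    rw [← hL, ← hL, ← hL, map_add]
  have hIs : ∀ x y, BQ F x (Complex.I • y) = - BQ F (Complex.I • x) y := by
    intro x y
    rw [← hI, smul_smul, Complex.I_mul_I]
    have := hsm (-1) (Complex.I • x) y
    simpa using this
  have hconj : ∀ (c : ℂ) x y, BQ F x (c • y) = BQ F ((starRingEnd ℂ) c • x) y := by
    intro c x y
    have e1 : c • y = (c.re : ℂ) • y + (c.im : ℂ) • (Complex.I • y) := by
      rw [smul_smul, ← add_smul, Complex.re_add_im]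
    have e2 : (starRingEnd ℂ) c • x = (c.re : ℂ) • x + ((-c.im : ℝ) : ℂ) • (Complex.I • x) := by
      rw [smul_smul, ← add_smul]
      congr 1
      apply Complex.ext <;> simp
    rw [e1, e2, haddr, BQ_add hneg hpar, hsm, hsm, hsm', hsm', hIs]; ring
  have hxx : ∀ x, BQ F x x = F x := by
    intro x
    unfold BQ
    rw [sub_self, ← two_smul ℂ x, hF, FQ_smul, FQ_zero]
    norm_num
  let b := stdOrthonormalBasis ℂ H
  let μ : (H →L[ℂ] H) →ₗ[ℝ] ℝ :=
    { toFun := fun a => ∑ i, L (b i) (a (b i))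
      map_add' := fun a a' => by simp [Finset.sum_add_distrib]
      map_smul' := fun t a => by simp [Finset.mul_sum] }
  haveI : FiniteDimensional ℝ (H →L[ℂ] H) := FiniteDimensional.complexToReal _
  have hμket : ∀ x, μ (ket x) = F x := by
    intro x
    change ∑ i, L (b i) (ket x (b i)) = F x
    have h1 : ∀ i, L (b i) (ket x (b i)) = L x (⟪b i, x⟫ • b i) := by
      intro i
      rw [hL, hL, ket_apply, hconj, inner_conj_symm, BQ_symm hneg]
    rw [Finset.sum_congr rfl fun i _ => h1 i, ← map_sum, b.sum_repr', hL, hxx]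
  obtain ⟨φ, hφ⟩ := exists_clm μ ‖LinearMap.toContinuousLinearMap μ‖ (fun a a' _ _ => map_add μ a a')
    (fun s a _ => by rw [map_smul, smul_eq_mul])
    (fun a _ => (LinearMap.toContinuousLinearMap μ).le_opNorm a)
  refine ⟨φ, fun p hp => ?_⟩
  rw [hφ p hp.2]
  obtain ⟨N, _, rfl⟩ := isStarProjection_iff_eq_starProjection.1 hp
  let c := stdOrthonormalBasis ℂ N
  have hc : N.starProjection = ∑ i, ket (c i : H) := c.starProjection_eq_sum_rankOne
  have hcn : ∀ i, ‖(c i : H)‖ = 1 := fun i => c.orthonormal.1 i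
  rw [hc, map_sum, hm.sum _ (fun i => ket_proj (hcn i)) ?_]
  · congr 1
    refine Finset.sum_congr rfl fun i _ => ?_
    rw [hμket, hF, FQ_unit m (hcn i)]
  · intro i j hij
    have h : ⟪(c i : H), (c j : H)⟫ = 0 := c.orthonormal.2 hij
    ext y
    change ket (c i : H) (ket (c j : H) y) = 0
    rw [ket_apply, ket_apply, inner_smul_right, h, mul_zero, zero_smul]

theorem gleason (hdim : 2 < Module.rank ℂ H) {m : (H →L[ℂ] H) → ℝ} {C : ℝ} (hm : PM m C) :
    ∃ φ : (H →L[ℂ] H) →L[ℂ] ℂ, ∀ p, IsStarProjection p → φ p = m p := by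
  by_cases hfd : FiniteDimensional ℂ H
  · exact gleason_fin hdim hm
  · obtain ⟨w, b, hb⟩ := exists_hilbertBasis ℂ H
    haveI : Infinite w := by
      by_contra h
      rw [not_infinite_iff_finite] at h
      haveI := Fintype.ofFinite w
      exact hfd (Module.Finite.of_basis b.toOrthonormalBasis.toBasis)
    exact gleason_inf b hm
end GTsec

end partT

section partU
open scoped ComplexStarModule
section GUsec
variable {H : Type u} [NormedAddCommGroup H] [InnerProductSpace ℂ H] [CompleteSpace H]

lemma proj_ext {φ ψ : (H →L[ℂ] H) →L[ℂ] ℂ} (h : ∀ p, IsStarProjection p → φ p = ψ p) : φ = ψ := by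
  ext x
  have := vanish (ψ := φ - ψ) (h := 1) (x := x) (IsStarProjection.one _)
    (fun q hq _ => by rw [sub_apply, h q hq, sub_self]) (one_mul x) (mul_one x)
  rwa [sub_apply, sub_eq_zero] at this

lemma gleason_bound {m : (H →L[ℂ] H) → ℝ} {C : ℝ} (hm : PM m C) {φ : (H →L[ℂ] H) →L[ℂ] ℂ}
    (hφ : ∀ p, IsStarProjection p → φ p = m p) (x : H →L[ℂ] H) : ‖φ x‖ ≤ 4 * C * ‖x‖ := by
  have hC := hm.C_nonneg
  have sa : ∀ a, IsSelfAdjoint a → ‖φ a‖ ≤ 2 * C * ‖a‖ := by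
    intro a ha
    refine le_of_forall_pos_le_add fun δ hδ => ?_
    set ε := δ / (‖φ‖ + 2 * C + 1) with hε
    have hpos : 0 < ‖φ‖ + 2 * C + 1 := by positivity
    have hε0 : 0 < ε := div_pos hδ hpos
    obtain ⟨ι, _, q, l, hq, hl⟩ := SRsa a ha ε hε0
    set s := ∑ j, l j • q j with hs
    have h1 : φ s = ((∑ j, l j * m (q j) : ℝ) : ℂ) := by
      rw [hs, map_sum]
      push_cast
      refine Finset.sum_congr rfl fun j _ => ?_
      rw [show l j • q j = (l j : ℂ) • q j from RCLike.real_smul_eq_coe_smul (K := ℂ) _ _,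
        map_smul, hφ _ (hq.proj j), smul_eq_mul]
    have h2 : ‖φ s‖ ≤ 2 * C * ‖s‖ := by
      rw [h1, Complex.norm_real]
      exact CB hm q hq.proj hq.orth l
    have h3 : ‖s‖ ≤ ‖a‖ + ε := by
      have : s = a - (a - s) := by abel
      rw [this]
      exact (norm_sub_le _ _).trans (add_le_add le_rfl hl)
    have h4 : ‖φ a‖ ≤ ‖φ‖ * ε + ‖φ s‖ := by
      have : φ a = φ (a - s) + φ s := by rw [map_sub]; ring
      rw [this]
      refine (norm_add_le _ _).trans (add_le_add ((φ.le_opNorm _).trans ?_) le_rfl)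
      exact mul_le_mul_of_nonneg_left hl (norm_nonneg _)
    have h5 : 2 * C * ‖s‖ ≤ 2 * C * (‖a‖ + ε) := mul_le_mul_of_nonneg_left h3 (by positivity)
    have h6 : (‖φ‖ + 2 * C + 1) * ε = δ := by rw [hε]; field_simp
    nlinarith
  have hx : x = (ℜ x : H →L[ℂ] H) + Complex.I • (ℑ x : H →L[ℂ] H) :=
    (realPart_add_I_smul_imaginaryPart x).symm
  have b0 : ‖(ℜ x : H →L[ℂ] H)‖ ≤ ‖x‖ := realPart.norm_le x
  have b1 : ‖(ℑ x : H →L[ℂ] H)‖ ≤ ‖x‖ := imaginaryPart.norm_le x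
  have e : φ x = φ (ℜ x : H →L[ℂ] H) + Complex.I * φ (ℑ x : H →L[ℂ] H) := by
    conv_lhs => rw [hx]
    rw [map_add, map_smul, smul_eq_mul]
  rw [e]
  refine (norm_add_le _ _).trans ?_
  rw [norm_mul, Complex.norm_I, one_mul]
  have c0 := (sa _ (ℜ x).2).trans (mul_le_mul_of_nonneg_left b0 (by positivity : 0 ≤ 2 * C))
  have c1 := (sa _ (ℑ x).2).trans (mul_le_mul_of_nonneg_left b1 (by positivity : 0 ≤ 2 * C))
  linarith

theorem gleasonC (hdim : 2 < Module.rank ℂ H) (n : (H →L[ℂ] H) → ℂ) (C : ℝ)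
    (hb : ∀ p, IsStarProjection p → ‖n p‖ ≤ C)
    (ha : ∀ p q, IsStarProjection p → IsStarProjection q → p * q = 0 → n (p + q) = n p + n q) :
    ∃ φ : (H →L[ℂ] H) →L[ℂ] ℂ, (∀ p, IsStarProjection p → φ p = n p) ∧
      ∀ x, ‖φ x‖ ≤ 8 * C * ‖x‖ := by
  have h1 : PM (fun p => (n p).re) C := ⟨fun p hp => (Complex.abs_re_le_norm _).trans (hb p hp),
    fun p q hp hq hpq => by simp only [ha p q hp hq hpq, Complex.add_re]⟩
  have h2 : PM (fun p => (n p).im) C := ⟨fun p hp => (Complex.abs_im_le_norm _).trans (hb p hp),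
    fun p q hp hq hpq => by simp only [ha p q hp hq hpq, Complex.add_im]⟩
  obtain ⟨φ, hφ⟩ := gleason hdim h1
  obtain ⟨ψ, hψ⟩ := gleason hdim h2
  refine ⟨φ + Complex.I • ψ, fun p hp => ?_, fun x => ?_⟩
  · rw [add_apply, smul_apply, hφ p hp, hψ p hp, smul_eq_mul, mul_comm, Complex.re_add_im]
  · rw [add_apply, smul_apply, smul_eq_mul]
    refine (norm_add_le _ _).trans ?_
    rw [norm_mul, Complex.norm_I, one_mul]
    linarith [gleason_bound h1 hφ x, gleason_bound h2 hψ x]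

theorem bil_ext {D D' : (H →L[ℂ] H) →ₗ[ℂ] (H →L[ℂ] H) →ₗ[ℂ] ℂ} {C C' : ℝ}
    (hD : ∀ x y, ‖D x y‖ ≤ C * ‖x‖ * ‖y‖) (hD' : ∀ x y, ‖D' x y‖ ≤ C' * ‖x‖ * ‖y‖)
    (h : ∀ p q, IsStarProjection p → IsStarProjection q → D p q = D' p q) : D = D' := by
  have h1 : ∀ p, IsStarProjection p → ∀ y, D p y = D' p y := by
    intro p hp y
    have := proj_ext (φ := (D p).mkContinuous (C * ‖p‖) (hD p))
      (ψ := (D' p).mkContinuous (C' * ‖p‖) (hD' p)) (fun q hq => h p q hp hq)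
    exact DFunLike.congr_fun this y
  ext x y
  have := proj_ext (φ := (D.flip y).mkContinuous (C * ‖y‖) (fun x => (hD x y).trans_eq (by ring)))
      (ψ := (D'.flip y).mkContinuous (C' * ‖y‖) (fun x => (hD' x y).trans_eq (by ring)))
      (fun q hq => h1 q hq y)
  exact DFunLike.congr_fun this x

theorem bil_exists (hdim : 2 < Module.rank ℂ H) (d : (H →L[ℂ] H) → (H →L[ℂ] H) → ℂ) (C : ℝ)
    (hb : ∀ p q, IsStarProjection p → IsStarProjection q → ‖d p q‖ ≤ C)
    (hl : ∀ p p' q, IsStarProjection p → IsStarProjection p' → IsStarProjection q → p * p' = 0 →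
      d (p + p') q = d p q + d p' q)
    (hr : ∀ p q q', IsStarProjection p → IsStarProjection q → IsStarProjection q' → q * q' = 0 →
      d p (q + q') = d p q + d p q') :
    ∃ D : (H →L[ℂ] H) →ₗ[ℂ] (H →L[ℂ] H) →ₗ[ℂ] ℂ,
      (∃ C' : ℝ, ∀ x y, ‖D x y‖ ≤ C' * ‖x‖ * ‖y‖) ∧
      ∀ p q, IsStarProjection p → IsStarProjection q → D p q = d p q := by
  have step1 : ∀ q, ∃ φ : (H →L[ℂ] H) →L[ℂ] ℂ, IsStarProjection q →
      (∀ p, IsStarProjection p → φ p = d p q) ∧ ∀ x, ‖φ x‖ ≤ 8 * C * ‖x‖ := by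
    intro q
    by_cases hq : IsStarProjection q
    · obtain ⟨φ, hφ⟩ := gleasonC hdim (fun p => d p q) C (fun p hp => hb p q hp hq)
        (fun p p' hp hp' h => hl p p' q hp hp' hq h)
      exact ⟨φ, fun _ => hφ⟩
    · exact ⟨0, fun h => absurd h hq⟩
  choose Φ hΦ using step1
  have hΦadd : ∀ q q', IsStarProjection q → IsStarProjection q' → q * q' = 0 →
      Φ (q + q') = Φ q + Φ q' := by
    intro q q' hq hq' h
    have hqq : IsStarProjection (q + q') := hq.add hq' h
    refine proj_ext fun p hp => ?_
    rw [add_apply, (hΦ _ hqq).1 p hp, (hΦ _ hq).1 p hp, (hΦ _ hq').1 p hp, hr p q q' hp hq hq' h]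
  have step2 : ∀ x, ∃ ψ : (H →L[ℂ] H) →L[ℂ] ℂ, (∀ q, IsStarProjection q → ψ q = Φ q x) ∧
      ∀ y, ‖ψ y‖ ≤ 8 * (8 * C * ‖x‖) * ‖y‖ := fun x =>
    gleasonC hdim (fun q => Φ q x) (8 * C * ‖x‖) (fun q hq => (hΦ q hq).2 x)
      (fun q q' hq hq' h => by rw [hΦadd q q' hq hq' h, add_apply])
  choose Ψ hΨ using step2
  have hΨa : ∀ x x', Ψ (x + x') = Ψ x + Ψ x' := fun x x' => proj_ext fun q hq => by
    rw [add_apply, (hΨ _).1 q hq, (hΨ _).1 q hq, (hΨ _).1 q hq, map_add]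
  have hΨs : ∀ (c : ℂ) x, Ψ (c • x) = c • Ψ x := fun c x => proj_ext fun q hq => by
    rw [smul_apply, (hΨ _).1 q hq, (hΨ _).1 q hq, map_smul]
  refine ⟨LinearMap.mk₂ ℂ (fun x y => Ψ x y) (fun x x' y => by rw [hΨa, add_apply])
    (fun c x y => by rw [hΨs, smul_apply]) (fun x y y' => map_add _ _ _)
    (fun c x y => map_smul _ _ _), ⟨64 * C, fun x y => ?_⟩, fun p q hp hq => ?_⟩
  · rw [LinearMap.mk₂_apply]
    exact ((hΨ x).2 y).trans_eq (by ring)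
  · rw [LinearMap.mk₂_apply, (hΨ p).1 q hq, (hΦ q hq).1 p hp]
end GUsec

end partU

/-- A decoherence functional `d` on a Hilbert space which is
infinite dimensional or of finite dimension greater than two extends (uniquely)
to a bounded bilinear form on `B(𝔥) × B(𝔥)` iff `d` is bounded. -/
theorem stmt_0 (hdim : 2 < Module.rank ℂ E)
    (d : (E →L[ℂ] E) → (E →L[ℂ] E) → ℂ) (hd : IsDecoherenceFunctional d) :
    (∃! D : (E →L[ℂ] E) →ₗ[ℂ] (E →L[ℂ] E) →ₗ[ℂ] ℂ,
        IsBoundedBilinear D ∧ ExtendsDF D d) ↔ DFBounded d := by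
  have toS : ∀ p : E →L[ℂ] E, IsStarProjection p → IsOrthoProj p := fun p h => ⟨h.1, h.2⟩
  have ofS : ∀ p : E →L[ℂ] E, IsOrthoProj p → IsStarProjection p := fun p h => ⟨h.1, h.2⟩
  constructor
  · rintro ⟨D, ⟨⟨C, hC⟩, hext⟩, -⟩
    refine ⟨|C|, fun p q hp hq => ?_⟩
    rw [← hext p q hp hq]
    have hpn : ‖p‖ ≤ 1 := (ofS p hp).norm_le
    have hqn : ‖q‖ ≤ 1 := (ofS q hq).norm_le
    calc ‖D p q‖ ≤ C * ‖p‖ * ‖q‖ := hC p q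
      _ ≤ |C| * 1 * 1 := by
          gcongr
          exact le_abs_self C
      _ = |C| := by ring
  · rintro ⟨C, hC⟩
    obtain ⟨D, ⟨C', hC'⟩, hD⟩ := bil_exists hdim d C
      (fun p q hp hq => hC p q (toS p hp) (toS q hq))
      (fun p p' q hp hp' hq h => hd.orthoadd p p' q (toS _ hp) (toS _ hp') (toS _ hq) h)
      (fun p q q' hp hq hq' h => by
        rw [hd.hermitian p (q+q') (toS _ hp) (toS _ (hq.add hq' h)),
          hd.orthoadd q q' p (toS _ hq) (toS _ hq') (toS _ hp) h, map_add,
          ← hd.hermitian p q (toS _ hp) (toS _ hq), ← hd.hermitian p q' (toS _ hp) (toS _ hq')])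
    refine ⟨D, ⟨⟨C', hC'⟩, fun p q hp hq => hD p q (ofS p hp) (ofS q hq)⟩, ?_⟩
    rintro D' ⟨⟨C'', h''⟩, hext'⟩
    exact bil_ext h'' hC'
      (fun p q hp hq => by rw [hext' p q (toS p hp) (toS q hq), hD p q hp hq])
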